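/- Let k be an algebraically closed field and let f ∈ k[x₀,x₁,x₂] be an irreducible homogeneous polynomial of positive total degree. Suppose there exists a line L ⊂ ℙ² with V(f) ∖ L ≅ 𝔸¹; concretely, suppose there is an invertible 3×3 matrix M over k such that, letting f' be the polynomial obtained from f by the linear substitution x_i ↦ Σ_j M_{ij} x_j, the quotient k-algebra k[x₀,x₁] / (f'(x₀,x₁,1)) is isomorphic to the polynomial ring k[t]. Then every irreducible homogeneous g ∈ k[x₀,x₁,x₂] for which the degree-zero localization rings A_f and A_g are isomorphic as k-algebras is projectively equivalent to f. -/

import Mathlib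

open MvPolynomial

attribute [local instance] MvPolynomial.gradedAlgebra

/-- The degree-zero part `A_f` of the localization of `k[x₀,x₁,x₂]` away from `f`,
i.e. the coordinate ring of the affine variety `ℙ² ∖ V(f)`. -/
noncomputable abbrev AwayRing (k : Type) [Field k] (f : MvPolynomial (Fin 3) k) : Type :=
  HomogeneousLocalization.Away (homogeneousSubmodule (Fin 3) k) f

noncomputable instance (k : Type) [Field k] (f : MvPolynomial (Fin 3) k) :
    Algebra k (AwayRing k f) :=
  ((algebraMap (homogeneousSubmodule (Fin 3) k 0) (AwayRing k f)).comp
    (algebraMap k (homogeneousSubmodule (Fin 3) k 0))).toAlgebra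

/-- Two (homogeneous) polynomials are projectively equivalent if a linear change of
coordinates by an invertible matrix sends one to a nonzero scalar multiple of the other. -/
def ProjEquiv {k : Type} [Field k] (f g : MvPolynomial (Fin 3) k) : Prop :=
  ∃ N : Matrix (Fin 3) (Fin 3) k, IsUnit N.det ∧ ∃ c : kˣ,
    aeval (fun i => ∑ j, C (N i j) * X j) f = (c : k) • g

open MvPolynomial
namespace Yosh
open scoped Polynomial

structure ZVal (k K : Type) [Field k] [Field K] [Algebra k K] where
  v : K → ℤ
  map_mul' : ∀ a b, a ≠ 0 → b ≠ 0 → v (a * b) = v a + v b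
  map_add' : ∀ a b, a ≠ 0 → b ≠ 0 → a + b ≠ 0 → min (v a) (v b) ≤ v (a + b)
  map_const' : ∀ c : k, c ≠ 0 → v (algebraMap k K c) = 0

namespace ZVal
variable {k K : Type} [Field k] [Field K] [Algebra k K] (V : ZVal k K)

/-- `a` has value at least `n` (or is zero). -/
def Ge (n : ℤ) (a : K) : Prop := a ≠ 0 → n ≤ V.v a

lemma ge_zero (n : ℤ) : V.Ge n 0 := fun h => absurd rfl h

lemma Ge.mono {V : ZVal k K} {n m : ℤ} {a : K} (h : V.Ge n a) (hm : m ≤ n) : V.Ge m a :=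
  fun ha => hm.trans (h ha)

lemma ge_self (a : K) : V.Ge (V.v a) a := fun _ => le_rfl

lemma Ge.add {V : ZVal k K} {n : ℤ} {a b : K} (ha : V.Ge n a) (hb : V.Ge n b) : V.Ge n (a + b) := by
  intro h
  by_cases h1 : a = 0
  · subst h1; rw [zero_add] at h ⊢; exact hb h
  by_cases h2 : b = 0
  · subst h2; rw [add_zero] at h ⊢; exact ha h
  exact (le_min (ha h1) (hb h2)).trans (V.map_add' a b h1 h2 h)

lemma Ge.mul {V : ZVal k K} {n m : ℤ} {a b : K} (ha : V.Ge n a) (hb : V.Ge m b) :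
    V.Ge (n + m) (a * b) := by
  intro h
  have h1 := left_ne_zero_of_mul h
  have h2 := right_ne_zero_of_mul h
  rw [V.map_mul' _ _ h1 h2]
  exact add_le_add (ha h1) (hb h2)

lemma map_one : V.v 1 = 0 := by
  have := V.map_const' 1 one_ne_zero
  rwa [_root_.map_one] at this

lemma map_mul {a b : K} (ha : a ≠ 0) (hb : b ≠ 0) : V.v (a * b) = V.v a + V.v b :=
  V.map_mul' a b ha hb

lemma map_inv (a : K) (ha : a ≠ 0) : V.v a⁻¹ = - V.v a := by
  have := V.map_mul' a a⁻¹ ha (inv_ne_zero ha)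
  rw [mul_inv_cancel₀ ha, V.map_one] at this
  omega

lemma map_div {a b : K} (ha : a ≠ 0) (hb : b ≠ 0) : V.v (a / b) = V.v a - V.v b := by
  rw [div_eq_mul_inv, V.map_mul ha (inv_ne_zero hb), V.map_inv b hb, sub_eq_add_neg]

lemma map_pow (a : K) (ha : a ≠ 0) (n : ℕ) : V.v (a ^ n) = n * V.v a := by
  induction n with
  | zero => simp [V.map_one]
  | succ n ih =>
    rw [pow_succ, V.map_mul (pow_ne_zero n ha) ha, ih]; push_cast; ring

lemma map_zpow (a : K) (ha : a ≠ 0) (n : ℤ) : V.v (a ^ n) = n * V.v a := by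
  cases n with
  | ofNat n => simpa using V.map_pow a ha n
  | negSucc n =>
    rw [zpow_negSucc, V.map_inv _ (pow_ne_zero _ ha), V.map_pow a ha]
    rw [Int.negSucc_eq]; push_cast; ring

lemma ge_const (c : k) : V.Ge 0 (algebraMap k K c) := by
  intro h
  have : c ≠ 0 := by rintro rfl; simp at h
  rw [V.map_const' c this]

lemma ge_one : V.Ge 0 (1 : K) := by
  intro _; rw [V.map_one]

lemma Ge.pow {V : ZVal k K} {n : ℤ} {a : K} (ha : V.Ge n a) (i : ℕ) : V.Ge (i * n) (a ^ i) := by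
  intro h
  by_cases h0 : a = 0
  · subst h0
    rcases Nat.eq_zero_or_pos i with rfl | hi
    · simp [V.map_one]
    · exact absurd (zero_pow hi.ne') h
  · rw [V.map_pow a h0]
    exact mul_le_mul_of_nonneg_left (ha h0) (by positivity)

lemma Ge.pow0 {V : ZVal k K} {a : K} (ha : V.Ge 0 a) (i : ℕ) : V.Ge 0 (a ^ i) := by
  simpa using ha.pow i

lemma Ge.mul0 {V : ZVal k K} {a b : K} (ha : V.Ge 0 a) (hb : V.Ge 0 b) : V.Ge 0 (a * b) := by
  simpa using ha.mul hb

lemma Ge.const_mul {V : ZVal k K} {n : ℤ} {a : K} (ha : V.Ge n a) (c : k) :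
    V.Ge n (algebraMap k K c * a) := by
  simpa using (V.ge_const c).mul ha

lemma Ge.smul {V : ZVal k K} {n : ℤ} {a : K} (ha : V.Ge n a) (c : k) : V.Ge n (c • a) := by
  rw [Algebra.smul_def]; exact ha.const_mul c

lemma Ge.neg {V : ZVal k K} {n : ℤ} {a : K} (ha : V.Ge n a) : V.Ge n (-a) := by
  have := ha.const_mul (-1)
  simpa using this

lemma Ge.sub {V : ZVal k K} {n : ℤ} {a b : K} (ha : V.Ge n a) (hb : V.Ge n b) : V.Ge n (a - b) := by
  rw [sub_eq_add_neg]; exact ha.add hb.neg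

lemma Ge.sum {V : ZVal k K} {ι : Type*} {n : ℤ} (s : Finset ι) (a : ι → K)
    (h : ∀ i ∈ s, V.Ge n (a i)) : V.Ge n (∑ i ∈ s, a i) := by
  classical
  induction s using Finset.induction_on with
  | empty => simpa using V.ge_zero n
  | insert i s hi ih =>
    rw [Finset.sum_insert hi]
    exact (h i (Finset.mem_insert_self _ _)).add
      (ih fun j hj => h j (Finset.mem_insert_of_mem hj))

lemma Ge.prod0 {V : ZVal k K} {ι : Type*} (s : Finset ι) (a : ι → K)
    (h : ∀ i ∈ s, V.Ge 0 (a i)) : V.Ge 0 (∏ i ∈ s, a i) := by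
  classical
  induction s using Finset.induction_on with
  | empty => simpa using V.ge_one
  | insert i s hi ih =>
    rw [Finset.prod_insert hi]
    exact (h i (Finset.mem_insert_self _ _)).mul0
      (ih fun j hj => h j (Finset.mem_insert_of_mem hj))

lemma map_neg (a : K) : V.v (-a) = V.v a := by
  by_cases h : a = 0
  · subst h; simp
  have := V.map_mul (a := -1) (b := a) (by simp) h
  have h2 := V.map_const' (-1) (by simp)
  simp at h2
  rw [neg_one_mul, h2] at this; simpa using this

/-- strict domination. -/
lemma map_add_of_lt {a b : K} (ha : a ≠ 0) (hb : V.Ge (V.v a + 1) b) :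
    a + b ≠ 0 ∧ V.v (a + b) = V.v a := by
  have hne : a + b ≠ 0 := by
    intro h
    have hb' : b = -a := by linear_combination h
    have := hb (by rw [hb']; simpa using ha)
    rw [hb', V.map_neg] at this; omega
  refine ⟨hne, le_antisymm ?_ ?_⟩
  · by_contra hlt
    push Not at hlt
    have h1 : V.Ge (V.v a + 1) (a + b) := fun _ => by omega
    have h2 := (h1.sub hb) (by simpa using ha)
    rw [add_sub_cancel_right] at h2; omega
  · exact ((V.ge_self a).add (hb.mono (by omega))) hne

/-- Evaluation of a polynomial at an element of nonnegative value. -/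
lemma ge_aeval (r : K) (hr : V.Ge 0 r) (p : k[X]) : V.Ge 0 (Polynomial.aeval r p) := by
  rw [Polynomial.aeval_eq_sum_range]
  exact Ge.sum _ _ fun i _ => (hr.pow0 i).smul _

/-- Residue lemma. -/
lemma residue [IsAlgClosed k] (r : K) (hr : V.Ge 0 r)
    (hc : ∀ c : k, r - algebraMap k K c ≠ 0 ∧ V.v (r - algebraMap k K c) ≤ 0)
    (p : k[X]) (hp : p ≠ 0) : Polynomial.aeval r p ≠ 0 ∧ V.v (Polynomial.aeval r p) = 0 := by
  induction h : p.natDegree using Nat.strong_induction_on generalizing p with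
  | _ n ih =>
  by_cases hd : p.degree = 0
  · rw [Polynomial.eq_C_of_degree_eq_zero hd]
    have : p.coeff 0 ≠ 0 := by
      intro h0
      rw [Polynomial.eq_C_of_degree_eq_zero hd, h0] at hp; simp at hp
    rw [Polynomial.aeval_C]
    exact ⟨by simpa using this, V.map_const' _ this⟩
  · obtain ⟨c, hroot⟩ := IsAlgClosed.exists_root p hd
    obtain ⟨q, rfl⟩ := Polynomial.dvd_iff_isRoot.mpr hroot
    have hq : q ≠ 0 := right_ne_zero_of_mul hp
    have hnd : q.natDegree < n := by
      rw [← h, Polynomial.natDegree_mul (Polynomial.X_sub_C_ne_zero c) hq]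
      simp
    obtain ⟨h1, h2⟩ := ih _ hnd q hq rfl
    obtain ⟨h3, h4⟩ := hc c
    rw [_root_.map_mul, _root_.map_sub, Polynomial.aeval_X, Polynomial.aeval_C]
    refine ⟨mul_ne_zero h3 h1, ?_⟩
    rw [V.map_mul h3 h1, h2]
    have := (hr.sub (V.ge_const c)) h3
    omega

end ZVal

section LL
variable {k K : Type} [Field k] [Field K] [Algebra k K]

/-- evaluation of a polynomial in two variables (`X` inner, outer). -/
noncomputable def ev {R : Type} [CommRing R] [Algebra k R] (s t : R) : k[X][X] →+* R :=
  Polynomial.eval₂RingHom (Polynomial.aeval (R := k) s : k[X] →+* R) t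

lemma ev_C {R : Type} [CommRing R] [Algebra k R] (s t : R) (p : k[X]) :
    ev s t (Polynomial.C p) = Polynomial.aeval s p := by
  simp [ev]

lemma ev_X {R : Type} [CommRing R] [Algebra k R] (s t : R) :
    ev (k := k) s t (Polynomial.X) = t := by
  simp [ev]

lemma ev_CX {R : Type} [CommRing R] [Algebra k R] (s t : R) :
    ev (k := k) s t (Polynomial.C Polynomial.X) = s := by
  simp [ev]

lemma ev_CC {R : Type} [CommRing R] [Algebra k R] (s t : R) (c : k) :
    ev (k := k) s t (Polynomial.C (Polynomial.C c)) = algebraMap k R c := by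
  simp [ev]

/-- blow-up map `A(S,T) ↦ A(ST,T)`. -/
noncomputable def blow : k[X][X] →+* k[X][X] :=
  Polynomial.eval₂RingHom (Polynomial.aeval (R := k) (Polynomial.C Polynomial.X * Polynomial.X : k[X][X]) : k[X] →+* k[X][X])
    Polynomial.X

lemma ev_hom_ext {R : Type} [CommRing R] (f g : k[X][X] →+* R)
    (h1 : ∀ c : k, f (Polynomial.C (Polynomial.C c)) = g (Polynomial.C (Polynomial.C c)))
    (h2 : f (Polynomial.C Polynomial.X) = g (Polynomial.C Polynomial.X))
    (h3 : f Polynomial.X = g Polynomial.X) : f = g := by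
  apply Polynomial.ringHom_ext _ h3
  intro p
  have : f.comp (Polynomial.C) = g.comp (Polynomial.C) := by
    apply Polynomial.ringHom_ext <;> simpa
  exact RingHom.congr_fun this p

lemma ev_blow (s t : K) (A : k[X][X]) : ev s t (blow A) = ev (s * t) t A := by
  have : (ev s t).comp blow = ev (k := k) (s * t) t := by
    apply ev_hom_ext
    · intro c; simp [blow, ev]
    · simp [blow, ev]
    · simp [blow, ev]
  exact RingHom.congr_fun this A

lemma coeff_blow (A : k[X][X]) (n i : ℕ) :
    ((blow A).coeff n).coeff i = if i ≤ n then (A.coeff (n - i)).coeff i else 0 := by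
  induction A using Polynomial.induction_on' with
  | add p q hp hq => 
    rw [_root_.map_add, Polynomial.coeff_add, Polynomial.coeff_add, hp, hq]
    split_ifs <;> simp
  | monomial j a =>
    induction a using Polynomial.induction_on' with
    | add p q hp hq =>
      rw [_root_.map_add, _root_.map_add, Polynomial.coeff_add, Polynomial.coeff_add, hp, hq]
      split_ifs <;> simp
    | monomial l c =>
      have : blow (Polynomial.monomial j (Polynomial.monomial l c)) =
          Polynomial.monomial (l + j) (Polynomial.monomial l c) := by
        rw [blow, Polynomial.coe_eval₂RingHom, Polynomial.eval₂_monomial]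
        simp only [RingHom.coe_coe, Polynomial.aeval_monomial, mul_pow]
        rw [← Polynomial.C_mul_X_pow_eq_monomial, ← Polynomial.C_mul_X_pow_eq_monomial]
        simp [Polynomial.algebraMap_eq, Polynomial.algebraMap_apply]
        ring
      rw [this, Polynomial.coeff_monomial, Polynomial.coeff_monomial]
      by_cases h1 : l + j = n
      · subst h1
        simp only [if_true]
        by_cases h2 : i = l
        · subst h2; simp
        · have : ¬ l = i := fun h => h2 h.symm
          rw [Polynomial.coeff_monomial]
          simp only [this, if_false]
          split_ifs <;> simp [Polynomial.coeff_monomial, this]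
      · simp only [h1, if_false, Polynomial.coeff_zero]
        split_ifs with h2 h3
        · rw [Polynomial.coeff_monomial, if_neg]; omega
        · simp
        · simp


/-- Jacobian determinant with respect to two derivations. -/
def Jac (D0 D1 : Derivation k K K) (a b : K) : K := D0 a * D1 b - D1 a * D0 b

variable (D0 D1 : Derivation k K K)

lemma Jac_sub_const (a b : K) (c : k) : Jac D0 D1 (a - algebraMap k K c) b = Jac D0 D1 a b := by
  simp [Jac]

lemma Jac_mul_left (a b c : K) : Jac D0 D1 (a * b) c = a * Jac D0 D1 b c + b * Jac D0 D1 a c := by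
  simp [Jac]; ring

lemma Jac_mul_right (a b c : K) : Jac D0 D1 c (a * b) = a * Jac D0 D1 c b + b * Jac D0 D1 c a := by
  simp [Jac]; ring

lemma Jac_self (a : K) : Jac D0 D1 a a = 0 := by simp [Jac]; ring

lemma Jac_swap (a b : K) : Jac D0 D1 a b = - Jac D0 D1 b a := by simp [Jac]; ring

lemma Jac_div_self (s t : K) (ht : t ≠ 0) : Jac D0 D1 (s / t) t = Jac D0 D1 s t / t := by
  have h : s = s / t * t := by field_simp
  have h2 : Jac D0 D1 s t = t * Jac D0 D1 (s / t) t := by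
    conv_lhs => rw [h, Jac_mul_left, Jac_self]
    ring
  rw [h2]; field_simp

lemma Jac_self_div (s t : K) (hs : s ≠ 0) : Jac D0 D1 s (t / s) = Jac D0 D1 s t / s := by
  rw [Jac_swap, Jac_div_self _ _ _ _ hs, Jac_swap _ _ t]; ring

lemma Jac_zero_right (s : K) : Jac D0 D1 s 0 = 0 := by simp [Jac]
lemma Jac_zero_left (s : K) : Jac D0 D1 0 s = 0 := by simp [Jac]

lemma ge_ev (V : ZVal k K) (s t : K) (hs : V.Ge 0 s) (ht : V.Ge 0 t) (A : k[X][X]) :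
    V.Ge 0 (ev s t A) := by
  rw [ev, Polynomial.coe_eval₂RingHom, Polynomial.eval₂_eq_sum_range]
  refine ZVal.Ge.sum _ _ fun i _ => ?_
  exact (V.ge_aeval s hs _).mul0 (ht.pow0 i)

lemma ev_eq (s t : K) (A : k[X][X]) :
    ev s t A = Polynomial.aeval s (A.coeff 0) + t * ev s t A.divX := by
  conv_lhs => rw [← Polynomial.divX_mul_X_add A]
  rw [_root_.map_add, _root_.map_mul, ev_X, ev_C]; ring

/-- The local lemma. -/
theorem LL [IsAlgClosed k] (V : ZVal k K) (ω : ℤ)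
    (hlog : ∀ a b, a ≠ 0 → b ≠ 0 → Jac D0 D1 a b ≠ 0 → V.v a + V.v b ≤ V.v (Jac D0 D1 a b) + ω)
    (s t : K) (hJ : Jac D0 D1 s t ≠ 0) (hs : 0 < V.v s) (ht : 0 < V.v t)
    (A : k[X][X]) (o : ℕ) (ho : (A.coeff 0).coeff o ≠ 0) (hA : ev s t A ≠ 0) :
    V.v (ev s t A) ≤ o * (V.v (Jac D0 D1 s t) + ω - V.v t) := by
  induction hn : (V.v (Jac D0 D1 s t) + ω).toNat using Nat.strong_induction_on
    generalizing s t A o with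
  | _ n ih =>
  have hs0 : s ≠ 0 := by rintro rfl; exact hJ (Jac_zero_left _ _ _)
  have ht0 : t ≠ 0 := by rintro rfl; exact hJ (Jac_zero_right _ _ _)
  have hΩ := hlog s t hs0 ht0 hJ
  set Ω := V.v (Jac D0 D1 s t) + ω with hΩdef
  rcases lt_or_ge (V.v s) (V.v t) with hlt | hge
  · -- second chart
    have hJ1 := Jac_self_div D0 D1 s t hs0
    have hJ1' : Jac D0 D1 s (t / s) ≠ 0 := by rw [hJ1]; exact div_ne_zero hJ hs0
    have hv1 : V.v (Jac D0 D1 s (t / s)) = V.v (Jac D0 D1 s t) - V.v s := by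
      rw [hJ1, V.map_div hJ hs0]
    have hvt : V.v (t / s) = V.v t - V.v s := V.map_div ht0 hs0
    have hev : ev s (t / s) (A.comp (Polynomial.C Polynomial.X * Polynomial.X)) = ev s t A := by
      have : (ev s (t / s)).comp (Polynomial.compRingHom
          (Polynomial.C Polynomial.X * Polynomial.X)) = ev (k := k) s t := by
        apply ev_hom_ext
        · intro c; simp [ev]
        · simp [ev]
        · simp [ev]; field_simp
      exact RingHom.congr_fun this A
    have := ih (V.v (Jac D0 D1 s (t / s)) + ω).toNat (by omega) s (t / s) hJ1' hs (by omega)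
      (A.comp (Polynomial.C Polynomial.X * Polynomial.X)) o
      (by rw [Polynomial.comp_C_mul_X_coeff]; simpa using ho) (by rw [hev]; exact hA) rfl
    rw [hev, hv1, hvt] at this
    convert this using 2
    rw [hΩdef]; ring
  · -- first chart
    have hB0 : blow A ≠ 0 := by
      intro h
      have := coeff_blow A o o
      rw [h] at this; simp at this; exact ho this.symm
    set ν := (blow A).natTrailingDegree with hν
    obtain ⟨A1, hA1⟩ : ∃ A1, blow A = Polynomial.X ^ ν * A1 := by
      rw [← dvd_def, Polynomial.X_pow_dvd_iff]
      intro i hi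
      exact Polynomial.coeff_eq_zero_of_lt_natTrailingDegree hi
    have hcoef : ∀ i, (A1.coeff i) = (blow A).coeff (i + ν) := by
      intro i; rw [hA1, mul_comm, Polynomial.coeff_mul_X_pow]
    have hp0 : A1.coeff 0 ≠ 0 := by
      rw [hcoef, zero_add]
      exact (Polynomial.trailingCoeff_nonzero_iff_nonzero).mpr hB0
    have hdeg : (A1.coeff 0).natDegree ≤ ν := by
      rw [Polynomial.natDegree_le_iff_coeff_eq_zero]
      intro i hi
      rw [hcoef, coeff_blow, if_neg]; omega
    have hνo : ν ≤ o := by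
      apply Polynomial.natTrailingDegree_le_of_ne_zero
      intro h
      have := coeff_blow A o o
      rw [h] at this; simp at this; exact ho this.symm
    have hevA : ev s t A = t ^ ν * ev (s / t) t A1 := by
      have := ev_blow (s / t) t A
      rw [div_mul_cancel₀ _ ht0] at this
      rw [← this, hA1, _root_.map_mul, _root_.map_pow, ev_X]
    have hA1ne : ev (s / t) t A1 ≠ 0 := by
      intro h; apply hA; rw [hevA, h, mul_zero]
    have hvA : V.v (ev s t A) = ν * V.v t + V.v (ev (s / t) t A1) := by
      rw [hevA, V.map_mul (pow_ne_zero _ ht0) hA1ne, V.map_pow _ ht0]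
    have hr : V.Ge 0 (s / t) := by
      intro _; rw [V.map_div hs0 ht0]; omega
    -- it suffices to bound
    have key : V.v (ev (s / t) t A1) ≤ ν * (Ω - 2 * V.v t) := by
      by_cases hc : ∃ c : k, 0 < V.v (s / t - algebraMap k K c)
          ∧ s / t - algebraMap k K c ≠ 0
      · obtain ⟨c, hc, hne⟩ := hc
        have hJ1 : Jac D0 D1 (s / t - algebraMap k K c) t = Jac D0 D1 s t / t := by
          rw [Jac_sub_const, Jac_div_self _ _ _ _ ht0]
        have hev : ev (s / t - algebraMap k K c) t (A1.map (Polynomial.compRingHom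
            (Polynomial.X + Polynomial.C c))) = ev (s / t) t A1 := by
          have : (ev (s / t - algebraMap k K c) t).comp (Polynomial.mapRingHom
              (Polynomial.compRingHom (Polynomial.X + Polynomial.C c))) =
              ev (k := k) (s / t) t := by
            apply ev_hom_ext
            · intro c; simp [ev]
            · simp [ev]
            · simp [ev]
          exact RingHom.congr_fun this A1
        have hvJ : V.v (Jac D0 D1 (s / t - algebraMap k K c) t) =
            V.v (Jac D0 D1 s t) - V.v t := by
          rw [hJ1, V.map_div hJ ht0]
        have h1 := ih (V.v (Jac D0 D1 (s / t - algebraMap k K c) t) + ω).toNat (by omega)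
          (s / t - algebraMap k K c) t (by rw [hJ1]; exact div_ne_zero hJ ht0) hc ht
          (A1.map (Polynomial.compRingHom (Polynomial.X + Polynomial.C c)))
          (A1.coeff 0).natDegree (by
            rw [Polynomial.coeff_map, Polynomial.coe_compRingHom_apply]
            have hnd : ((A1.coeff 0).comp (Polynomial.X + Polynomial.C c)).natDegree =
                (A1.coeff 0).natDegree := by
              rw [Polynomial.natDegree_comp, Polynomial.natDegree_X_add_C, mul_one]
            rw [← hnd]
            change Polynomial.leadingCoeff _ ≠ 0
            rw [Polynomial.leadingCoeff_ne_zero]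
            intro h0
            rw [Polynomial.comp_eq_zero_iff] at h0
            rcases h0 with h0 | h0
            · exact hp0 h0
            · have h2 := congrArg Polynomial.natDegree h0.2
              rw [Polynomial.natDegree_X_add_C, Polynomial.natDegree_C] at h2
              omega) (by rw [hev]; exact hA1ne) rfl
        rw [hev, hvJ] at h1
        refine h1.trans ?_
        have : V.v (Jac D0 D1 s t) - V.v t + ω - V.v t = Ω - 2 * V.v t := by rw [hΩdef]; ring
        rw [this]
        apply mul_le_mul_of_nonneg_right _ (by omega)
        exact_mod_cast hdeg
      · push Not at hc
        have hne : ∀ c : k, s / t - algebraMap k K c ≠ 0 := by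
          intro c h0
          have h1 := Jac_sub_const D0 D1 (s / t) t c
          rw [h0, Jac_zero_left, Jac_div_self _ _ _ _ ht0] at h1
          exact div_ne_zero hJ ht0 h1.symm
        obtain ⟨h1, h2⟩ := V.residue (s / t) hr (fun c => ⟨hne c, by
          by_contra h; push Not at h; exact hne c (hc c h)⟩) (A1.coeff 0) hp0
        have h3 := V.map_add_of_lt (b := t * ev (s / t) t A1.divX) h1 (by
          have := (V.ge_self t).mul (ge_ev V (s / t) t hr (fun _ => ht.le) A1.divX)
          exact this.mono (by omega))
        rw [← ev_eq] at h3
        rw [h3.2, h2]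
        have : 0 ≤ Ω - 2 * V.v t := by omega
        positivity
    rw [hvA]
    have h4 : (ν : ℤ) * V.v t + ν * (Ω - 2 * V.v t) = ν * (Ω - V.v t) := by ring
    have h5 : (ν : ℤ) * (Ω - V.v t) ≤ o * (Ω - V.v t) := by
      apply mul_le_mul_of_nonneg_right _ (by omega)
      exact_mod_cast hνo
    linarith

/-- The local lemma at a translated point. -/
theorem LL' [IsAlgClosed k] (V : ZVal k K) (ω : ℤ)
    (hlog : ∀ a b, a ≠ 0 → b ≠ 0 → Jac D0 D1 a b ≠ 0 → V.v a + V.v b ≤ V.v (Jac D0 D1 a b) + ω)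
    (s t : K) (hJ : Jac D0 D1 s t ≠ 0) (c : k) (hs : 0 < V.v (s - algebraMap k K c))
    (ht : 0 < V.v t)
    (A : k[X][X]) (h0 : A.coeff 0 ≠ 0) (hA : ev s t A ≠ 0) :
    V.v (ev s t A) ≤ (A.coeff 0).rootMultiplicity c * (V.v (Jac D0 D1 s t) + ω - V.v t) := by
  have hev : ev (s - algebraMap k K c) t (A.map (Polynomial.compRingHom
      (Polynomial.X + Polynomial.C c))) = ev s t A := by
    have : (ev (s - algebraMap k K c) t).comp (Polynomial.mapRingHom
        (Polynomial.compRingHom (Polynomial.X + Polynomial.C c))) =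
        ev (k := k) s t := by
      apply ev_hom_ext
      · intro c; simp [ev]
      · simp [ev]
      · simp [ev]
    exact RingHom.congr_fun this A
  have h1 := LL D0 D1 V ω hlog (s - algebraMap k K c) t (by rwa [Jac_sub_const]) hs ht
    (A.map (Polynomial.compRingHom (Polynomial.X + Polynomial.C c)))
    ((A.coeff 0).rootMultiplicity c) (by
      rw [Polynomial.coeff_map, Polynomial.coe_compRingHom_apply,
        Polynomial.rootMultiplicity_eq_natTrailingDegree]
      change Polynomial.trailingCoeff _ ≠ 0
      rw [Polynomial.trailingCoeff_nonzero_iff_nonzero]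
      intro h2
      rw [Polynomial.comp_eq_zero_iff] at h2
      rcases h2 with h2 | h2
      · exact h0 h2
      · have h3 := congrArg Polynomial.natDegree h2.2
        rw [Polynomial.natDegree_X_add_C, Polynomial.natDegree_C] at h3
        omega) (by rw [hev]; exact hA)
  rwa [hev, Jac_sub_const] at h1

end LL
end Yosh

open MvPolynomial
namespace Yosh
open scoped Polynomial
section NL
variable {k : Type} [Field k]

/-- weight bound for a polynomial in two variables. -/
def Wt (α β : ℕ) (n : ℤ) (A : k[X][X]) : Prop :=
  ∀ i j, (A.coeff j).coeff i ≠ 0 → (α * i + β * j : ℤ) ≤ n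

lemma Wt.add {α β : ℕ} {n : ℤ} {A B : k[X][X]} (hA : Wt α β n A) (hB : Wt α β n B) :
    Wt α β n (A + B) := by
  intro i j h
  by_cases h1 : (A.coeff j).coeff i = 0
  · apply hB; intro h2; apply h; simp [h1, h2]
  · exact hA _ _ h1

lemma Wt.neg {α β : ℕ} {n : ℤ} {A : k[X][X]} (hA : Wt α β n A) : Wt α β n (-A) := by
  intro i j h
  apply hA; intro h2; apply h; simp [h2]

lemma Wt.sum {α β : ℕ} {n : ℤ} {ι : Type*} (s : Finset ι) (A : ι → k[X][X])
    (h : ∀ i ∈ s, Wt α β n (A i)) : Wt α β n (∑ i ∈ s, A i) := by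
  classical
  induction s using Finset.induction_on with
  | empty => intro i j h; simp at h
  | insert i s hi ih =>
    rw [Finset.sum_insert hi]
    exact (h i (Finset.mem_insert_self _ _)).add
      (ih fun j hj => h j (Finset.mem_insert_of_mem hj))

lemma Wt.mul {α β : ℕ} {n m : ℤ} {A B : k[X][X]} (hA : Wt α β n A) (hB : Wt α β m B) :
    Wt α β (n + m) (A * B) := by
  intro i j h
  rw [Polynomial.coeff_mul, Polynomial.finsetSum_coeff] at h
  obtain ⟨x, hx, h⟩ := Finset.exists_ne_zero_of_sum_ne_zero h
  rw [Polynomial.coeff_mul] at h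
  obtain ⟨y, hy, h⟩ := Finset.exists_ne_zero_of_sum_ne_zero h
  have h1 := hA _ _ (left_ne_zero_of_mul h)
  have h2 := hB _ _ (right_ne_zero_of_mul h)
  rw [Finset.HasAntidiagonal.mem_antidiagonal] at hx hy
  rw [← hx, ← hy]; push_cast; nlinarith

lemma Wt.prod {α β : ℕ} {ι : Type*} (s : Finset ι) (n : ι → ℤ) (A : ι → k[X][X])
    (h : ∀ i ∈ s, Wt α β (n i) (A i)) : Wt α β (∑ i ∈ s, n i) (∏ i ∈ s, A i) := by
  classical
  induction s using Finset.induction_on with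
  | empty =>
    intro i j h
    simp only [Finset.prod_empty, Polynomial.coeff_one] at h
    split_ifs at h with h1
    · rw [Polynomial.coeff_one] at h
      split_ifs at h with h2
      · subst h1 h2; simp
      · simp at h
    · simp at h
  | insert i s hi ih =>
    rw [Finset.prod_insert hi, Finset.sum_insert hi]
    exact (h i (Finset.mem_insert_self _ _)).mul
      (ih fun j hj => h j (Finset.mem_insert_of_mem hj))

lemma degree_le_degree_of_natDegree_le' {p r : k[X]} (hp : 0 < p.natDegree)
    (h : p.natDegree ≤ r.natDegree) : p.degree ≤ r.degree := by
  have h3 : r ≠ 0 := by rintro rfl; simp at h; omega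
  have h0 : p ≠ 0 := by rintro rfl; simp at hp
  rw [Polynomial.degree_eq_natDegree h0, Polynomial.degree_eq_natDegree h3]
  exact_mod_cast h

lemma expand_p (p : k[X]) (hp : 0 < p.natDegree) (n : ℕ) (r : k[X]) (hr : r.natDegree ≤ n) :
    ∃ m : Fin p.natDegree → k[X], r = ∑ i, (m i).comp p * Polynomial.X ^ (i : ℕ) ∧
      ∀ i l, (m i).coeff l ≠ 0 → p.natDegree * l + i ≤ n := by
  have hp0 : p ≠ 0 := by rintro rfl; simp at hp
  induction n using Nat.strong_induction_on generalizing r with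
  | _ n ih =>
  by_cases hlt : r.natDegree < p.natDegree
  · refine ⟨fun i => Polynomial.C (r.coeff i), ?_, ?_⟩
    · conv_lhs => rw [r.as_sum_range_C_mul_X_pow' hlt]
      rw [Finset.sum_range]; simp
    · intro i l h
      rw [Polynomial.coeff_C] at h
      split_ifs at h with h1
      · subst h1
        have := Polynomial.le_natDegree_of_ne_zero h
        omega
      · simp at h
  · push Not at hlt
    have hdiv : (r / p).natDegree ≤ n - p.natDegree := by
      have h1 := Polynomial.degree_add_div hp0 (degree_le_degree_of_natDegree_le' hp hlt)
      by_cases h2 : r / p = 0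
      · rw [h2]; simp
      have h3 : r ≠ 0 := by rintro rfl; simp at h2
      rw [Polynomial.degree_eq_natDegree h2, Polynomial.degree_eq_natDegree h3,
        Polynomial.degree_eq_natDegree hp0] at h1
      norm_cast at h1
      omega
    obtain ⟨m, hm, hm2⟩ := ih (n - p.natDegree) (by omega) (r / p) hdiv
    have hmod : (r % p).natDegree < p.natDegree := by
      exact Polynomial.natDegree_mod_lt r hp.ne'
    refine ⟨fun i => Polynomial.X * m i + Polynomial.C ((r % p).coeff i), ?_, ?_⟩
    · have h1 : r % p = ∑ i : Fin p.natDegree, Polynomial.C ((r % p).coeff i) * Polynomial.X ^ (i : ℕ) := by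
        conv_lhs => rw [(r % p).as_sum_range_C_mul_X_pow' hmod]
        rw [Finset.sum_range]
      conv_lhs => rw [← EuclideanDomain.div_add_mod r p]
      conv_lhs => rw [h1, hm, Finset.mul_sum, ← Finset.sum_add_distrib]
      apply Finset.sum_congr rfl
      intro i _
      simp; ring
    · intro i l h
      rcases l with _ | l
      · simp only [Polynomial.coeff_add, Polynomial.mul_coeff_zero, Polynomial.coeff_X_zero, zero_mul, zero_add, Polynomial.coeff_C_zero] at h
        have := i.2; omega
      · simp only [Polynomial.coeff_add, Polynomial.coeff_X_mul, Polynomial.coeff_C_succ, add_zero] at h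
        have := hm2 i l h
        rw [Nat.mul_succ]; omega

lemma exists_chi (p q : k[X]) (hp : 0 < p.natDegree) :
    ∃ χ : k[X][X], χ.Monic ∧ χ.natDegree = p.natDegree ∧ ev p q χ = 0 ∧
      Wt p.natDegree q.natDegree (p.natDegree * q.natDegree) χ := by
  classical
  have h : ∀ j : Fin p.natDegree, ∃ m : Fin p.natDegree → k[X],
      q * Polynomial.X ^ (j : ℕ) = ∑ i, (m i).comp p * Polynomial.X ^ (i : ℕ) ∧
      ∀ i l, (m i).coeff l ≠ 0 → p.natDegree * l + i ≤ q.natDegree + j := by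
    intro j
    apply expand_p p hp
    refine Polynomial.natDegree_mul_le.trans ?_
    simp
  choose m hm1 hm2 using h
  let M : Matrix (Fin p.natDegree) (Fin p.natDegree) k[X] := Matrix.of fun j i => m j i
  refine ⟨M.charpoly, M.charpoly_monic, by simp [Matrix.charpoly_natDegree_eq_dim], ?_, ?_⟩
  · rw [Matrix.charpoly, RingHom.map_det]
    rw [← Matrix.exists_mulVec_eq_zero_iff]
    refine ⟨fun i => Polynomial.X ^ (i : ℕ), ?_, ?_⟩
    · intro h0
      have := congrFun h0 ⟨0, hp⟩
      simp at this
    · ext1 j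
      rw [Matrix.mulVec, dotProduct]
      have h1 : ∀ i, ((ev p q).mapMatrix M.charmatrix) j i =
          (if j = i then q else 0) - (m j i).comp p := by
        intro i
        rw [RingHom.mapMatrix_apply, Matrix.map_apply, Matrix.charmatrix_apply, Matrix.diagonal_apply]
        rw [_root_.map_sub, ev_C]
        congr 1
        split_ifs
        · exact ev_X _ _
        · simp
      simp only [h1, sub_mul, Finset.sum_sub_distrib, ite_mul, zero_mul]
      rw [Finset.sum_ite_eq]
      simp [hm1 j]
  · rw [Matrix.charpoly, Matrix.det_apply]
    apply Wt.sum
    intro σ _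
    have : Wt p.natDegree q.natDegree (p.natDegree * q.natDegree : ℤ)
        (∏ i, M.charmatrix (σ i) i) := by
      have hsum : (p.natDegree * q.natDegree : ℤ) =
          ∑ i : Fin p.natDegree, ((q.natDegree : ℤ) + ((σ i : Fin _) : ℕ) - ((i : ℕ) : ℤ)) := by
        rw [Finset.sum_sub_distrib, Finset.sum_add_distrib,
          Equiv.sum_comp σ (fun i => (((i : Fin p.natDegree) : ℕ) : ℤ))]
        simp
      rw [hsum]
      apply Wt.prod
      intro i _ a b hab
      rw [Matrix.charmatrix_apply, Matrix.diagonal_apply, Polynomial.coeff_sub, Polynomial.coeff_sub] at hab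
      by_cases hb : b = 0
      · subst hb
        have h0 : ((if σ i = i then (Polynomial.X : k[X][X]) else 0).coeff 0) = 0 := by
          split_ifs <;> simp
        rw [h0, Polynomial.coeff_C_zero] at hab
        simp only [Polynomial.coeff_zero, zero_sub, ne_eq, neg_eq_zero] at hab
        have := hm2 (σ i) i a hab
        zify at this
        push_cast; linarith
      · rw [Polynomial.coeff_C_of_ne_zero hb, Polynomial.coeff_zero, sub_zero] at hab
        split_ifs at hab with h1
        · rw [Polynomial.coeff_X] at hab
          split_ifs at hab with h2
          · subst h2
            rw [Polynomial.coeff_one] at hab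
            split_ifs at hab with h3
            · subst h3; rw [h1]; simp
            · simp at hab
          · simp at hab
        · simp at hab
    rcases Int.units_eq_one_or (Equiv.Perm.sign σ) with h | h
    · rw [h]; simpa using this
    · rw [h]; simpa using this.neg

/-- first half of the N-lemma. -/
lemma Nlem_aux (p q : k[X]) (hp : 0 < p.natDegree) (hs : Function.Surjective (ev (k := k) p q))
    (Φ : k[X][X]) (hker : ∀ A, ev p q A = 0 ↔ Φ ∣ A) :
    Wt p.natDegree q.natDegree (p.natDegree * q.natDegree) Φ ∧
      (Φ.coeff p.natDegree).coeff 0 ≠ 0 := by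
  obtain ⟨χ, hmon, hdeg, h0, hwt⟩ := exists_chi p q hp
  obtain ⟨u, hu⟩ := (hker χ).1 h0
  have hlc : Φ.leadingCoeff * u.leadingCoeff = 1 := by
    rw [← Polynomial.leadingCoeff_mul, ← hu]; exact hmon
  have hχ0 : χ ≠ 0 := hmon.ne_zero
  have hΦ0 : Φ ≠ 0 := by rintro rfl; simp at hu; exact hχ0 hu
  have hu0 : u ≠ 0 := by rintro rfl; simp at hu; exact hχ0 hu
  have hsum : Φ.natDegree + u.natDegree = p.natDegree := by
    rw [← hdeg, hu, Polynomial.natDegree_mul hΦ0 hu0]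
  -- make Φ monic
  obtain ⟨a, ha⟩ := Polynomial.isUnit_iff.1 (IsUnit.of_mul_eq_one _ hlc)
  obtain ⟨ha1, ha2⟩ := ha
  have ha0 : a ≠ 0 := ha1.ne_zero
  set Φ1 := Polynomial.C (Polynomial.C a⁻¹) * Φ with hΦ1
  have hmonic1 : Φ1.Monic := by
    rw [Polynomial.Monic, hΦ1, Polynomial.leadingCoeff_mul, Polynomial.leadingCoeff_C, ← ha2,
      ← Polynomial.C_mul, inv_mul_cancel₀ ha0, Polynomial.C_1]
  have hdeg1 : Φ1.natDegree = Φ.natDegree := by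
    rw [hΦ1, Polynomial.natDegree_C_mul]
    simpa using ha0
  have hev1 : ev p q Φ1 = 0 := by
    rw [hΦ1, _root_.map_mul, (hker Φ).2 dvd_rfl, mul_zero]
  -- dimension count
  have hle : p.natDegree ≤ Φ.natDegree := by
    have hp0 : p ≠ 0 := by rintro rfl; simp at hp
    let L : (Fin Φ.natDegree → k) →ₗ[k] AdjoinRoot p :=
      { toFun := fun c => ∑ i, c i • (AdjoinRoot.mk p q) ^ (i : ℕ)
        map_add' := by intro x y; simp [add_smul, Finset.sum_add_distrib]
        map_smul' := by intro x y; simp [Finset.smul_sum, mul_smul] }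
    have hL : Function.Surjective L := by
      intro y
      obtain ⟨r, rfl⟩ := AdjoinRoot.mk_surjective y
      obtain ⟨A, rfl⟩ := hs r
      rw [← Polynomial.modByMonic_add_div A Φ1, _root_.map_add, _root_.map_mul, hev1, zero_mul, add_zero]
      set R := A %ₘ Φ1
      by_cases hone : Φ1 = 1
      · exfalso
        rw [hone, _root_.map_one] at hev1
        exact one_ne_zero hev1
      have hR : R.natDegree < Φ.natDegree := by
        rw [← hdeg1]
        exact Polynomial.natDegree_modByMonic_lt A hmonic1 hone
      refine ⟨fun i => (R.coeff i).coeff 0, ?_⟩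
      change ∑ i : Fin Φ.natDegree, _ = _
      rw [ev, Polynomial.coe_eval₂RingHom, Polynomial.eval₂_eq_sum_range' _ hR, Finset.sum_range, _root_.map_sum]
      apply Finset.sum_congr rfl
      intro i _
      rw [_root_.map_mul, _root_.map_pow]
      rw [Algebra.smul_def]
      congr 1
      simp only [RingHom.coe_coe]
      have := Polynomial.divX_mul_X_add (R.coeff i)
      conv_rhs => rw [← this]
      rw [_root_.map_add, _root_.map_mul, Polynomial.aeval_X, Polynomial.aeval_C, _root_.map_add, _root_.map_mul,
        AdjoinRoot.mk_self, mul_zero, zero_add]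
      rfl
    have h1 := LinearMap.finrank_le_finrank_of_surjective (f := L) hL
    rw [Module.finrank_fin_fun, (AdjoinRoot.powerBasis hp0).finrank, AdjoinRoot.powerBasis_dim] at h1
    exact h1
  have hΦd : Φ.natDegree = p.natDegree := by omega
  have hud : u.natDegree = 0 := by omega
  obtain ⟨b, hb1, hb2⟩ := Polynomial.isUnit_iff.1 (IsUnit.of_mul_eq_one_right _ hlc)
  have hueq : u = Polynomial.C (Polynomial.C b) := by
    have := Polynomial.eq_C_of_natDegree_eq_zero hud
    rw [this]; congr 1
    rw [hb2, Polynomial.leadingCoeff, hud]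
  refine ⟨?_, ?_⟩
  · intro i j hij
    apply hwt
    rw [hu, hueq, Polynomial.coeff_mul_C, Polynomial.coeff_mul_C]
    exact mul_ne_zero hij hb1.ne_zero
  · rw [← hΦd]
    change (Φ.leadingCoeff).coeff 0 ≠ 0
    rw [← ha2, Polynomial.coeff_C_zero]; exact ha0

/-- swap of the two variables. -/
noncomputable def swp : k[X][X] →+* k[X][X] := ev Polynomial.X (Polynomial.C Polynomial.X)

lemma swp_swp (A : k[X][X]) : swp (swp A) = A := by
  have : (swp).comp (swp (k := k)) = RingHom.id _ := by
    apply ev_hom_ext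
    · intro c; simp [swp, ev, Polynomial.algebraMap_eq, Polynomial.algebraMap_apply]
    · simp [swp, ev]
    · simp [swp, ev]
  exact RingHom.congr_fun this A

lemma ev_swp {R : Type} [CommRing R] [Algebra k R] (s t : R) (A : k[X][X]) :
    ev s t (swp A) = ev t s A := by
  have : (ev s t).comp (swp (k := k)) = ev t s := by
    apply ev_hom_ext
    · intro c; simp [swp, ev, Polynomial.algebraMap_apply]
    · simp [swp, ev]
    · simp [swp, ev]
  exact RingHom.congr_fun this A

lemma coeff_swp (A : k[X][X]) (i j : ℕ) : ((swp A).coeff j).coeff i = (A.coeff i).coeff j := by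
  induction A using Polynomial.induction_on' with
  | add p q hp hq =>
    rw [_root_.map_add, Polynomial.coeff_add, Polynomial.coeff_add, hp, hq]; simp
  | monomial b a =>
    induction a using Polynomial.induction_on' with
    | add p q hp hq =>
      rw [_root_.map_add, _root_.map_add, Polynomial.coeff_add, Polynomial.coeff_add, hp, hq]; simp
    | monomial l c =>
      have : swp (Polynomial.monomial b (Polynomial.monomial l c)) =
          Polynomial.monomial l (Polynomial.monomial b c) := by
        rw [swp, ev, Polynomial.coe_eval₂RingHom, Polynomial.eval₂_monomial]
        simp only [RingHom.coe_coe, Polynomial.aeval_monomial]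
        rw [← Polynomial.C_mul_X_pow_eq_monomial, ← Polynomial.C_mul_X_pow_eq_monomial]
        simp [Polynomial.algebraMap_apply]
        ring
      rw [this]
      simp only [Polynomial.coeff_monomial]
      split_ifs <;> simp_all [Polynomial.coeff_monomial]

theorem Nlem (p q : k[X]) (hp : 0 < p.natDegree) (hq : 0 < q.natDegree)
    (hs : Function.Surjective (ev (k := k) p q))
    (Φ : k[X][X]) (hker : ∀ A, ev p q A = 0 ↔ Φ ∣ A) :
    Wt p.natDegree q.natDegree (p.natDegree * q.natDegree) Φ ∧
      (Φ.coeff p.natDegree).coeff 0 ≠ 0 ∧ (Φ.coeff 0).coeff q.natDegree ≠ 0 := by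
  obtain ⟨h1, h2⟩ := Nlem_aux p q hp hs Φ hker
  refine ⟨h1, h2, ?_⟩
  have := (Nlem_aux q p hq (fun r => by
    obtain ⟨A, hA⟩ := hs r
    exact ⟨swp A, by rw [ev_swp]; exact hA⟩) (swp Φ) (fun A => by
      rw [← swp_swp A, ev_swp, hker]
      constructor
      · rintro ⟨c, hc⟩; rw [hc, _root_.map_mul]; exact dvd_mul_right _ _
      · rintro ⟨c, hc⟩
        have := congrArg swp hc
        rw [swp_swp, _root_.map_mul, swp_swp] at this
        rw [this]; exact dvd_mul_right _ _)).2
  rwa [coeff_swp] at this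

end NL
end Yosh

open MvPolynomial
namespace Yosh
open scoped Polynomial

section misc
variable {k : Type} [Field k]

lemma ev_map {R S : Type} [CommRing R] [Algebra k R] [CommRing S] [Algebra k S] (φ : R →ₐ[k] S)
    (s t : R) (A : k[X][X]) : φ (ev s t A) = ev (φ s) (φ t) A := by
  have : (φ : R →+* S).comp (ev s t) = ev (k := k) (φ s) (φ t) := by
    apply ev_hom_ext
    · intro c; simp [ev]
    · simp [ev]
    · simp [ev]
  exact RingHom.congr_fun this A

lemma ev_comp {R : Type} [CommRing R] [Algebra k R] (s t : R) (x y A : k[X][X]) :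
    ev s t (ev x y A) = ev (ev s t x) (ev s t y) A := by
  have : (ev s t).comp (ev x y) = ev (k := k) (ev s t x) (ev s t y) := by
    apply ev_hom_ext
    · intro c; simp [ev, Polynomial.algebraMap_apply]
    · simp [ev]
    · simp [ev]
  exact RingHom.congr_fun this A

lemma ev_id (A : k[X][X]) : ev (k := k) (Polynomial.C Polynomial.X : k[X][X]) Polynomial.X A = A := by
  have : ev (k := k) (Polynomial.C Polynomial.X : k[X][X]) Polynomial.X = RingHom.id k[X][X] := by
    apply ev_hom_ext
    · intro c; simp [ev, Polynomial.algebraMap_apply]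
    · simp [ev]
    · simp [ev]
  exact RingHom.congr_fun this A

lemma ev_smul {R : Type} [CommRing R] [Algebra k R] (s t : R) (c : k) (A : k[X][X]) :
    ev s t (c • A) = c • ev s t A := by
  rw [Algebra.smul_def, _root_.map_mul, Polynomial.algebraMap_apply, Algebra.smul_def]
  congr 1
  exact ev_CC s t c

/-- swapping a coordinate system. -/
lemma bij_swap {R : Type} [CommRing R] [Algebra k R] {P Q : R}
    (h : Function.Bijective (ev (k := k) P Q)) : Function.Bijective (ev (k := k) Q P) := by
  have : ⇑(ev (k := k) Q P) = ev (k := k) P Q ∘ swp := by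
    ext A; simp [ev_swp]
  rw [this]
  exact h.comp (Function.Involutive.bijective swp_swp)

lemma bij_elem {R : Type} [CommRing R] [Algebra k R] {P Q : R}
    (h : Function.Bijective (ev (k := k) P Q)) (c : k) (n : ℕ) :
    Function.Bijective (ev (k := k) (P - c • Q ^ n) Q) := by
  have : ⇑(ev (k := k) (P - c • Q ^ n) Q) =
      ev (k := k) P Q ∘ (ev (k := k) (Polynomial.C Polynomial.X - c • Polynomial.X ^ n : k[X][X]) Polynomial.X) := by
    ext A
    rw [Function.comp, ev_comp, _root_.map_sub, ev_smul, _root_.map_pow, ev_CX, ev_X]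
  rw [this]
  refine h.comp ?_
  have hinv : ∀ e : k, ∀ A : k[X][X],
      ev (k := k) (Polynomial.C Polynomial.X - e • Polynomial.X ^ n : k[X][X]) Polynomial.X
        (ev (k := k) (Polynomial.C Polynomial.X - (-e) • Polynomial.X ^ n : k[X][X]) Polynomial.X A) = A := by
    intro e A
    rw [ev_comp, _root_.map_sub, ev_smul, _root_.map_pow, ev_CX, ev_X]
    rw [show Polynomial.C Polynomial.X - e • Polynomial.X ^ n - -e • Polynomial.X ^ n =
      (Polynomial.C Polynomial.X : k[X][X]) by rw [neg_smul]; ring]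
    exact ev_id A
  rw [Function.bijective_iff_has_inverse]
  refine ⟨ev (k := k) (Polynomial.C Polynomial.X - (-c) • Polynomial.X ^ n : k[X][X]) Polynomial.X, fun A => ?_,
    fun A => hinv c A⟩
  have := hinv (-c) A
  rwa [neg_neg] at this

lemma bisum (Φ : k[X][X]) (I J : ℕ) (h : ∀ i j, (Φ.coeff j).coeff i ≠ 0 → i < I ∧ j < J) :
    Φ = ∑ x ∈ Finset.range I ×ˢ Finset.range J,
      Polynomial.monomial x.2 (Polynomial.monomial x.1 ((Φ.coeff x.2).coeff x.1)) := by
  ext j i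
  rw [Polynomial.finsetSum_coeff, Polynomial.finsetSum_coeff]
  by_cases h0 : (Φ.coeff j).coeff i = 0
  · rw [h0]; symm
    apply Finset.sum_eq_zero
    intro x _
    rw [Polynomial.coeff_monomial]
    split_ifs with h1
    · rw [Polynomial.coeff_monomial]
      split_ifs with h2
      · rw [h1, h2, h0]
      · rfl
    · simp
  · have := h i j h0
    rw [Finset.sum_eq_single (i, j)]
    · simp
    · intro x _ hx
      rw [Polynomial.coeff_monomial]
      split_ifs with h1
      · rw [Polynomial.coeff_monomial, if_neg]
        intro h2; exact hx (Prod.ext h2 h1)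
      · simp
    · intro hx; exfalso; apply hx; simp; exact this

lemma ev_monomial {R : Type} [CommRing R] [Algebra k R] (s t : R) (i j : ℕ) (c : k) :
    ev s t (Polynomial.monomial j (Polynomial.monomial i c)) = algebraMap k R c * s ^ i * t ^ j := by
  rw [ev, Polynomial.coe_eval₂RingHom, Polynomial.eval₂_monomial]
  simp [Polynomial.aeval_monomial]

lemma ev_bisum {R : Type} [CommRing R] [Algebra k R] (s t : R) (Φ : k[X][X]) (I J : ℕ)
    (h : ∀ i j, (Φ.coeff j).coeff i ≠ 0 → i < I ∧ j < J) :
    ev s t Φ = ∑ x ∈ Finset.range I ×ˢ Finset.range J,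
      algebraMap k R ((Φ.coeff x.2).coeff x.1) * s ^ x.1 * t ^ x.2 := by
  conv_lhs => rw [bisum Φ I J h, _root_.map_sum]
  simp only [ev_monomial]

lemma exists_bounds (Φ : k[X][X]) : ∃ I J : ℕ, ∀ i j, (Φ.coeff j).coeff i ≠ 0 → i < I ∧ j < J := by
  refine ⟨(Φ.support.sup fun j => (Φ.coeff j).natDegree) + 1, Φ.natDegree + 1, fun i j h => ?_⟩
  have hj : Φ.coeff j ≠ 0 := by intro h0; rw [h0] at h; simp at h
  have h1 := Polynomial.le_natDegree_of_ne_zero hj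
  have h2 := Polynomial.le_natDegree_of_ne_zero h
  have h3 : (Φ.coeff j).natDegree ≤ Φ.support.sup fun j => (Φ.coeff j).natDegree :=
    Finset.le_sup (f := fun j => (Φ.coeff j).natDegree) (Polynomial.mem_support_iff.2 hj)
  omega

/-- dominant monomial. -/
lemma ev_dom {K : Type} [Field K] [Algebra k K] (V : ZVal k K) (s t : K) (hs : s ≠ 0) (ht : t ≠ 0)
    (Φ : k[X][X]) (i0 j0 : ℕ) (h0 : (Φ.coeff j0).coeff i0 ≠ 0)
    (h : ∀ i j, (Φ.coeff j).coeff i ≠ 0 → (i, j) ≠ (i0, j0) →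
      i0 * V.v s + j0 * V.v t < i * V.v s + j * V.v t) :
    V.v (ev s t Φ) = i0 * V.v s + j0 * V.v t := by
  obtain ⟨I, J, hIJ⟩ := exists_bounds Φ
  rw [ev_bisum s t Φ I J hIJ]
  have hmem : (i0, j0) ∈ Finset.range I ×ˢ Finset.range J := by
    simp; exact hIJ i0 j0 h0
  rw [← Finset.add_sum_erase _ _ hmem]
  have hval : ∀ i j : ℕ, ∀ c : k, c ≠ 0 → algebraMap k K c * s ^ i * t ^ j ≠ 0 ∧
      V.v (algebraMap k K c * s ^ i * t ^ j) = i * V.v s + j * V.v t := by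
    intro i j c hc
    have hc' : algebraMap k K c ≠ 0 := by simpa using hc
    refine ⟨mul_ne_zero (mul_ne_zero hc' (pow_ne_zero _ hs)) (pow_ne_zero _ ht), ?_⟩
    rw [V.map_mul (mul_ne_zero hc' (pow_ne_zero _ hs)) (pow_ne_zero _ ht),
      V.map_mul hc' (pow_ne_zero _ hs), V.map_const' c hc, V.map_pow s hs, V.map_pow t ht, zero_add]
  obtain ⟨h1, h2⟩ := hval i0 j0 _ h0
  have h3 := V.map_add_of_lt (a := algebraMap k K ((Φ.coeff j0).coeff i0) * s ^ i0 * t ^ j0)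
    (b := ∑ x ∈ (Finset.range I ×ˢ Finset.range J).erase (i0, j0),
      algebraMap k K ((Φ.coeff x.2).coeff x.1) * s ^ x.1 * t ^ x.2) h1 (by
    rw [h2]
    apply ZVal.Ge.sum
    intro x hx
    by_cases hc : (Φ.coeff x.2).coeff x.1 = 0
    · rw [hc]; simpa using V.ge_zero _
    intro _
    rw [(hval x.1 x.2 _ hc).2]
    exact h x.1 x.2 hc (Finset.ne_of_mem_erase hx))
  rw [h3.2, h2]

lemma dlog_mul {K : Type} [Field K] [Algebra k K] (D : Derivation k K K) (a b : K)
    (ha : a ≠ 0) (hb : b ≠ 0) : D (a * b) / (a * b) = D a / a + D b / b := by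
  rw [D.leibniz]; simp; field_simp; ring

lemma dlog_pow {K : Type} [Field K] [Algebra k K] (D : Derivation k K K) (a : K)
    (ha : a ≠ 0) (n : ℕ) : D (a ^ n) / a ^ n = n * (D a / a) := by
  induction n with
  | zero => simp
  | succ n ih => rw [pow_succ, dlog_mul D _ _ (pow_ne_zero _ ha) ha, ih]; push_cast; ring

lemma dlog_div {K : Type} [Field K] [Algebra k K] (D : Derivation k K K) (a b : K)
    (ha : a ≠ 0) (hb : b ≠ 0) : D (a / b) / (a / b) = D a / a - D b / b := by
  have h := dlog_mul D (a / b) b (div_ne_zero ha hb) hb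
  rw [div_mul_cancel₀ _ hb] at h
  rw [h]; ring

lemma Jac_dlog {K : Type} [Field K] [Algebra k K] (D0 D1 : Derivation k K K) (a b : K)
    (ha : a ≠ 0) (hb : b ≠ 0) :
    Jac D0 D1 a b = a * b * (D0 a / a * (D1 b / b) - D1 a / a * (D0 b / b)) := by
  rw [Jac]; field_simp

lemma Jac_monom {K : Type} [Field K] [Algebra k K] (D0 D1 : Derivation k K K) (P Q : K)
    (hP : P ≠ 0) (hQ : Q ≠ 0) (a b u w : ℕ) (h : a * u = b * w + 1) :
    Jac D0 D1 (Q ^ a / P ^ b) (Q ^ w / P ^ u) =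
      (Q ^ a / P ^ b) * (Q ^ w / P ^ u) * (Jac D0 D1 P Q / (P * Q)) := by
  have h1 := fun n => pow_ne_zero n hP
  have h2 := fun n => pow_ne_zero n hQ
  rw [Jac_dlog D0 D1 _ _ (div_ne_zero (h2 a) (h1 b)) (div_ne_zero (h2 w) (h1 u))]
  rw [dlog_div _ _ _ (h2 a) (h1 b), dlog_div _ _ _ (h2 w) (h1 u), dlog_div _ _ _ (h2 a) (h1 b),
    dlog_div _ _ _ (h2 w) (h1 u)]
  simp only [dlog_pow _ _ hP, dlog_pow _ _ hQ]
  rw [Jac_dlog D0 D1 P Q hP hQ]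
  have h' : (a : K) * u = b * w + 1 := by exact_mod_cast congrArg (Nat.cast (R := K)) h
  rw [mul_div_cancel_left₀ _ (mul_ne_zero hP hQ)]
  congr 1
  linear_combination (D0 P / P * (D1 Q / Q) - D1 P / P * (D0 Q / Q)) * h'

lemma bezout_nat (a b : ℕ) (ha : 1 ≤ a) (hb : 1 ≤ b) (h : Nat.Coprime a b) :
    ∃ u w : ℕ, a * u = b * w + 1 := by
  rcases Nat.lt_or_ge 1 b with hb1 | hb1
  · obtain ⟨u, hu⟩ := Nat.exists_mul_mod_eq_one_of_coprime h hb1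
    refine ⟨u, a * u / b, ?_⟩
    have := Nat.div_add_mod (a * u) b
    rw [hu.2] at this; omega
  · have : b = 1 := by omega
    subst this
    exact ⟨1, a - 1, by omega⟩

end misc

/-- Core data for the affine part of the argument. -/
structure Core (k K : Type) [Field k] [Field K] [Algebra k K] where
  ι : MvPolynomial (Fin 2) k →ₐ[k] K
  ι_inj : Function.Injective ι
  D0 : Derivation k K K
  D1 : Derivation k K K
  D00 : D0 (ι (X 0)) = 1
  D01 : D0 (ι (X 1)) = 0
  D10 : D1 (ι (X 0)) = 0
  D11 : D1 (ι (X 1)) = 1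
  V : ZVal k K
  VL : ZVal k K
  VL_spec : ∀ A, A ≠ 0 → VL.v (ι A) = -(A.totalDegree : ℤ)
  ω : ℤ
  hlog : ∀ a b, a ≠ 0 → b ≠ 0 → Jac D0 D1 a b ≠ 0 → V.v a + V.v b ≤ V.v (Jac D0 D1 a b) + ω
  F : MvPolynomial (Fin 2) k
  d : ℕ
  hd : 3 ≤ d
  hdeg : F.totalDegree = d
  ε : MvPolynomial (Fin 2) k →ₐ[k] k[X]
  ε_surj : Function.Surjective ε
  ε_ker : ∀ A, ε A = 0 ↔ F ∣ A
  m : ℕ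
  hm : 1 ≤ m
  hvF : V.v (ι F) = m
  hω : (d : ℤ) * (ω - 1) ≤ 3 * (m - 1)

namespace Core
variable {k K : Type} [Field k] [Field K] [Algebra k K] (c : Core k K)

structure St (P Q : MvPolynomial (Fin 2) k) (N : ℕ) : Prop where
  bij : Function.Bijective (ev (k := k) P Q)
  jac : ∃ j : k, j ≠ 0 ∧ Jac c.D0 c.D1 (c.ι P) (c.ι Q) = algebraMap k K j
  hN : 1 ≤ N
  degQ : c.VL.v (c.ι Q) ≤ -1
  degP : c.VL.v (c.ι P) = N * c.VL.v (c.ι Q)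
  hq : c.V.v (c.ι Q) < 0
  hp : N * c.V.v (c.ι Q) < c.V.v (c.ι P)
  hα : (c.ε P).natDegree ≤ c.d
  hβ : (c.ε Q).natDegree ≤ c.d

def Out (P Q : MvPolynomial (Fin 2) k) : Prop :=
  ∃ x' : MvPolynomial (Fin 2) k, Function.Bijective (ev (k := k) x' c.F) ∧
    (∃ j : k, j ≠ 0 ∧ Jac c.D0 c.D1 (c.ι x') (c.ι c.F) = algebraMap k K j) ∧
    ∀ τ : MvPolynomial (Fin 2) k →ₐ[k] K, τ c.F = c.ι c.F → c.VL.Ge c.d (τ x' - c.ι x') →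
      c.VL.Ge (-c.VL.v (c.ι Q)) (τ P - c.ι P) ∧ c.VL.Ge (-c.VL.v (c.ι P)) (τ Q - c.ι Q)

variable {c}

lemma F_ne : c.F ≠ 0 := by
  intro h; have := c.hdeg; rw [h] at this; simp at this; have := c.hd; omega

lemma ιF_ne : c.ι c.F ≠ 0 := by
  intro h; exact F_ne (c.ι_inj (by rw [h, map_zero]))

lemma ker_state {P Q Φ} (bij : Function.Bijective (ev (k := k) P Q)) (hΦ : ev P Q Φ = c.F) (A : k[X][X]) :
    ev (c.ε P) (c.ε Q) A = 0 ↔ Φ ∣ A := by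
  rw [← ev_map, c.ε_ker]
  constructor
  · rintro ⟨D, hD⟩
    obtain ⟨D', rfl⟩ := bij.2 D
    refine ⟨D', bij.1 ?_⟩
    rw [hD, _root_.map_mul, hΦ]
  · rintro ⟨D, rfl⟩
    rw [_root_.map_mul, hΦ]; exact dvd_mul_right _ _

lemma surj_state {P Q} (bij : Function.Bijective (ev (k := k) P Q)) :
    Function.Surjective (ev (k := k) (c.ε P) (c.ε Q)) := by
  intro r
  obtain ⟨A, rfl⟩ := c.ε_surj r
  obtain ⟨D, rfl⟩ := bij.2 A
  exact ⟨D, by rw [ev_map]⟩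

/-- If `ε P` is constant then `F` is a linear function of `P`. -/
lemma const_case {P Q} (bij : Function.Bijective (ev (k := k) P Q)) (h : (c.ε P).natDegree = 0) :
    ∃ κ e : k, κ ≠ 0 ∧ κ • c.F = P - algebraMap k _ e := by
  obtain ⟨Φ, hΦ⟩ := bij.2 c.F
  obtain ⟨e, he⟩ : ∃ e, c.ε P = Polynomial.C e := ⟨_, Polynomial.eq_C_of_natDegree_eq_zero h⟩
  have h1 : Φ ∣ Polynomial.C (Polynomial.X - Polynomial.C e) := by
    rw [← ker_state bij hΦ, ev_C, he]; simp
  have hpr : Prime (Polynomial.C (Polynomial.X - Polynomial.C e) : k[X][X]) :=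
    Polynomial.prime_C_iff.2 (Polynomial.prime_X_sub_C e)
  obtain ⟨u, hu⟩ := h1
  rcases hpr.irreducible.isUnit_or_isUnit hu with hu1 | hu1
  · exfalso
    have := (ker_state bij hΦ 1).2 hu1.dvd
    simp at this
  · obtain ⟨r, hr, rfl⟩ := Polynomial.isUnit_iff.1 hu1
    obtain ⟨κ, hκ, rfl⟩ := Polynomial.isUnit_iff.1 hr
    refine ⟨κ, e, hκ.ne_zero, ?_⟩
    have := congrArg (ev P Q) hu
    rw [_root_.map_mul, hΦ, ev_C, ev_CC] at this
    rw [Algebra.smul_def, mul_comm, ← this]; simp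

lemma no_const {P Q} (bij : Function.Bijective (ev (k := k) P Q)) (hv : c.V.v (c.ι P) < 0)
   : 0 < (c.ε P).natDegree := by
  by_contra h
  obtain ⟨κ, e, hκ, h1⟩ := const_case (c := c) bij (by omega)
  have h2 := congrArg c.ι h1
  rw [_root_.map_smul, _root_.map_sub, AlgHom.commutes] at h2
  have hP : c.ι P ≠ 0 := by
    intro h0
    have : P = 0 := c.ι_inj (by rw [h0, map_zero])
    have h3 := bij.1 (a₁ := Polynomial.C Polynomial.X) (a₂ := 0) (by rw [ev_CX, map_zero, this])
    simp at h3
  have h3 := c.V.map_add_of_lt (a := c.ι P) (b := - algebraMap k K e) hP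
    ((c.V.ge_const e).neg.mono (by omega))
  rw [← sub_eq_add_neg, ← h2, Algebra.smul_def] at h3
  rw [c.V.map_mul (by simpa using hκ) ιF_ne, c.V.map_const' _ hκ, c.hvF] at h3
  have := h3.2; omega

lemma ne_of_jac {P Q : MvPolynomial (Fin 2) k}
    (jac : ∃ j : k, j ≠ 0 ∧ Jac c.D0 c.D1 (c.ι P) (c.ι Q) = algebraMap k K j) :
    c.ι P ≠ 0 ∧ c.ι Q ≠ 0 := by
  obtain ⟨j, hj, h⟩ := jac
  constructor
  · intro h0; rw [h0, Jac_zero_left] at h; exact hj (by simpa using h.symm)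
  · intro h0; rw [h0, Jac_zero_right] at h; exact hj (by simpa using h.symm)

lemma slope1 {P Q N} (st : c.St P Q N) (hα : 0 < (c.ε P).natDegree)
    (h : ((c.ε Q).natDegree : ℤ) * (- c.V.v (c.ι P)) < (c.ε P).natDegree * (-c.V.v (c.ι Q))) : False := by
  obtain ⟨hP0, hQ0⟩ := ne_of_jac st.jac
  have hβ := no_const (c := c) (bij_swap st.bij) st.hq
  obtain ⟨Φ, hΦ⟩ := st.bij.2 c.F
  obtain ⟨n1, n2, n3⟩ := Nlem _ _ hα hβ (surj_state st.bij) Φ (ker_state st.bij hΦ)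
  have h1 := ev_dom c.V (c.ι P) (c.ι Q) hP0 hQ0 Φ 0 (c.ε P).natDegree n2 (by
    intro i j hij hne
    have h2 := n1 i j hij
    have hq := st.hq
    set p := c.V.v (c.ι P)
    set q := c.V.v (c.ι Q)
    set α := (c.ε P).natDegree
    set β := (c.ε Q).natDegree
    have hβ' : (0 : ℤ) < β := by exact_mod_cast hβ
    rcases Nat.eq_zero_or_pos i with rfl | hi
    · have : j ≠ α := by rintro rfl; exact hne rfl
      have h3 : (j : ℤ) < α := by
        have : (β : ℤ) * j ≤ β * α := by push_cast at h2; nlinarith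
        have := le_of_mul_le_mul_left this hβ'
        omega
      push_cast; nlinarith
    · have hi' : (0 : ℤ) < i := by exact_mod_cast hi
      have h4 : (β : ℤ) * ((0 : ℕ) * p + α * q) < β * (i * p + j * q) := by
        push_cast
        nlinarith
      exact lt_of_mul_lt_mul_left h4 hβ'.le)
  rw [← ev_map, hΦ, c.hvF] at h1
  have hq := st.hq
  have := c.hm
  push_cast at h1
  have : (0 : ℤ) < (c.ε P).natDegree := by exact_mod_cast hα
  nlinarith

lemma slope2 {P Q N} (st : c.St P Q N) (hα : 0 < (c.ε P).natDegree)
    (h : ((c.ε P).natDegree : ℤ) * (- c.V.v (c.ι Q)) < (c.ε Q).natDegree * (-c.V.v (c.ι P))) : False := by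
  obtain ⟨hP0, hQ0⟩ := ne_of_jac st.jac
  have hβ := no_const (c := c) (bij_swap st.bij) st.hq
  obtain ⟨Φ, hΦ⟩ := st.bij.2 c.F
  obtain ⟨n1, n2, n3⟩ := Nlem _ _ hα hβ (surj_state st.bij) Φ (ker_state st.bij hΦ)
  have hq := st.hq
  have hα' : (0 : ℤ) < (c.ε P).natDegree := by exact_mod_cast hα
  have hβ' : (0 : ℤ) < (c.ε Q).natDegree := by exact_mod_cast hβ
  have hp : c.V.v (c.ι P) < 0 := by
    by_contra h0
    push Not at h0
    nlinarith
  have h1 := ev_dom c.V (c.ι P) (c.ι Q) hP0 hQ0 Φ (c.ε Q).natDegree 0 n3 (by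
    intro i j hij hne
    have h2 := n1 i j hij
    set p := c.V.v (c.ι P)
    set q := c.V.v (c.ι Q)
    set α := (c.ε P).natDegree
    set β := (c.ε Q).natDegree
    rcases Nat.eq_zero_or_pos j with rfl | hi
    · have : i ≠ β := by rintro rfl; exact hne rfl
      have h3 : (i : ℤ) < β := by
        have : (α : ℤ) * i ≤ α * β := by push_cast at h2; nlinarith
        have := le_of_mul_le_mul_left this hα'
        omega
      push_cast; nlinarith
    · have hi' : (0 : ℤ) < j := by exact_mod_cast hi
      have h4 : (α : ℤ) * (β * p + (0 : ℕ) * q) < α * (i * p + j * q) := by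
        push_cast
        nlinarith
      exact lt_of_mul_lt_mul_left h4 hα'.le)
  rw [← ev_map, hΦ, c.hvF] at h1
  have := c.hm
  push_cast at h1
  nlinarith

end Core
end Yosh

open MvPolynomial
namespace Yosh
open scoped Polynomial

lemma chart {k K : Type} [Field k] [Field K] [Algebra k K] (P Q : K) (hP : P ≠ 0) (hQ : Q ≠ 0)
    (Φ : k[X][X]) (g a b u w : ℕ) (hg : 0 < g) (ha : 0 < a) (hb : 0 < b) (huw : a * u = b * w + 1)
    (hW : Wt (g * a) (g * b) ((g * a : ℕ) * (g * b : ℕ)) Φ) (h0 : (Φ.coeff 0).coeff (g * b) ≠ 0) :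
    ∃ A : k[X][X], ev (Q ^ a / P ^ b) (Q ^ w / P ^ u) A =
        (Q ^ w / P ^ u) ^ (g * a * b) * ev P Q Φ ∧
      A.coeff 0 ≠ 0 ∧ ∀ e : k, e ≠ 0 → (A.coeff 0).rootMultiplicity e ≤ g := by
  classical
  have hW' : ∀ i j, (Φ.coeff j).coeff i ≠ 0 → a * i + b * j ≤ g * a * b := by
    intro i j hij
    have h1 := hW i j hij
    have h2 : g * (a * i + b * j) ≤ g * (g * a * b) := by
      zify; push_cast at h1; nlinarith
    exact Nat.le_of_mul_le_mul_left h2 hg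
  obtain ⟨I, J, hIJ⟩ := exists_bounds Φ
  set T := Finset.range I ×ˢ Finset.range J with hT
  set co : ℕ × ℕ → k := fun x => (Φ.coeff x.2).coeff x.1 with hco
  set A : k[X][X] := ∑ x ∈ T, Polynomial.monomial (g * a * b - (a * x.1 + b * x.2))
    (Polynomial.monomial (w * x.1 + u * x.2) (co x)) with hA
  have hc0 : ∀ l, (A.coeff 0).coeff l = ∑ x ∈ T,
      if g * a * b - (a * x.1 + b * x.2) = 0 ∧ w * x.1 + u * x.2 = l then co x else 0 := by
    intro l
    rw [hA, Polynomial.finsetSum_coeff, Polynomial.finsetSum_coeff]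
    apply Finset.sum_congr rfl
    intro x _
    rw [Polynomial.coeff_monomial]
    by_cases h1 : g * a * b - (a * x.1 + b * x.2) = 0
    · rw [if_pos h1, Polynomial.coeff_monomial]; simp [h1]
    · rw [if_neg h1]; simp [h1]
  -- arithmetic of exponents
  have key : ∀ i j : ℕ, co (i, j) ≠ 0 → g * a * b - (a * i + b * j) = 0 →
      i + b * (w * i + u * j) = u * (g * a * b) ∧ j + w * (g * a * b) = a * (w * i + u * j) := by
    intro i j h1 h2
    have h3 := hW' i j h1
    have h4 : a * i + b * j = g * a * b := by omega
    rw [← h4]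
    constructor
    · nlinarith
    · nlinarith
  have hsupp : ∀ l, (A.coeff 0).coeff l ≠ 0 → w * (g * b) ≤ l ∧ l ≤ w * (g * b) + g := by
    intro l hl
    rw [hc0] at hl
    obtain ⟨x, hx, hx2⟩ := Finset.exists_ne_zero_of_sum_ne_zero hl
    split_ifs at hx2 with h1
    · obtain ⟨h1, h3⟩ := h1
      obtain ⟨k1, k2⟩ := key x.1 x.2 hx2 h1
      rw [h3] at k1 k2
      constructor
      · have : a * (w * (g * b)) ≤ a * l := by nlinarith
        exact Nat.le_of_mul_le_mul_left this ha
      · have : b * l ≤ b * (w * (g * b) + g) := by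
          have : u * (g * a * b) = g * b * (b * w + 1) := by rw [← huw]; ring
          nlinarith
        exact Nat.le_of_mul_le_mul_left this hb
    · exact absurd rfl hx2
  have hne : (A.coeff 0).coeff (w * (g * b)) ≠ 0 := by
    rw [hc0, Finset.sum_eq_single (g * b, 0)]
    · rw [if_pos]
      · exact h0
      · refine ⟨?_, ?_⟩
        · have : a * (g * b) = g * a * b := by ring
          simp [this]
        · simp
    · rintro ⟨i, j⟩ hx hxne
      by_contra h1
      split_ifs at h1 with h2
      · obtain ⟨h2, h3⟩ := h2
        obtain ⟨k1, k2⟩ := key i j h1 h2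
        simp only at h2 h3 k1 k2
        rw [h3] at k1 k2
        apply hxne
        have h5 : a * u * (g * b) = (b * w + 1) * (g * b) := by rw [huw]
        ext
        · simp only; nlinarith
        · simp only; nlinarith
      · exact h1 rfl
    · intro hx
      exfalso; apply hx
      rw [hT]; simp
      exact hIJ _ _ h0
  have hA0 : A.coeff 0 ≠ 0 := by intro h; rw [h] at hne; simp at hne
  refine ⟨A, ?_, hA0, ?_⟩
  · rw [hA, _root_.map_sum, ev_bisum P Q Φ I J hIJ, Finset.mul_sum]
    apply Finset.sum_congr rfl
    intro x _
    rw [ev_monomial]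
    by_cases h1 : co x = 0
    · have h1' : (Φ.coeff x.2).coeff x.1 = 0 := h1
      rw [h1, h1']; simp
    · have h2 := hW' x.1 x.2 h1
      obtain ⟨n, hn⟩ := Nat.exists_eq_add_of_le h2
      have h3 : g * a * b - (a * x.1 + b * x.2) = n := by omega
      rw [h3, hn, pow_add (Q ^ w / P ^ u) _ n]
      change algebraMap k K (co x) * _ * _ = _ * (algebraMap k K (co x) * _ * _)
      have e1 : (Q ^ a / P ^ b) ^ (w * x.1 + u * x.2) =
          (Q ^ w / P ^ u) ^ (a * x.1 + b * x.2) * (P ^ x.1 * Q ^ x.2) := by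
        rw [div_pow, div_pow]
        rw [div_mul_eq_mul_div, div_eq_div_iff (by positivity) (by positivity)]
        simp only [← pow_mul]
        have f1 : Q ^ (a * (w * x.1 + u * x.2)) = Q ^ (w * (a * x.1 + b * x.2)) * Q ^ x.2 := by
          rw [← pow_add]; congr 1; nlinarith
        have f2 : P ^ (u * (a * x.1 + b * x.2)) = P ^ x.1 * P ^ (b * (w * x.1 + u * x.2)) := by
          rw [← pow_add]; congr 1; nlinarith
        rw [f1, f2]; ring
      rw [e1]; ring
  · intro e he
    obtain ⟨h, hh⟩ : ∃ h, A.coeff 0 = Polynomial.X ^ (w * (g * b)) * h := by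
      rw [← dvd_def, Polynomial.X_pow_dvd_iff]
      intro i hi
      by_contra h1
      have := (hsupp i h1).1; omega
    have hh0 : h ≠ 0 := by rintro rfl; rw [mul_zero] at hh; exact hA0 hh
    have hdeg : h.natDegree ≤ g := by
      rw [Polynomial.natDegree_le_iff_coeff_eq_zero]
      intro i hi
      by_contra h1
      have := (hsupp (i + w * (g * b)) (by
        rw [hh, mul_comm, Polynomial.coeff_mul_X_pow]; exact h1)).2
      omega
    rw [hh, Polynomial.rootMultiplicity_mul (by rw [← hh]; exact hA0),
      Polynomial.rootMultiplicity_eq_zero (by simp [he]), zero_add]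
    have := Polynomial.count_roots h (a := e)
    rw [← this]
    exact (Multiset.count_le_card _ _).trans ((Polynomial.card_roots' h).trans hdeg)

lemma num_contra (g a b η m : ℕ) (ω : ℤ) (hg : 0 < g) (hη : 0 < η) (ha : 2 ≤ a) (hb : 2 ≤ b)
    (hcop : Nat.Coprime a b) (hB : (g * a * b * η + m : ℤ) ≤ g * (ω + (a + b) * η))
    (hωb : (g : ℤ) * (ω - 1) ≤ m - 1) : False := by
  have ha2 : (2 : ℤ) ≤ a := by exact_mod_cast ha
  have hb2 : (2 : ℤ) ≤ b := by exact_mod_cast hb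
  have hab1 : (1 : ℤ) ≤ a * b - a - b := by
    have : ¬ (a = 2 ∧ b = 2) := by
      rintro ⟨rfl, rfl⟩; revert hcop; decide
    have : (3 : ℤ) ≤ a ∨ (3 : ℤ) ≤ b := by omega
    rcases this with h | h <;> nlinarith
  have hgη : (0 : ℤ) < g * η := by positivity
  have h6 : (g * η : ℤ) * 1 ≤ g * η * (a * b - a - b) := mul_le_mul_of_nonneg_left hab1 hgη.le
  have h7 : (g : ℤ) ≤ g * η := by
    have : (1 : ℤ) ≤ η := by exact_mod_cast hη
    have : (0 : ℤ) < g := by exact_mod_cast hg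
    nlinarith
  have h8 : (g : ℤ) * (ω + (a + b) * η) = g * (ω - 1) + g + g * η * a + g * η * b := by ring
  have h9 : (g * η : ℤ) * (a * b - a - b) = g * a * b * η - g * η * a - g * η * b := by ring
  rw [h8] at hB
  rw [h9] at h6
  linarith

namespace Core
variable {k K : Type} [Field k] [Field K] [Algebra k K] {c : Core k K}

set_option maxHeartbeats 1000000 in
/-- The main numerical step at a state with `p, q > 0`. -/
lemma step [IsAlgClosed k] {P Q N} (st : c.St P Q N) (hp : c.V.v (c.ι P) < 0) :
    ∃ g a b η : ℕ, 0 < a ∧ 0 < b ∧ (c.ε P).natDegree = g * a ∧ (c.ε Q).natDegree = g * b ∧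
      c.V.v (c.ι P) = - (a * η) ∧ c.V.v (c.ι Q) = -(b * η) ∧ (a = 1 ∨ b = 1) ∧
      ∃ e : k, e ≠ 0 ∧ c.V.Ge (c.V.v (c.ι Q ^ a) + 1) (c.ι Q ^ a - algebraMap k K e * c.ι P ^ b) := by
  obtain ⟨hP0, hQ0⟩ := ne_of_jac st.jac
  have hα := no_const (c := c) st.bij hp
  have hβ := no_const (c := c) (bij_swap st.bij) st.hq
  have hslope : ((c.ε Q).natDegree : ℤ) * (- c.V.v (c.ι P)) = (c.ε P).natDegree * (-c.V.v (c.ι Q)) :=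
    le_antisymm (not_lt.1 fun h => slope2 st hα h) (not_lt.1 fun h => slope1 st hα h)
  obtain ⟨Φ, hΦ⟩ := st.bij.2 c.F
  obtain ⟨n1, n2, n3⟩ := Nlem _ _ hα hβ (surj_state st.bij) Φ (ker_state st.bij hΦ)
  obtain ⟨g, a, b, hg, hcop, hαe, hβe⟩ := Nat.exists_coprime' (m := (c.ε P).natDegree)
    (n := (c.ε Q).natDegree) (Nat.gcd_pos_of_pos_left _ hα)
  rw [mul_comm] at hαe hβe
  have ha : 0 < a := by rcases Nat.eq_zero_or_pos a with rfl | h; · simp at hαe; omega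
                        · exact h
  have hb : 0 < b := by rcases Nat.eq_zero_or_pos b with rfl | h; · simp at hβe; omega
                        · exact h
  have hg' : (0 : ℤ) < g := by exact_mod_cast hg
  -- p = a η, q = b η
  have hrel : (b : ℤ) * (- c.V.v (c.ι P)) = a * (-c.V.v (c.ι Q)) := by
    rw [hαe, hβe] at hslope; push_cast at hslope
    have : (g : ℤ) * (b * (- c.V.v (c.ι P))) = g * (a * (-c.V.v (c.ι Q))) := by linarith
    exact mul_left_cancel₀ hg'.ne' this
  obtain ⟨η', hη'⟩ : (a : ℤ) ∣ - c.V.v (c.ι P) := by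
    exact IsCoprime.dvd_of_dvd_mul_left (Nat.isCoprime_iff_coprime.2 hcop) ⟨_, hrel⟩
  have hq' : - c.V.v (c.ι Q) = b * η' := by
    rw [hη'] at hrel
    have : (a : ℤ) * (b * η') = a * (- c.V.v (c.ι Q)) := by linarith
    exact (mul_left_cancel₀ (by positivity) this).symm
  have hη0 : 0 < η' := by
    have : (0 : ℤ) < a * η' := by omega
    exact pos_of_mul_pos_right this (by positivity)
  obtain ⟨η, rfl⟩ : ∃ η : ℕ, η' = η := ⟨η'.toNat, by omega⟩
  have hηpos : 0 < η := by exact_mod_cast hη0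
  obtain ⟨u, w, huw⟩ := bezout_nat a b ha hb hcop
  rw [hαe, hβe] at n1
  rw [hβe] at n3
  obtain ⟨A, hA1, hA2, hA3⟩ := chart (c.ι P) (c.ι Q) hP0 hQ0 Φ g a b u w hg ha hb huw n1 n3
  rw [← ev_map, hΦ] at hA1
  set p := c.ι P with hpdef
  set q := c.ι Q with hqdef
  set ρ := q ^ a / p ^ b with hρ
  set π := q ^ w / p ^ u with hπ
  have hρ0 : ρ ≠ 0 := div_ne_zero (pow_ne_zero _ hQ0) (pow_ne_zero _ hP0)
  have hπ0 : π ≠ 0 := div_ne_zero (pow_ne_zero _ hQ0) (pow_ne_zero _ hP0)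
  have hvp : c.V.v p = -(a * η) := by omega
  have hvq : c.V.v q = -(b * η) := by omega
  have huw' : (a : ℤ) * u = b * w + 1 := by exact_mod_cast huw
  have hvρ : c.V.v ρ = 0 := by
    rw [hρ, c.V.map_div (pow_ne_zero _ hQ0) (pow_ne_zero _ hP0), c.V.map_pow _ hQ0, c.V.map_pow _ hP0,
      hvp, hvq]; ring
  have hvπ : c.V.v π = η := by
    rw [hπ, c.V.map_div (pow_ne_zero _ hQ0) (pow_ne_zero _ hP0), c.V.map_pow _ hQ0, c.V.map_pow _ hP0,
      hvp, hvq]; linear_combination (η : ℤ) * huw'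
  obtain ⟨j, hj, hJ⟩ := st.jac
  have hJ0 : Jac c.D0 c.D1 p q ≠ 0 := by rw [hJ]; simpa using hj
  have hJρ := Jac_monom c.D0 c.D1 p q hP0 hQ0 a b u w huw
  rw [← hρ, ← hπ] at hJρ
  have hJρ0 : Jac c.D0 c.D1 ρ π ≠ 0 := by
    rw [hJρ]; exact mul_ne_zero (mul_ne_zero hρ0 hπ0) (div_ne_zero hJ0 (mul_ne_zero hP0 hQ0))
  have hvJ : c.V.v (Jac c.D0 c.D1 ρ π) = η + (a + b) * η := by
    rw [hJρ, c.V.map_mul (mul_ne_zero hρ0 hπ0) (div_ne_zero hJ0 (mul_ne_zero hP0 hQ0)),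
      c.V.map_mul hρ0 hπ0, c.V.map_div hJ0 (mul_ne_zero hP0 hQ0), c.V.map_mul hP0 hQ0, hvρ, hvπ,
      hJ, c.V.map_const' _ hj, hvp, hvq]; ring
  have hA0 : ev ρ π A ≠ 0 := by
    rw [hA1]; exact mul_ne_zero (pow_ne_zero _ hπ0) ιF_ne
  have hvA : c.V.v (ev ρ π A) = g * a * b * η + c.m := by
    rw [hA1, c.V.map_mul (pow_ne_zero _ hπ0) ιF_ne, c.V.map_pow _ hπ0, hvπ, c.hvF]; push_cast; ring
  have hmpos := c.hm
  have hne : ∀ e : k, ρ - algebraMap k K e ≠ 0 := by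
    intro e h0
    have h1 := Jac_sub_const c.D0 c.D1 ρ π e
    rw [h0, Jac_zero_left] at h1
    exact hJρ0 h1.symm
  obtain ⟨e, he⟩ : ∃ e : k, 0 < c.V.v (ρ - algebraMap k K e) := by
    by_contra hcon
    push Not at hcon
    obtain ⟨h1, h2⟩ := c.V.residue ρ (fun _ => hvρ.ge) (fun e => ⟨hne e, hcon e⟩) (A.coeff 0) hA2
    have h3 := c.V.map_add_of_lt (b := π * ev ρ π A.divX) h1 (by
      have := (c.V.ge_self π).mul (ge_ev c.V ρ π (fun _ => hvρ.ge) (fun _ => by omega) A.divX)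
      exact this.mono (by omega))
    rw [← ev_eq, hvA, h2] at h3
    have h4 := h3.2
    have : (0 : ℤ) ≤ g * a * b * η := by positivity
    omega
  have he0 : e ≠ 0 := by
    rintro rfl
    rw [_root_.map_zero, sub_zero, hvρ] at he
    omega
  refine ⟨g, a, b, η, ha, hb, hαe, hβe, hvp, hvq, ?_, e, he0, ?_⟩
  · by_contra hab
    push Not at hab
    have hLL := LL' c.D0 c.D1 c.V c.ω c.hlog ρ π hJρ0 e he (by omega) A hA2 hA0
    rw [hvA, hvJ, hvπ] at hLL
    have hmul := hA3 e he0
    -- 3 g ≤ d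
    have h3g : 3 * g ≤ c.d := by
      have h1 := st.hα
      have h2 := st.hβ
      rw [hαe] at h1; rw [hβe] at h2
      have ha2 : 2 ≤ a := by omega
      have hb2 : 2 ≤ b := by omega
      have : 3 ≤ a ∨ 3 ≤ b := by
        by_contra h; push Not at h
        have e1 : a = 2 := by omega
        have e2 : b = 2 := by omega
        subst e1 e2; revert hcop; decide
      rcases this with h | h
      · nlinarith
      · nlinarith
    have hωb : (g : ℤ) * (c.ω - 1) ≤ c.m - 1 := by
      have h1 := c.hω
      have h2 : (3 * g : ℤ) ≤ c.d := by exact_mod_cast h3g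
      rcases le_or_gt 0 (c.ω - 1) with h | h
      · nlinarith
      · have : (1 : ℤ) ≤ c.m := by exact_mod_cast hmpos
        nlinarith
    have hmul' : ((A.coeff 0).rootMultiplicity e : ℤ) ≤ g := by exact_mod_cast hmul
    have hnn : (0 : ℤ) ≤ (c.ω + (a + b) * η) := by
      have := c.hlog (ρ - algebraMap k K e) π (hne e) hπ0 (by rw [Jac_sub_const]; exact hJρ0)
      rw [Jac_sub_const, hvJ, hvπ] at this
      linarith
    have hB : (g * a * b * η + c.m : ℤ) ≤ g * (c.ω + (a + b) * η) := by
      refine hLL.trans ?_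
      rw [show ((η : ℤ) + (a + b) * η + c.ω - η) = c.ω + (a + b) * η by ring]
      exact mul_le_mul_of_nonneg_right hmul' hnn
    exact num_contra g a b η c.m c.ω (by omega) (by omega) (by omega) (by omega) hcop hB hωb
  · have h1 : q ^ a - algebraMap k K e * p ^ b = (ρ - algebraMap k K e) * p ^ b := by
      rw [hρ]; have := pow_ne_zero b hP0; field_simp
    rw [h1]
    intro _
    rw [c.V.map_mul (hne e) (pow_ne_zero _ hP0), c.V.map_pow _ hQ0, c.V.map_pow _ hP0, hvp, hvq]
    linarith

end Core
end Yosh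

open MvPolynomial
namespace Yosh
open scoped Polynomial

lemma ge_pow_sub {k K : Type} [Field k] [Field K] [Algebra k K] (V : ZVal k K) (x y : K) (n v : ℤ) (a : ℕ)
    (hx : V.Ge v x) (hn : v ≤ n) (h : V.Ge n (y - x)) : V.Ge (n + a * v - v) (y ^ a - x ^ a) := by
  have hy : V.Ge v y := by
    have := (h.mono hn).add hx
    simpa using this
  rw [← (Commute.all y x).mul_geom_sum₂]
  have : V.Ge (a * v - v) (∑ i ∈ Finset.range a, y ^ i * x ^ (a - 1 - i)) := by
    apply ZVal.Ge.sum
    intro i hi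
    have hi := Finset.mem_range.1 hi
    refine ((hy.pow i).mul (hx.pow (a - 1 - i))).mono (le_of_eq ?_)
    obtain ⟨j, rfl⟩ : ∃ j, a = i + 1 + j := ⟨a - (i+1), by omega⟩
    have : i + 1 + j - 1 - i = j := by omega
    rw [this]; push_cast; ring
  exact (h.mul this).mono (by linarith)

lemma bij_scale {k R : Type} [Field k] [CommRing R] [Algebra k R] {P Q : R}
    (h : Function.Bijective (ev (k := k) P Q)) (c : k) (hc : c ≠ 0) :
    Function.Bijective (ev (k := k) (c • P) Q) := by
  have key : ∀ (P Q : R) (c : k) (A : k[X][X]), ev (c • P) Q A =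
      ev P Q (ev (k := k) (c • (Polynomial.C Polynomial.X) : k[X][X]) Polynomial.X A) := by
    intro P Q c A
    rw [ev_comp, ev_smul, ev_CX, ev_X]
  have inv : ∀ (c c' : k) (h : c' * c = 1) (A : k[X][X]),
      ev (k := k) (c • (Polynomial.C Polynomial.X) : k[X][X]) Polynomial.X (ev (k := k) (c' • (Polynomial.C Polynomial.X) : k[X][X]) Polynomial.X A) = A := by
    intro c c' h A
    rw [ev_comp, ev_smul, ev_CX, ev_X, smul_smul, h, one_smul, ev_id]
  constructor
  · intro A B hAB
    rw [key, key] at hAB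
    have := h.1 hAB
    have h2 := congrArg (ev (k := k) (c⁻¹ • (Polynomial.C Polynomial.X) : k[X][X]) Polynomial.X) this
    rwa [inv _ _ (by field_simp), inv _ _ (by field_simp)] at h2
  · intro r
    obtain ⟨A, rfl⟩ := h.2 r
    refine ⟨ev (k := k) (c⁻¹ • (Polynomial.C Polynomial.X) : k[X][X]) Polynomial.X A, ?_⟩
    rw [key, inv _ _ (by field_simp)]

lemma Jac_elem {k K : Type} [Field k] [Field K] [Algebra k K] (D0 D1 : Derivation k K K) (a b : K) (c : k) (n : ℕ) :
    Jac D0 D1 (a - c • b ^ n) b = Jac D0 D1 a b := by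
  simp [Jac, Algebra.smul_def]; ring

namespace Core
variable {k K : Type} [Field k] [Field K] [Algebra k K] {c : Core k K}

set_option maxHeartbeats 2000000 in
theorem descent [IsAlgClosed k] : ∀ (n : ℕ) (P Q : MvPolynomial (Fin 2) k) (N : ℕ), c.St P Q N →
    (-c.V.v (c.ι P)).toNat + (-c.V.v (c.ι Q)).toNat ≤ n → c.Out P Q := by
  intro n
  induction n with
  | zero => intro P Q N st h; have := st.hq; omega
  | succ n ih =>
  intro P Q N st h
  obtain ⟨hP0, hQ0⟩ := ne_of_jac st.jac
  by_cases hp : 0 ≤ c.V.v (c.ι P)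
  · have hα : (c.ε P).natDegree = 0 := by
      by_contra hα
      refine slope1 st (Nat.pos_of_ne_zero hα) ?_
      have h1 : (0:ℤ) < (c.ε P).natDegree := by exact_mod_cast Nat.pos_of_ne_zero hα
      have := st.hq
      have h2 : (0:ℤ) ≤ (c.ε Q).natDegree := by positivity
      nlinarith
    obtain ⟨κ, e, hκ, hF⟩ := const_case (c := c) st.bij hα
    have hF' : c.F = κ⁻¹ • (P - e • Q ^ 0) := by
      rw [pow_zero, ← Algebra.algebraMap_eq_smul_one, ← hF, smul_smul, inv_mul_cancel₀ hκ, one_smul]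
    have hPF : P = κ • c.F + algebraMap k _ e := by rw [hF]; ring
    obtain ⟨j, hj, hj'⟩ := st.jac
    have hιP : c.ι P = κ • c.ι c.F + algebraMap k _ e := by
      conv_lhs => rw [hPF]
      simp
    refine ⟨Q, ?_, ⟨-(κ⁻¹ * j), by simp [hκ, hj], ?_⟩, ?_⟩
    · apply bij_swap
      rw [hF']
      exact bij_scale (bij_elem st.bij e 0) _ (inv_ne_zero hκ)
    · have : Jac c.D0 c.D1 (c.ι P) (c.ι Q) = κ • Jac c.D0 c.D1 (c.ι c.F) (c.ι Q) := by
        rw [hιP]; simp [Jac, Algebra.smul_def]; ring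
      rw [Jac_swap, _root_.map_neg, _root_.map_mul, ← hj', this, Algebra.smul_def, ← mul_assoc,
        ← _root_.map_mul, inv_mul_cancel₀ hκ, _root_.map_one, one_mul]
    · intro τ hτ h1
      have hτP : τ P = c.ι P := by
        rw [hιP]; conv_lhs => rw [hPF]
        simp [hτ]
      refine ⟨by rw [hτP, sub_self]; exact c.VL.ge_zero _, h1.mono ?_⟩
      have hdP := c.VL_spec c.F F_ne
      have := c.VL.map_add_of_lt (a := κ • c.ι c.F) (b := algebraMap k _ e) (by simp [hκ, ιF_ne]) (by
        refine (c.VL.ge_const e).mono ?_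
        rw [Algebra.smul_def, c.VL.map_mul (by simpa using hκ) ιF_ne, c.VL.map_const' _ hκ, hdP, c.hdeg]
        have := c.hd; omega)
      rw [hιP, this.2, Algebra.smul_def, c.VL.map_mul (by simpa using hκ) ιF_ne, c.VL.map_const' _ hκ, hdP, c.hdeg]
      omega
  push Not at hp
  obtain ⟨g, a, b, η, ha, hb, h1, h2, h3, h4, h5, e, he, h6⟩ := step st hp
  have hη : 0 < (η : ℤ) := by
    have : η ≠ 0 := by rintro rfl; rw [h3] at hp; simp at hp
    omega
  have hsmul : ∀ A B : MvPolynomial (Fin 2) k, ∀ r : k, ∀ n : ℕ, c.ι (A - r • B ^ n) = c.ι A - r • c.ι B ^ n := by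
    intro A B r n; simp
  have hdQ := st.degQ
  have hdP := st.degP
  have hN := st.hN
  by_cases hb1 : b = 1
  · subst hb1
    have haN : a < N := by
      have := st.hp
      rw [h3, h4] at this
      have h7 : (a : ℤ) * η < N * η := by push_cast at this; linarith
      have := lt_of_mul_lt_mul_right h7 hη.le
      exact_mod_cast this
    have hjac : Jac c.D0 c.D1 (c.ι (P - e⁻¹ • Q ^ a)) (c.ι Q) = Jac c.D0 c.D1 (c.ι P) (c.ι Q) := by
      rw [hsmul, Jac_elem]
    have hjac' : ∃ j : k, j ≠ 0 ∧ Jac c.D0 c.D1 (c.ι (P - e⁻¹ • Q ^ a)) (c.ι Q) = algebraMap k K j := by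
      rw [hjac]; exact st.jac
    have hP1 := (ne_of_jac hjac').1
    have hv : c.V.v (c.ι P) + 1 ≤ c.V.v (c.ι (P - e⁻¹ • Q ^ a)) := by
      have := (h6.smul (- e⁻¹)).mono (m := c.V.v (c.ι P) + 1) (by
        rw [c.V.map_pow _ hQ0, h4, h3]; push_cast; linarith)
      have h8 : c.ι (P - e⁻¹ • Q ^ a) = -e⁻¹ • (c.ι Q ^ a - algebraMap k K e * c.ι P ^ 1) := by
        rw [hsmul, pow_one, smul_sub, ← Algebra.smul_def, smul_smul, neg_mul, inv_mul_cancel₀ he]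
        simp only [neg_smul, one_smul]; ring
      rw [h8] at hP1 ⊢
      exact this hP1
    have hdeg1 : c.VL.v (c.ι (P - e⁻¹ • Q ^ a)) = c.VL.v (c.ι P) := by
      rw [hsmul, sub_eq_add_neg]
      refine (c.VL.map_add_of_lt hP0 ?_).2
      apply ZVal.Ge.neg
      apply ZVal.Ge.smul
      refine (c.VL.ge_self _).mono ?_
      rw [c.VL.map_pow _ hQ0, hdP]
      have : (a : ℤ) + 1 ≤ N := by exact_mod_cast haN
      nlinarith
    have st1 : c.St (P - e⁻¹ • Q ^ a) Q N := by
      refine ⟨bij_elem st.bij _ _, hjac', st.hN, st.degQ, by rw [hdeg1, hdP], st.hq, ?_, ?_, st.hβ⟩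
      · have := st.hp; omega
      · rw [_root_.map_sub, _root_.map_smul, _root_.map_pow]
        refine (Polynomial.natDegree_sub_le _ _).trans (max_le st.hα ?_)
        refine (Polynomial.natDegree_smul_le _ _).trans (Polynomial.natDegree_pow_le.trans ?_)
        have := st.hα
        rw [h2]; rw [h1] at this; rw [mul_one, mul_comm]; exact this
    obtain ⟨x', o1, o2, o3⟩ := ih _ _ _ st1 (by omega)
    refine ⟨x', o1, o2, fun τ t1 t2 => ?_⟩
    obtain ⟨e1, e2⟩ := o3 τ t1 t2
    rw [hdeg1] at e2
    refine ⟨?_, e2⟩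
    have e3 := ge_pow_sub c.VL (c.ι Q) (τ Q) _ _ a (c.VL.ge_self _) (by nlinarith) e2
    have : τ P - c.ι P = (τ (P - e⁻¹ • Q ^ a) - c.ι (P - e⁻¹ • Q ^ a)) + e⁻¹ • (τ Q ^ a - c.ι Q ^ a) := by
      simp [smul_sub]; ring
    rw [this]
    refine e1.add ((e3.smul _).mono ?_)
    rw [hdP]
    have : (a : ℤ) + 1 ≤ N := by exact_mod_cast haN
    nlinarith
  · obtain rfl : a = 1 := by tauto
    have hb2 : (2 : ℤ) ≤ b := by omega
    have hjac : Jac c.D0 c.D1 (c.ι (Q - e • P ^ b)) (c.ι P) = Jac c.D0 c.D1 (c.ι Q) (c.ι P) := by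
      rw [hsmul, Jac_elem]
    have hjac' : ∃ j : k, j ≠ 0 ∧ Jac c.D0 c.D1 (c.ι (Q - e • P ^ b)) (c.ι P) = algebraMap k K j := by
      obtain ⟨j, hj, hj'⟩ := st.jac
      refine ⟨-j, by simpa using hj, ?_⟩
      rw [hjac, Jac_swap, hj', _root_.map_neg]
    have hQ1 := (ne_of_jac hjac').1
    have hv : c.V.v (c.ι Q) + 1 ≤ c.V.v (c.ι (Q - e • P ^ b)) := by
      rw [pow_one] at h6
      rw [hsmul] at hQ1 ⊢
      rw [Algebra.smul_def] at hQ1 ⊢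
      exact h6 hQ1
    have hdeg1 : c.VL.v (c.ι (Q - e • P ^ b)) = b * c.VL.v (c.ι P) := by
      rw [hsmul, sub_eq_add_neg, add_comm]
      have hv1 : c.VL.v (-(e • c.ι P ^ b)) = b * c.VL.v (c.ι P) := by
        rw [c.VL.map_neg, Algebra.smul_def, c.VL.map_mul (by simpa using he) (pow_ne_zero _ hP0), c.VL.map_const' _ he,
          c.VL.map_pow _ hP0, zero_add]
      rw [(c.VL.map_add_of_lt (by simp [he, hP0]) ?_).2, hv1]
      refine (c.VL.ge_self _).mono ?_
      rw [hv1, hdP]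
      have : (2 : ℤ) ≤ b * N := by nlinarith
      nlinarith
    have hN' : (1 : ℤ) ≤ N := by exact_mod_cast hN
    have st1 : c.St (Q - e • P ^ b) P b := by
      refine ⟨bij_elem (bij_swap st.bij) _ _, hjac', hb, by rw [hdP]; nlinarith, hdeg1, hp, ?_, ?_, st.hα⟩
      · rw [h4] at hv; rw [h3]; push_cast; push_cast at hv; linarith
      · rw [_root_.map_sub, _root_.map_smul, _root_.map_pow]
        refine (Polynomial.natDegree_sub_le _ _).trans (max_le st.hβ ?_)
        refine (Polynomial.natDegree_smul_le _ _).trans (Polynomial.natDegree_pow_le.trans ?_)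
        have := st.hβ
        rw [h1]; rw [h2] at this; rw [mul_one, mul_comm]; exact this
    obtain ⟨x', o1, o2, o3⟩ := ih _ _ _ st1 (by have := st.hq; omega)
    refine ⟨x', o1, o2, fun τ t1 t2 => ?_⟩
    obtain ⟨e1, e2⟩ := o3 τ t1 t2
    rw [hdeg1] at e2
    refine ⟨e2.mono (by rw [hdP]; have : (1 : ℤ) ≤ b * N := by nlinarith
                        nlinarith), ?_⟩
    have hPneg : c.VL.v (c.ι P) ≤ -1 := st1.degQ
    have e3 := ge_pow_sub c.VL (c.ι P) (τ P) _ _ b (c.VL.ge_self _) (by nlinarith) e2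
    have : τ Q - c.ι Q = (τ (Q - e • P ^ b) - c.ι (Q - e • P ^ b)) + e • (τ P ^ b - c.ι P ^ b) := by
      simp [smul_sub]; ring
    rw [this]
    refine e1.add ((e3.smul _).mono ?_)
    linarith

end Core
end Yosh

open MvPolynomial
namespace Yosh
open scoped Polynomial

lemma bij_std {k : Type} [Field k] :
    Function.Bijective (ev (k := k) (X 0 : MvPolynomial (Fin 2) k) (X 1)) := by
  let φ : MvPolynomial (Fin 2) k →ₐ[k] k[X][X] := aeval ![Polynomial.C Polynomial.X, Polynomial.X]
  refine Function.bijective_iff_has_inverse.2 ⟨φ, ?_, ?_⟩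
  · intro A
    rw [ev_map]
    simp only [φ, aeval_X]
    exact ev_id A
  · intro A
    induction A using MvPolynomial.induction_on with
    | C a => simp only [φ, aeval_C]; exact ev_CC _ _ a
    | add p q hp hq => rw [_root_.map_add, _root_.map_add, hp, hq]
    | mul_X p i hp =>
      rw [_root_.map_mul, _root_.map_mul, hp]
      fin_cases i <;> simp [φ, ev_X, ev_CX]

namespace Core
variable {k K : Type} [Field k] [Field K] [Algebra k K] {c : Core k K}

lemma D_ι (c : Core k K) (A : MvPolynomial (Fin 2) k) :
    c.D0 (c.ι A) = c.ι (pderiv 0 A) ∧ c.D1 (c.ι A) = c.ι (pderiv 1 A) := by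
  induction A using MvPolynomial.induction_on with
  | C a =>
    have : (C a : MvPolynomial (Fin 2) k) = algebraMap k _ a := rfl
    rw [this, AlgHom.commutes]; simp
  | add p q hp hq => simp [hp.1, hp.2, hq.1, hq.2]
  | mul_X p i hp =>
    have h00 := c.D00
    have h01 := c.D01
    have h10 := c.D10
    have h11 := c.D11
    constructor <;>
    · simp only [_root_.map_mul, Derivation.leibniz, _root_.map_add, hp.1, hp.2, smul_eq_mul]
      fin_cases i <;> simp [h00, h01, h10, h11, pderiv_X]

lemma Jac_ι (c : Core k K) (A B : MvPolynomial (Fin 2) k) :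
    ∃ J, Jac c.D0 c.D1 (c.ι A) (c.ι B) = c.ι J := by
  refine ⟨pderiv 0 A * pderiv 1 B - pderiv 1 A * pderiv 0 B, ?_⟩
  simp [Jac, (D_ι c A).1, (D_ι c A).2, (D_ι c B).1, (D_ι c B).2]

lemma VL_X (c : Core k K) (i : Fin 2) : c.VL.v (c.ι (X i)) = -1 := by
  rw [c.VL_spec _ (X_ne_zero i), totalDegree_X]; simp

structure Start (c : Core k K) (P Q : MvPolynomial (Fin 2) k) : Prop where
  lin : ∃ (i j : Fin 2) (a : k), i ≠ j ∧ P = X i - a • X j ^ 1 ∧ Q = X j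
  bij : Function.Bijective (ev (k := k) P Q)
  jac : ∃ j : k, j ≠ 0 ∧ Jac c.D0 c.D1 (c.ι P) (c.ι Q) = algebraMap k K j
  hα : 0 < (c.ε P).natDegree
  hlt : (c.ε P).natDegree < (c.ε Q).natDegree
  degP : c.VL.v (c.ι P) = -1
  degQ : c.VL.v (c.ι Q) = -1
  hβ : (c.ε Q).natDegree = c.d
  hΦ : ∃ Φ : k[X][X], ev P Q Φ = c.F ∧ Wt (c.ε P).natDegree c.d ((c.ε P).natDegree * c.d) Φ ∧
    (Φ.coeff 0).coeff c.d ≠ 0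

lemma start_aux (i j : Fin 2) (hij : i ≠ j) (a : k)
    (hlt : (c.ε (X i - a • X j ^ 1)).natDegree < (c.ε (X j)).natDegree) :
    c.Start (X i - a • X j ^ 1) (X j) := by
  have hbij : Function.Bijective (ev (k := k) (X i : MvPolynomial (Fin 2) k) (X j)) := by
    have := bij_std (k := k)
    fin_cases i <;> fin_cases j <;> first | (exact absurd rfl hij) | exact this | exact bij_swap this
  have hjac : ∃ j' : k, j' ≠ 0 ∧ Jac c.D0 c.D1 (c.ι (X i)) (c.ι (X j)) = algebraMap k K j' := by
    have h00 := c.D00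
    have h01 := c.D01
    have h10 := c.D10
    have h11 := c.D11
    fin_cases i <;> fin_cases j
    · exact absurd rfl hij
    · refine ⟨1, one_ne_zero, ?_⟩; simp [Jac, h00, h01, h10, h11]
    · refine ⟨-1, by simp, ?_⟩; simp [Jac, h00, h01, h10, h11]
    · exact absurd rfl hij
  have hb := bij_elem hbij a 1
  have hj' : Jac c.D0 c.D1 (c.ι (X i - a • X j ^ 1)) (c.ι (X j)) = Jac c.D0 c.D1 (c.ι (X i)) (c.ι (X j)) := by
    rw [_root_.map_sub, _root_.map_smul, _root_.map_pow, Jac_elem]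
  have hjac2 : ∃ j' : k, j' ≠ 0 ∧ Jac c.D0 c.D1 (c.ι (X i - a • X j ^ 1)) (c.ι (X j)) = algebraMap k K j' := by
    rw [hj']; exact hjac
  have hne := ne_of_jac hjac2
  have hdeg : (X i - a • X j ^ 1 : MvPolynomial (Fin 2) k).totalDegree ≤ 1 := by
    refine (totalDegree_sub _ _).trans (max_le (by rw [totalDegree_X]) ?_)
    refine (totalDegree_smul_le _ _).trans ?_
    rw [pow_one, totalDegree_X]
  have hα : 0 < (c.ε (X i - a • X j ^ 1)).natDegree := by
    by_contra h
    obtain ⟨κ, e, hκ, hF⟩ := const_case (c := c) hb (by omega)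
    have : c.F = κ⁻¹ • (X i - a • X j ^ 1 - algebraMap k _ e) := by
      rw [← hF, smul_smul, inv_mul_cancel₀ hκ, one_smul]
    have h2 : c.F.totalDegree ≤ 1 := by
      rw [this]
      refine (totalDegree_smul_le _ _).trans ((totalDegree_sub _ _).trans (max_le hdeg ?_))
      rw [algebraMap_eq, totalDegree_C]; omega
    rw [c.hdeg] at h2; have := c.hd; omega
  have hdP : c.VL.v (c.ι (X i - a • X j ^ 1)) = -1 := by
    have hP : (X i - a • X j ^ 1 : MvPolynomial (Fin 2) k) ≠ 0 := by
      intro h; apply hne.1; rw [h, map_zero]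
    rw [c.VL_spec _ hP]
    have : (X i - a • X j ^ 1 : MvPolynomial (Fin 2) k).totalDegree ≠ 0 := by
      intro h
      rw [totalDegree_eq_zero_iff_eq_C] at h
      rw [h] at hα
      have h1 := AlgHom.commutes c.ε (coeff 0 (X i - a • X j ^ 1 : MvPolynomial (Fin 2) k))
      rw [algebraMap_eq] at h1
      rw [h1, Polynomial.algebraMap_eq, Polynomial.natDegree_C] at hα
      omega
    omega
  obtain ⟨Φ, hΦ⟩ := hb.2 c.F
  obtain ⟨n1, n2, n3⟩ := Nlem _ _ hα (by omega) (surj_state hb) Φ (ker_state hb hΦ)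
  have hβ : (c.ε (X j)).natDegree = c.d := by
    have hα' : (0 : ℤ) < (c.ε (X i - a • X j ^ 1)).natDegree := by exact_mod_cast hα
    have hlt' : ((c.ε (X i - a • X j ^ 1)).natDegree : ℤ) < (c.ε (X j)).natDegree := by exact_mod_cast hlt
    have := ev_dom c.VL (c.ι (X i - a • X j ^ 1)) (c.ι (X j)) hne.1 hne.2 Φ _ 0 n3 (by
      intro i' j' h h'
      have h1 := n1 _ _ h
      rw [hdP, VL_X]
      push_cast
      set α := (c.ε (X i - a • X j ^ 1)).natDegree
      set β := (c.ε (X j)).natDegree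
      rcases Nat.eq_zero_or_pos j' with rfl | hj
      · have : i' ≠ β := by rintro rfl; exact h' rfl
        push_cast at h1
        have : (i' : ℤ) ≤ β := by
          have : (α : ℤ) * i' ≤ α * β := by linarith
          exact le_of_mul_le_mul_left this hα'
        push_cast; omega
      · have hj : (0 : ℤ) < j' := by exact_mod_cast hj
        have : (α : ℤ) * (i' + j') < α * β := by nlinarith
        have := lt_of_mul_lt_mul_left this hα'.le
        linarith)
    rw [← ev_map, hΦ, c.VL_spec _ F_ne, hdP, c.hdeg] at this
    push_cast at this
    omega
  refine ⟨⟨i, j, a, hij, rfl, rfl⟩, hb, hjac2, hα, hlt, hdP, VL_X c j, hβ, Φ, hΦ, ?_, ?_⟩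
  · rw [hβ] at n1; exact n1
  · rw [hβ] at n3; exact n3

lemma start (c : Core k K) : ∃ P Q, c.Start P Q := by
  have main : ∀ i j : Fin 2, i ≠ j → (c.ε (X i)).natDegree ≤ (c.ε (X j)).natDegree → ∃ P Q, c.Start P Q := by
    intro i j hij hle
    have hpos : 0 < (c.ε (X j)).natDegree := by
      by_contra h
      obtain ⟨A, hA⟩ := c.ε_surj Polynomial.X
      have hc : ∀ i : Fin 2, ∃ r, c.ε (X i) = Polynomial.C r := by
        intro l
        have : l = i ∨ l = j := by omega
        refine ⟨_, Polynomial.eq_C_of_natDegree_eq_zero ?_⟩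
        rcases this with rfl | rfl <;> omega
      choose r hr using hc
      have : ∃ s, c.ε A = Polynomial.C s := by
        have : c.ε = (Algebra.ofId k k[X]).comp (aeval r) := by
          apply MvPolynomial.algHom_ext
          intro l
          rw [hr l]; simp [Algebra.ofId_apply, Polynomial.algebraMap_eq]
        exact ⟨aeval r A, by rw [this]; rfl⟩
      obtain ⟨s, hs⟩ := this
      rw [hs] at hA
      exact Polynomial.X_ne_C s hA.symm
    rcases hle.lt_or_eq with hlt | heq
    · exact ⟨_, _, start_aux i j hij 0 (by simpa using hlt)⟩
    · refine ⟨_, _, start_aux i j hij ((c.ε (X i)).leadingCoeff / (c.ε (X j)).leadingCoeff) ?_⟩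
      have hj0 : c.ε (X j) ≠ 0 := by intro h; rw [h] at hpos; simp at hpos
      have hi0 : c.ε (X i) ≠ 0 := by intro h; rw [h] at heq; simp at heq; omega
      have hl : (c.ε (X j)).leadingCoeff ≠ 0 := by simpa using hj0
      have hl' : (c.ε (X i)).leadingCoeff ≠ 0 := by simpa using hi0
      rw [pow_one, _root_.map_sub, _root_.map_smul]
      set p := c.ε (X i)
      set q := c.ε (X j)
      have hdlt := Polynomial.degree_sub_lt_left (p := p) (q := (p.leadingCoeff / q.leadingCoeff) • q) (by
        rw [Polynomial.smul_eq_C_mul, Polynomial.degree_C_mul (div_ne_zero hl' hl)]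
        rw [Polynomial.degree_eq_natDegree hi0, Polynomial.degree_eq_natDegree hj0, heq]) hi0 (by
        rw [Polynomial.smul_eq_C_mul, Polynomial.leadingCoeff_mul, Polynomial.leadingCoeff_C, div_mul_cancel₀ _ hl])
      rw [← heq]
      by_cases h0 : p - (p.leadingCoeff / q.leadingCoeff) • q = 0
      · rw [h0, Polynomial.natDegree_zero]; omega
      · exact Polynomial.natDegree_lt_natDegree h0 hdlt
  rcases le_total (c.ε (X 0)).natDegree (c.ε (X 1)).natDegree with h | h
  · exact main 0 1 (by decide) h
  · exact main 1 0 (by decide) h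


/-- Conclusion of the affine part. -/
def Concl (c : Core k K) : Prop :=
  c.m = 1 ∧ ∃ τ : MvPolynomial (Fin 2) k →ₐ[k] K, Function.Injective τ ∧ τ c.F = c.ι c.F ∧
    (∀ A, c.V.Ge 0 (τ A)) ∧ c.VL.Ge (-1) (τ (X 0)) ∧ c.VL.Ge (-1) (τ (X 1)) ∧
    ∀ w : ZVal k K, (∀ A, w.Ge 0 (c.ι A)) → w.v (c.ι c.F) = 0 → ∀ A, w.Ge 0 (τ A)

lemma F_prime (c : Core k K) : Prime c.F := by
  refine ⟨F_ne, ?_, ?_⟩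
  · intro h
    have := (c.ε_ker 1).2 h.dvd
    simp at this
  · intro a b h
    rw [← c.ε_ker, _root_.map_mul, mul_eq_zero, c.ε_ker, c.ε_ker] at h
    exact h

lemma omega_le (c : Core k K) : c.ω ≤ c.m := by
  have h1 := c.hω
  have h2 : (3 : ℤ) ≤ c.d := by exact_mod_cast c.hd
  have h3 : (1 : ℤ) ≤ c.m := by exact_mod_cast c.hm
  by_contra h
  nlinarith

lemma aeval_sub_dvd (c : Core k K) (s0 : MvPolynomial (Fin 2) k) (hs0 : c.ε s0 = Polynomial.X)
    (A : MvPolynomial (Fin 2) k) : ∃ G, A = Polynomial.aeval s0 (c.ε A) + c.F * G := by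
  have : c.F ∣ A - Polynomial.aeval s0 (c.ε A) := by
    rw [← c.ε_ker, _root_.map_sub, ← Polynomial.aeval_algHom_apply, hs0, Polynomial.aeval_X_left_apply, sub_self]
  obtain ⟨G, hG⟩ := this
  exact ⟨G, by rw [← hG]; ring⟩

/-- case (a): everything regular. -/
lemma caseA [IsAlgClosed k] (c : Core k K) (hfrac : ∀ a : K, ∃ A B, B ≠ 0 ∧ a = c.ι A / c.ι B)
    (hone : ∃ a : K, a ≠ 0 ∧ c.V.v a = 1) (hreg : ∀ A, c.V.Ge 0 (c.ι A)) : c.Concl := by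
  have key : ∀ A, ¬ c.F ∣ A → c.V.v (c.ι A) = 0 := by
    intro A hA
    have hA0 : A ≠ 0 := by rintro rfl; exact hA (dvd_zero _)
    have hιA : c.ι A ≠ 0 := by
      intro h; exact hA0 (c.ι_inj (by rw [h, map_zero]))
    by_contra hne
    have hpos : 1 ≤ c.V.v (c.ι A) := by have := hreg A hιA; omega
    obtain ⟨s0, hs0⟩ := c.ε_surj Polynomial.X
    obtain ⟨G, hG⟩ := aeval_sub_dvd c s0 hs0 A
    have hεA : c.ε A ≠ 0 := by rw [Ne, c.ε_ker]; exact hA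
    have hvF : c.V.Ge 1 (c.ι c.F) := fun _ => by rw [c.hvF]; exact_mod_cast c.hm
    have hp : c.V.Ge 1 (Polynomial.aeval (c.ι s0) (c.ε A)) := by
      have : Polynomial.aeval (c.ι s0) (c.ε A) = c.ι A - c.ι c.F * c.ι G := by
        rw [Polynomial.aeval_algHom_apply, ← _root_.map_mul, ← _root_.map_sub]
        congr 1; linear_combination -hG
      rw [this]
      exact ((c.V.ge_self _).mono hpos).sub ((hvF.mul (hreg G)).mono (by omega))
    have hex : ∃ r : k, 1 ≤ c.V.v (c.ι s0 - algebraMap k K r) := by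
      by_contra hno
      push Not at hno
      have := c.V.residue (c.ι s0) (hreg s0) (fun r => ⟨?_, by have := hno r; omega⟩) (c.ε A) hεA
      · have h2 := hp this.1; omega
      · intro h0
        have : s0 - algebraMap k _ r = 0 := c.ι_inj (by rw [_root_.map_sub, AlgHom.commutes, h0, map_zero])
        have h3 := congrArg c.ε this
        rw [_root_.map_sub, AlgHom.commutes, hs0, map_zero, Polynomial.algebraMap_eq] at h3
        exact Polynomial.X_sub_C_ne_zero r h3
    obtain ⟨r, hr⟩ := hex
    -- the Jacobian
    have hJ : ¬ c.V.Ge 1 (Jac c.D0 c.D1 (c.ι s0) (c.ι c.F)) := by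
      intro hJ
      obtain ⟨G1, hG1⟩ := aeval_sub_dvd c s0 hs0 (X 0)
      obtain ⟨G2, hG2⟩ := aeval_sub_dvd c s0 hs0 (X 1)
      have hx := congrArg c.ι hG1
      have hy := congrArg c.ι hG2
      rw [_root_.map_add, _root_.map_mul, ← Polynomial.aeval_algHom_apply] at hx hy
      obtain ⟨J1, hJ1⟩ := Jac_ι c s0 G2
      obtain ⟨J2, hJ2⟩ := Jac_ι c G1 s0
      obtain ⟨J3, hJ3⟩ := Jac_ι c G1 (c.F * G2)
      obtain ⟨J4, hJ4⟩ := Jac_ι c c.F G2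
      have h1 : Jac c.D0 c.D1 (c.ι (X 0)) (c.ι (X 1)) = 1 := by
        have h00 := c.D00
        have h01 := c.D01
        have h10 := c.D10
        have h11 := c.D11
        simp [Jac, h00, h01, h10, h11]
      set p0 := c.ε (X 0)
      set p1 := c.ε (X 1)
      have hd : ∀ p : k[X], ∀ D : Derivation k K K, D (Polynomial.aeval (c.ι s0) p) =
          c.ι (Polynomial.aeval s0 (Polynomial.derivative p)) * D (c.ι s0) := by
        intro p D
        rw [Derivation.map_aeval, ← Polynomial.aeval_algHom_apply, smul_eq_mul]
      have h2 : Jac c.D0 c.D1 (c.ι (X 0)) (c.ι (X 1)) = Jac c.D0 c.D1 (c.ι s0) (c.ι c.F) *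
          c.ι (Polynomial.aeval s0 (Polynomial.derivative p0) * G2 - Polynomial.aeval s0 (Polynomial.derivative p1) * G1
            )
          + c.ι c.F * c.ι (Polynomial.aeval s0 (Polynomial.derivative p0) * J1 +
             Polynomial.aeval s0 (Polynomial.derivative p1) * J2 + J3 + G1 * J4) := by
        rw [hx, hy]
        simp only [_root_.map_add, _root_.map_mul, _root_.map_sub, ← hJ1, ← hJ2, ← hJ3, ← hJ4, Jac, hd,
          Derivation.leibniz, smul_eq_mul]
        ring
      rw [h1] at h2
      have h3 : c.V.Ge 1 (1 : K) := by
        rw [h2]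
        exact ((hJ.mul (hreg _)).mono (by omega)).add ((hvF.mul (hreg _)).mono (by omega))
      have := h3 one_ne_zero
      rw [c.V.map_one] at this; omega
    have hJ0 : Jac c.D0 c.D1 (c.ι s0) (c.ι c.F) ≠ 0 := by
      intro h; rw [h] at hJ; exact hJ (c.V.ge_zero _)
    have hJv : c.V.v (Jac c.D0 c.D1 (c.ι s0) (c.ι c.F)) ≤ 0 := by
      by_contra h; exact hJ fun _ => by omega
    have h5 := c.hlog (c.ι s0 - algebraMap k K r) (c.ι c.F) (by
      intro h0; apply hJ0; rw [← Jac_sub_const c.D0 c.D1 _ _ r, h0, Jac_zero_left]) ιF_ne (by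
      rw [Jac_sub_const]; exact hJ0)
    rw [Jac_sub_const, c.hvF] at h5
    have := omega_le c
    omega
  have hm1 : ∀ A, A ≠ 0 → (c.m : ℤ) ∣ c.V.v (c.ι A) := by
    intro A hA
    obtain ⟨n, A', hA', rfl⟩ := WfDvdMonoid.max_power_factor hA (F_prime c).irreducible
    have h0 : c.ι A' ≠ 0 := by
      intro h
      have : A' = 0 := c.ι_inj (by rw [h, map_zero])
      exact hA' (this ▸ dvd_zero _)
    rw [_root_.map_mul, _root_.map_pow, c.V.map_mul (pow_ne_zero _ ιF_ne) h0, c.V.map_pow _ ιF_ne, key _ hA', c.hvF]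
    simp
  refine ⟨?_, c.ι, c.ι_inj, rfl, hreg, ?_, ?_, fun w hw _ => hw⟩
  · obtain ⟨a, ha, hv⟩ := hone
    obtain ⟨A, B, hB, rfl⟩ := hfrac a
    have hA : A ≠ 0 := by rintro rfl; simp at ha
    have hιA : c.ι A ≠ 0 := by
      intro h; exact hA (c.ι_inj (by rw [h, map_zero]))
    have hιB : c.ι B ≠ 0 := by
      intro h; exact hB (c.ι_inj (by rw [h, map_zero]))
    rw [c.V.map_div hιA hιB] at hv
    have := dvd_sub (hm1 A hA) (hm1 B hB)
    rw [hv] at this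
    have := Int.eq_one_of_dvd_one (by positivity) this
    exact_mod_cast this
  · intro _; rw [VL_X]
  · intro _; rw [VL_X]

/-- case (b): the initial state of the descent. -/
lemma caseB_start [IsAlgClosed k] {P Q} (st : c.Start P Q) (hreg : ¬ ∀ A, c.V.Ge 0 (c.ι A)) : c.Out P Q := by
  obtain ⟨hP0, hQ0⟩ := ne_of_jac st.jac
  have hneg : c.V.v (c.ι P) < 0 ∨ c.V.v (c.ι Q) < 0 := by
    by_contra h
    push Not at h
    apply hreg
    intro A
    obtain ⟨D, rfl⟩ := st.bij.2 A
    rw [ev_map]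
    exact ge_ev c.V _ _ (fun _ => h.1) (fun _ => h.2) D
  have hlt : c.V.v (c.ι Q) < c.V.v (c.ι P) := by
    by_contra hle
    push Not at hle
    have hPneg : c.V.v (c.ι P) < 0 := by omega
    obtain ⟨Φ, hΦ, n1, n3⟩ := st.hΦ
    have hα' : (0 : ℤ) < (c.ε P).natDegree := by exact_mod_cast st.hα
    have hlt' : ((c.ε P).natDegree : ℤ) < c.d := by rw [← st.hβ]; exact_mod_cast st.hlt
    have := ev_dom c.V (c.ι P) (c.ι Q) hP0 hQ0 Φ _ 0 n3 (by
      intro i' j' h h'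
      have h1 := n1 _ _ h
      push_cast
      set α := (c.ε P).natDegree
      have hlt2 : (i' : ℤ) + j' < c.d := by
        rcases Nat.eq_zero_or_pos j' with rfl | hj
        · have : i' ≠ c.d := by rintro rfl; exact h' rfl
          push_cast at h1
          have : (i' : ℤ) ≤ c.d := by
            have : (α : ℤ) * i' ≤ α * c.d := by linarith
            exact le_of_mul_le_mul_left this hα'
          push_cast; omega
        · have hj : (0 : ℤ) < j' := by exact_mod_cast hj
          have : (α : ℤ) * (i' + j') < α * c.d := by nlinarith
          exact lt_of_mul_lt_mul_left this hα'.le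
      have hj : (0 : ℤ) ≤ j' := by positivity
      nlinarith)
    rw [← ev_map, hΦ, c.hvF] at this
    push_cast at this
    have hd := c.hd
    have : (3 : ℤ) ≤ c.d := by exact_mod_cast hd
    have : (0 : ℤ) ≤ c.m := by positivity
    nlinarith
  refine descent _ P Q 1 ⟨st.bij, st.jac, le_rfl, by rw [st.degQ], by rw [st.degP, st.degQ]; simp, by omega,
    by simpa using hlt, ?_, by rw [st.hβ]⟩ le_rfl
  have := st.hβ; have := st.hlt; omega

end Core
end Yosh

open MvPolynomial
namespace Yosh
open scoped Polynomial

section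
variable {k K : Type} [Field k] [Field K] [Algebra k K]

/-- homogenised substitution. -/
lemma HS (Θ : k[X][X]) (a b : k[X]) (J : ℕ) : ∃ Ψ : k[X][X],
    (∀ (s t x : K), t ^ J * x = Polynomial.aeval t a * s + Polynomial.aeval t b →
      ev t s Ψ = t ^ (J * Θ.natDegree) * ev t x Θ) ∧
    Ψ.coeff Θ.natDegree = Θ.leadingCoeff * a ^ Θ.natDegree ∧ Ψ.natDegree ≤ Θ.natDegree := by
  have hlin : (Polynomial.C a * Polynomial.X + Polynomial.C b).natDegree ≤ 1 := Polynomial.natDegree_linear_le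
  have hn : ∀ n, ((Polynomial.C a * Polynomial.X + Polynomial.C b) ^ n).natDegree ≤ n := fun n =>
    Polynomial.natDegree_pow_le.trans (by nlinarith)
  refine ⟨∑ n ∈ Finset.range (Θ.natDegree + 1), Polynomial.C (Θ.coeff n * Polynomial.X ^ (J * (Θ.natDegree - n))) *
    (Polynomial.C a * Polynomial.X + Polynomial.C b) ^ n, ?_, ?_, ?_⟩
  · intro s t x h
    conv_rhs => rw [ev, Polynomial.coe_eval₂RingHom, Polynomial.eval₂_eq_sum_range, Finset.mul_sum]
    rw [_root_.map_sum]
    refine Finset.sum_congr rfl fun n hn => ?_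
    have hn : n ≤ Θ.natDegree := by simpa [Nat.lt_succ_iff] using hn
    obtain ⟨l, hl⟩ := Nat.exists_eq_add_of_le hn
    have e1 : ev t s (Polynomial.C a * Polynomial.X + Polynomial.C b) = t ^ J * x := by
      rw [_root_.map_add, _root_.map_mul, ev_C, ev_C, ev_X, h]
    have e2 : Θ.natDegree - n = l := by omega
    rw [_root_.map_mul (ev t s), _root_.map_pow (ev t s), e1, ev_C, e2, hl, _root_.map_mul, _root_.map_pow, Polynomial.aeval_X]
    simp only [RingHom.coe_coe]
    ring
  · rw [Polynomial.finsetSum_coeff, Finset.sum_range_succ, Finset.sum_eq_zero]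
    · rw [Polynomial.coeff_C_mul]
      have := Polynomial.coeff_pow_of_natDegree_le hlin (m := Θ.natDegree)
      rw [mul_one] at this
      rw [this]
      simp
    · intro n hn'
      rw [Polynomial.coeff_C_mul, Polynomial.coeff_eq_zero_of_natDegree_lt (p := _ ^ n), mul_zero]
      exact (hn n).trans_lt (Finset.mem_range.1 hn')
  · refine Polynomial.natDegree_sum_le_of_forall_le _ _ fun n hn' => ?_
    refine (Polynomial.natDegree_C_mul_le _ _).trans ((hn n).trans ?_)
    have := Finset.mem_range.1 hn'; omega

lemma trail (A : k[X][X]) (hA : A ≠ 0) : ∃ A' : k[X][X], A = A' * Polynomial.X ^ A.natTrailingDegree ∧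
    A'.coeff 0 ≠ 0 ∧ A'.coeff 0 = A.coeff A.natTrailingDegree := by
  have : Polynomial.X ^ A.natTrailingDegree ∣ A := by
    rw [Polynomial.X_pow_dvd_iff]
    intro n hn
    exact Polynomial.coeff_eq_zero_of_lt_natTrailingDegree hn
  obtain ⟨A', hA'⟩ := this
  have h1 : A'.coeff 0 = A.coeff A.natTrailingDegree := by
    have := Polynomial.coeff_X_pow_mul A' A.natTrailingDegree 0
    rw [zero_add, ← hA'] at this
    exact this.symm
  refine ⟨A', by rw [mul_comm]; exact hA', ?_, h1⟩
  rw [h1]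
  exact Polynomial.trailingCoeff_nonzero_iff_nonzero.2 hA

lemma LLt [IsAlgClosed k] (D0 D1 : Derivation k K K) (V : ZVal k K) (ω : ℤ)
    (hlog : ∀ a b, a ≠ 0 → b ≠ 0 → Jac D0 D1 a b ≠ 0 → V.v a + V.v b ≤ V.v (Jac D0 D1 a b) + ω)
    (s t : K) (hJ : Jac D0 D1 s t ≠ 0) (hs : 0 < V.v s) (ht : 0 < V.v t)
    (A : k[X][X]) (n i : ℕ) (hn : A.coeff n ≠ 0) (hi : ∀ n, (A.coeff n).natDegree ≤ i) (hA : ev s t A ≠ 0)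
    (hΩ : 0 ≤ V.v (Jac D0 D1 s t) + ω - V.v t) :
    V.v (ev s t A) ≤ n * V.v t + i * (V.v (Jac D0 D1 s t) + ω - V.v t) := by
  have hA0 : A ≠ 0 := by rintro rfl; simp at hn
  obtain ⟨A', h1, h2, h3⟩ := trail A hA0
  have hle : A.natTrailingDegree ≤ n := Polynomial.natTrailingDegree_le_of_ne_zero hn
  have ht0 : t ≠ 0 := by rintro rfl; exact hJ (Jac_zero_right _ _ _)
  have hev : ev s t A = ev s t A' * t ^ A.natTrailingDegree := by
    conv_lhs => rw [h1]
    rw [_root_.map_mul, _root_.map_pow, ev_X]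
  have hA' : ev s t A' ≠ 0 := by intro h; rw [hev, h, zero_mul] at hA; exact hA rfl
  have hl : (A'.coeff 0).coeff (A'.coeff 0).natDegree ≠ 0 := by
    rw [← Polynomial.leadingCoeff]; simpa using h2
  have := LL D0 D1 V ω hlog s t hJ hs ht A' _ hl hA'
  rw [hev, V.map_mul hA' (pow_ne_zero _ ht0), V.map_pow _ ht0]
  have h4 : ((A'.coeff 0).natDegree : ℤ) ≤ i := by rw [h3]; exact_mod_cast hi _
  have h5 : (A.natTrailingDegree : ℤ) ≤ n := by exact_mod_cast hle
  nlinarith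

lemma Gauss [IsAlgClosed k] (V : ZVal k K) (s t : K) (hs : V.Ge 0 s)
    (hc : ∀ c : k, s - algebraMap k K c ≠ 0 ∧ V.v (s - algebraMap k K c) ≤ 0) (ht0 : t ≠ 0) (ht : V.v t = 1)
    (A : k[X][X]) (n : ℕ) (hn : A.coeff n ≠ 0) : V.v (ev s t A) ≤ n := by
  have hA0 : A ≠ 0 := by rintro rfl; simp at hn
  obtain ⟨A', h1, h2, h3⟩ := trail A hA0
  have hle : A.natTrailingDegree ≤ n := Polynomial.natTrailingDegree_le_of_ne_zero hn
  have hev : ev s t A = ev s t A' * t ^ A.natTrailingDegree := by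
    conv_lhs => rw [h1]
    rw [_root_.map_mul, _root_.map_pow, ev_X]
  obtain ⟨r1, r2⟩ := V.residue s hs hc _ h2
  have h4 := V.map_add_of_lt r1 (b := t * ev s t A'.divX) (by
    rw [r2]
    exact ((V.ge_self t).mul (ge_ev V s t hs (fun _ => by omega) A'.divX)).mono (by omega))
  rw [← ev_eq, r2] at h4
  rw [hev, V.map_mul h4.1 (pow_ne_zero _ ht0), V.map_pow _ ht0, h4.2, ht]
  omega
end

namespace Core
variable {k K : Type} [Field k] [Field K] [Algebra k K] {c : Core k K}

lemma bound1 [IsAlgClosed k] (x' : MvPolynomial (Fin 2) k) (hbij : Function.Bijective (ev (k := k) x' c.F))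
    (hj : ∃ j : k, j ≠ 0 ∧ Jac c.D0 c.D1 (c.ι x') (c.ι c.F) = algebraMap k K j)
    (Θ : k[X][X]) (hΘ : Θ ≠ 0) : c.V.v (c.ι (ev c.F x' Θ)) ≤ c.m * Θ.leadingCoeff.natTrailingDegree := by
  obtain ⟨j, hj0, hj⟩ := hj
  have hbij' := bij_swap hbij
  have hx0 := (ne_of_jac (c := c) ⟨j, hj0, hj⟩).1
  obtain ⟨J, hJ1, hJ2⟩ : ∃ J : ℕ, 1 ≤ c.V.v (c.ι x') + J * c.m ∧ 0 ≤ J * (c.m : ℤ) + c.ω - c.m := by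
    refine ⟨(1 + (-c.V.v (c.ι x')).toNat + (-c.ω).toNat + c.m), ?_, ?_⟩
    · have := c.hm
      have h : (1 : ℤ) ≤ c.m := by exact_mod_cast this
      push_cast
      nlinarith [Int.self_le_toNat (-c.V.v (c.ι x')), Int.self_le_toNat (-c.ω)]
    · have := c.hm
      have h : (1 : ℤ) ≤ c.m := by exact_mod_cast this
      push_cast
      nlinarith [Int.self_le_toNat (-c.V.v (c.ι x')), Int.self_le_toNat (-c.ω), (Int.natCast_nonneg (-c.V.v (c.ι x')).toNat), (Int.natCast_nonneg (-c.ω).toNat)]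
  obtain ⟨Ψ, h1, h2, h3⟩ := HS (K := K) Θ 1 0 J
  have h4 := h1 (c.ι c.F ^ J * c.ι x') (c.ι c.F) (c.ι x') (by simp)
  have hA0 : ev (c.ι c.F) (c.ι x') Θ ≠ 0 := by
    rw [← ev_map]
    intro h
    have := c.ι_inj (h.trans (map_zero _).symm)
    exact hΘ (hbij'.1 (this.trans (map_zero _).symm))
  have hJac : Jac c.D0 c.D1 (c.ι c.F ^ J * c.ι x') (c.ι c.F) = c.ι c.F ^ J * algebraMap k K j := by
    rw [← hj]; simp [Jac]; ring
  have hvs : c.V.v (c.ι c.F ^ J * c.ι x') = J * c.m + c.V.v (c.ι x') := by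
    rw [c.V.map_mul (pow_ne_zero _ ιF_ne) hx0, c.V.map_pow _ ιF_ne, c.hvF]
  have hvJ : c.V.v (Jac c.D0 c.D1 (c.ι c.F ^ J * c.ι x') (c.ι c.F)) = J * c.m := by
    rw [hJac, c.V.map_mul (pow_ne_zero _ ιF_ne) (by simpa using hj0), c.V.map_pow _ ιF_ne, c.hvF, c.V.map_const' _ hj0, add_zero]
  have hev : ev (c.ι c.F ^ J * c.ι x') (c.ι c.F) (swp Ψ) = c.ι c.F ^ (J * Θ.natDegree) * ev (c.ι c.F) (c.ι x') Θ := by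
    rw [ev_swp, h4]
  have hlead : Θ.leadingCoeff ≠ 0 := by simpa using hΘ
  have hco : (swp Ψ).coeff Θ.leadingCoeff.natTrailingDegree ≠ 0 := by
    intro h
    have h5 := coeff_swp Ψ Θ.natDegree Θ.leadingCoeff.natTrailingDegree
    rw [h, h2] at h5
    simp only [one_pow, mul_one, Polynomial.coeff_zero] at h5
    exact Polynomial.trailingCoeff_nonzero_iff_nonzero.2 hlead h5.symm
  have hm : (1 : ℤ) ≤ c.m := by exact_mod_cast c.hm
  have := LLt c.D0 c.D1 c.V c.ω c.hlog (c.ι c.F ^ J * c.ι x') (c.ι c.F) (by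
      rw [hJac]; exact mul_ne_zero (pow_ne_zero _ ιF_ne) (by simpa using hj0)) (by rw [hvs]; omega) (by rw [c.hvF]; omega)
      (swp Ψ) _ Θ.natDegree hco (by
        intro n
        rw [Polynomial.natDegree_le_iff_coeff_eq_zero]
        intro N hN
        rw [coeff_swp, Polynomial.coeff_eq_zero_of_natDegree_lt (p := Ψ) (by omega), Polynomial.coeff_zero]) (by
      rw [hev]; exact mul_ne_zero (pow_ne_zero _ ιF_ne) hA0) (by rw [hvJ, c.hvF]; exact hJ2)
  rw [hev, c.V.map_mul (pow_ne_zero _ ιF_ne) hA0, c.V.map_pow _ ιF_ne, hvJ, c.hvF] at this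
  rw [ev_map]
  have hω := omega_le c
  have hi : (0 : ℤ) ≤ Θ.natDegree := by positivity
  push_cast at this
  nlinarith

lemma bound2 [IsAlgClosed k] (hm1 : c.m = 1) (x' : MvPolynomial (Fin 2) k) (a : k[X]) (L j : ℕ)
    (s : K) (hs : c.ι c.F ^ (L + j) * c.ι x' = c.ι c.F ^ L * s + Polynomial.aeval (c.ι c.F) a)
    (hbij : Function.Bijective (ev (k := k) x' c.F))
    (hs0 : c.V.Ge 0 s)
    (hc : ∀ r : k, s - algebraMap k K r ≠ 0 ∧ c.V.v (s - algebraMap k K r) ≤ 0)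
    (Θ : k[X][X]) (hΘ : Θ ≠ 0) : c.V.v (c.ι (ev c.F x' Θ)) ≤ Θ.leadingCoeff.natTrailingDegree - j * Θ.natDegree := by
  have hbij' := bij_swap hbij
  obtain ⟨Ψ, h1, h2, h3⟩ := HS (K := K) Θ (Polynomial.X ^ L) a (L + j)
  have h4 := h1 s (c.ι c.F) (c.ι x') (by simpa using hs)
  have hA0 : ev (c.ι c.F) (c.ι x') Θ ≠ 0 := by
    rw [← ev_map]
    intro h
    have := c.ι_inj (h.trans (map_zero _).symm)
    exact hΘ (hbij'.1 (this.trans (map_zero _).symm))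
  have hev : ev s (c.ι c.F) (swp Ψ) = c.ι c.F ^ ((L + j) * Θ.natDegree) * ev (c.ι c.F) (c.ι x') Θ := by
    rw [ev_swp, h4]
  have hlead : Θ.leadingCoeff ≠ 0 := by simpa using hΘ
  have hco : (swp Ψ).coeff (Θ.leadingCoeff.natTrailingDegree + L * Θ.natDegree) ≠ 0 := by
    intro h
    have h5 := coeff_swp Ψ Θ.natDegree (Θ.leadingCoeff.natTrailingDegree + L * Θ.natDegree)
    rw [h, h2, ← pow_mul, Polynomial.coeff_mul_X_pow] at h5
    exact Polynomial.trailingCoeff_nonzero_iff_nonzero.2 hlead h5.symm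
  have hv : c.V.v (c.ι c.F) = 1 := by rw [c.hvF, hm1]; rfl
  have := Gauss c.V s (c.ι c.F) hs0 hc ιF_ne hv (swp Ψ) _ hco
  rw [hev, c.V.map_mul (pow_ne_zero _ ιF_ne) hA0, c.V.map_pow _ ιF_ne, hv] at this
  rw [ev_map]
  push_cast at this
  linarith

end Core
end Yosh

open MvPolynomial
namespace Yosh
open scoped Polynomial

lemma finrank_E (k : Type) [Field k] (N : ℕ) :
    2 * Module.finrank k (restrictTotalDegree (Fin 2) k N) = (N + 1) * (N + 2) := by
  rw [restrictTotalDegree, Module.finrank_eq_nat_card_basis (basisRestrictSupport k _)]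
  have e : {n : Fin 2 →₀ ℕ | (n.sum fun _ e => e) ≤ N} ≃ (Finset.range (N+1)).sigma (fun i => Finset.range (N + 1 - i)) :=
    { toFun := fun n => ⟨⟨n.1 0, n.1 1⟩, by
        have := n.2
        simp only [Set.mem_ofPred_eq] at this
        rw [Finsupp.sum_fintype _ _ (by simp)] at this
        simp at this
        simp; omega⟩
      invFun := fun p => ⟨Finsupp.equivFunOnFinite.symm ![p.1.1, p.1.2], by
        have := Finset.mem_sigma.1 p.2
        simp only [Finset.mem_range] at this
        simp only [Set.mem_ofPred_eq]
        rw [Finsupp.sum_fintype _ _ (by simp)]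
        simp; omega⟩
      left_inv := by
        intro n
        ext i
        fin_cases i <;> simp
      right_inv := by
        intro p
        simp }
  rw [Nat.card_congr e, Nat.card_eq_fintype_card, Fintype.card_coe, Finset.card_sigma]
  simp only [Finset.card_range]
  rw [← Finset.sum_range_reflect, mul_comm, Finset.sum_congr rfl (g := fun i => i + 1)]
  · rw [Finset.sum_add_distrib, add_mul, Finset.sum_range_id_mul_two]
    simp; ring
  · intro i hi
    have := Finset.mem_range.1 hi
    omega

lemma lead_sum {k σ : Type} [Field k] (S : Finset σ) (Θ : σ → k[X][X]) (i o : σ → ℕ) (κ : σ → k)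
    (hκ : ∀ s ∈ S, κ s ≠ 0)
    (hΘ : ∀ s ∈ S, (Θ s).natDegree = i s ∧ (Θ s).leadingCoeff = Polynomial.C (κ s) * Polynomial.X ^ (o s))
    (hinj : ∀ s ∈ S, ∀ s' ∈ S, i s = i s' → o s = o s' → s = s') (a : σ → k) (ha : ∃ s ∈ S, a s ≠ 0) :
    (∑ s ∈ S, a s • Θ s) ≠ 0 ∧ ∃ s ∈ S, (∑ s ∈ S, a s • Θ s).natDegree = i s ∧
      (∑ s ∈ S, a s • Θ s).leadingCoeff.natTrailingDegree = o s := by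
  classical
  obtain ⟨s1, hs1, h1⟩ := Finset.exists_max_image (S.filter fun s => a s ≠ 0) i (by
    obtain ⟨s, hs, h⟩ := ha; exact ⟨s, by simp [hs, h]⟩)
  obtain ⟨s0, hs0, h0⟩ := Finset.exists_min_image (S.filter fun s => a s ≠ 0 ∧ i s = i s1) o
    ⟨s1, by simp at hs1 ⊢; exact hs1⟩
  simp only [Finset.mem_filter] at hs0 hs1 h0 h1
  obtain ⟨hs0S, ha0, hi0⟩ := hs0
  have hco : ∀ s ∈ S, (Θ s).coeff (i s) = Polynomial.C (κ s) * Polynomial.X ^ (o s) := by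
    intro s hs; rw [← (hΘ s hs).2, ← (hΘ s hs).1, Polynomial.leadingCoeff]
  have hhi : ∀ N, i s0 < N → (∑ s ∈ S, a s • Θ s).coeff N = 0 := by
    intro N hN
    rw [Polynomial.finsetSum_coeff]
    refine Finset.sum_eq_zero fun s hs => ?_
    by_cases has : a s = 0
    · simp [has]
    · rw [Polynomial.coeff_smul, Polynomial.coeff_eq_zero_of_natDegree_lt, smul_zero]
      rw [(hΘ s hs).1]
      have := h1 s ⟨hs, has⟩
      omega
  have hlow : ∀ n, n ≤ o s0 → ((∑ s ∈ S, a s • Θ s).coeff (i s0)).coeff n = if n = o s0 then a s0 * κ s0 else 0 := by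
    intro n hn
    rw [Polynomial.finsetSum_coeff, Polynomial.finsetSum_coeff, Finset.sum_eq_single s0]
    · rw [Polynomial.coeff_smul, hco s0 hs0S, Polynomial.coeff_smul, Polynomial.coeff_C_mul_X_pow, smul_eq_mul]
      split_ifs <;> simp
    · intro s hs hne
      by_cases has : a s = 0
      · simp [has]
      · rw [Polynomial.coeff_smul, Polynomial.coeff_smul]
        have h2 := h1 s ⟨hs, has⟩
        rcases h2.lt_or_eq with hlt | heq
        · rw [Polynomial.coeff_eq_zero_of_natDegree_lt (p := Θ s) (by rw [(hΘ s hs).1]; omega)]; simp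
        · have h3 := h0 s ⟨hs, has, heq⟩
          have h4 : o s ≠ o s0 := fun h => hne (hinj s hs s0 hs0S (by omega) h)
          have : i s0 = i s := by omega
          rw [this, hco s hs, Polynomial.coeff_C_mul_X_pow, if_neg (by omega), smul_zero]
    · intro h; exact absurd hs0S h
  have hne : ((∑ s ∈ S, a s • Θ s).coeff (i s0)).coeff (o s0) ≠ 0 := by
    rw [hlow _ le_rfl, if_pos rfl]; exact mul_ne_zero ha0 (hκ s0 hs0S)
  have hne1 : (∑ s ∈ S, a s • Θ s).coeff (i s0) ≠ 0 := by
    intro h; rw [h] at hne; simp at hne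
  have hnat : (∑ s ∈ S, a s • Θ s).natDegree = i s0 :=
    le_antisymm (Polynomial.natDegree_le_iff_coeff_eq_zero.2 fun N hN => hhi N hN)
      (Polynomial.le_natDegree_of_ne_zero hne1)
  refine ⟨?_, s0, hs0S, hnat, ?_⟩
  · intro h; rw [h] at hne1; simp at hne1
  · rw [Polynomial.leadingCoeff, hnat]
    refine le_antisymm (Polynomial.natTrailingDegree_le_of_ne_zero hne) ?_
    refine Polynomial.le_natTrailingDegree hne1 fun n hn => ?_
    rw [hlow n hn.le, if_neg hn.ne]

/-- The set of exponents used in the counting argument. -/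
def cset (d D b n c : ℕ) : Finset ((_ : ℕ) × (ℕ × ℕ)) :=
  (Finset.Ioc b n).sigma (fun j => Finset.range (d * j + 1 - d * D) ×ˢ Finset.range d) ∪
  (Finset.Ioc c b).sigma (fun _ => Finset.Ico c b ×ˢ {0})

lemma cset_card (d D c M : ℕ) (hM : 1 ≤ M) (hc : c = M * (3 * d + 2 * d ^ 2 * D) + 1) :
    (2 * c * M * d + 1 : ℤ) * (2 * c * M * d + 2) <
      (2 * c * d + 1) * (2 * c * d + 2) + 2 * (cset d D (2 * c) (2 * c * M) c).card := by
  have hdisj : Disjoint ((Finset.Ioc (2*c) (2*c*M)).sigma (fun j => Finset.range (d * j + 1 - d * D) ×ˢ Finset.range d))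
    ((Finset.Ioc c (2*c)).sigma (fun _ => Finset.Ico c (2*c) ×ˢ ({0} : Finset ℕ))) := by
    rw [Finset.disjoint_left]
    rintro ⟨j, l, r⟩ h1 h2
    simp at h1 h2
    omega
  rw [cset, Finset.card_union_of_disjoint hdisj, Finset.card_sigma, Finset.card_sigma]
  simp only [Finset.card_product, Finset.card_range, Finset.card_singleton, Nat.card_Ico, Finset.sum_const, Nat.card_Ioc, mul_one, smul_eq_mul]
  have h2 : 2 * c - c = c := by omega
  rw [h2]
  have key : ∀ n, 2 * c ≤ n → (d ^ 2 * (n ^ 2 - (2 * c) ^ 2) : ℤ) + (n - 2 * c) * (d^2 + 2 * d - 2 * d ^ 2 * D) ≤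
      2 * ((∑ j ∈ Finset.Ioc (2*c) n, (d * j + 1 - d * D) * d : ℕ) : ℤ) := by
    intro n hn
    induction n, hn using Nat.le_induction with
    | base => simp
    | succ n hn ih =>
      rw [← Finset.insert_Ioc_right_eq_Ioc_add_one (by omega), Finset.sum_insert (by simp)]
      have : (d * ((n:ℤ) + 1) + 1 - d * D) ≤ ((d * (n + 1) + 1 - d * D : ℕ) : ℤ) := by
        have := (by omega : ∀ a b : ℕ, (a : ℤ) + 1 - b ≤ ((a + 1 - b : ℕ) : ℤ)) (d * (n + 1)) (d * D)
        rw [Nat.cast_mul, Nat.cast_mul] at this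
        push_cast at this
        exact this
      have hd : (0 : ℤ) ≤ d := by positivity
      have h3 := mul_le_mul_of_nonneg_right this hd
      push_cast at ih ⊢
      nlinarith
  have h3 := key (2 * c * M) (by nlinarith)
  push_cast at h3 ⊢
  have hc' : (c : ℤ) = M * (3 * d + 2 * d ^ 2 * D) + 1 := by exact_mod_cast hc
  have hc0 : (1 : ℤ) ≤ c := by rw [hc']; have : (0:ℤ) ≤ M * (3 * d + 2 * d ^ 2 * D) := by positivity
                               linarith
  have hM' : (1 : ℤ) ≤ M := by exact_mod_cast hM
  have h5 : (c : ℤ) * (M * (3 * d + 2 * d ^ 2 * D)) < c * c := by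
    apply mul_lt_mul_of_pos_left <;> linarith
  have h6 : (0 : ℤ) ≤ c * (3 * d + 2 * d ^ 2 * D) := by positivity
  have h7 : (0 : ℤ) ≤ c * (M - 1) * (d ^ 2 + 2 * d) := by
    apply mul_nonneg (mul_nonneg _ _) <;> first | positivity | linarith
  nlinarith

end Yosh

open MvPolynomial
namespace Yosh
open scoped Polynomial

lemma ev_X_zero {k : Type} [Field k] (A : k[X][X]) : ev (k := k) (Polynomial.X : k[X]) 0 A = A.coeff 0 := by
  have : (ev (k := k) (Polynomial.X : k[X]) 0) = Polynomial.constantCoeff := by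
    apply ev_hom_ext
    · intro r; rw [ev_CC]; simp [Polynomial.algebraMap_eq]
    · rw [ev_CX]; simp
    · rw [ev_X]; simp
  rw [this]; rfl

lemma ev_const {k : Type} [Field k] (p : k[X]) (r : k) (A : k[X][X]) :
    ev (k := k) p (Polynomial.C r) A = (A.eval (Polynomial.C r)).comp p := by
  have : (ev (k := k) p (Polynomial.C r)) = (Polynomial.compRingHom p).comp (Polynomial.evalRingHom (Polynomial.C r)) := by
    apply ev_hom_ext
    · intro r; rw [ev_CC]; simp [Polynomial.algebraMap_eq]
    · rw [ev_CX]; simp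
    · rw [ev_X]; simp
  rw [this]; rfl

namespace Core
variable {k K : Type} [Field k] [Field K] [Algebra k K] {c : Core k K}

lemma Qdeg {P Q} (st : c.Start P Q) (x' : MvPolynomial (Fin 2) k) (hbij : Function.Bijective (ev (k := k) x' c.F)) :
    ∃ (Θ : k[X][X]) (κ : k), ev c.F x' Θ = Q ∧ κ ≠ 0 ∧ Θ.natDegree = c.d ∧ Θ.leadingCoeff = Polynomial.C κ := by
  have hbij' := bij_swap hbij
  obtain ⟨i, j, a, hij, hP, hQ⟩ := st.lin
  obtain ⟨Φ, hΦF, hW, hW0⟩ := st.hΦ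
  obtain ⟨Θ, hΘ⟩ := hbij'.2 Q
  set ρ : MvPolynomial (Fin 2) k →ₐ[k] k[X] := aeval (fun l => if l = i then Polynomial.X else 0) with hρ
  have hρP : ρ P = Polynomial.X := by
    rw [hP, hρ]; simp [hij.symm]
  have hρQ : ρ Q = 0 := by
    rw [hQ, hρ]; simp [hij.symm]
  have hρev : ∀ A, ρ (ev P Q A) = A.coeff 0 := by
    intro A
    rw [ev_map, hρP, hρQ, ev_X_zero]
  have hker : ∀ A, ρ A = 0 ↔ Q ∣ A := by
    intro A
    obtain ⟨A, rfl⟩ := st.bij.2 A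
    rw [hρev]
    constructor
    · intro h
      obtain ⟨B, rfl⟩ := Polynomial.X_dvd_iff.2 h
      rw [_root_.map_mul, ev_X]; exact dvd_mul_right _ _
    · rintro ⟨B, hB⟩
      rw [← hρev, hB, _root_.map_mul, hρQ, zero_mul]
  have hsurj : Function.Surjective (ev (k := k) (ρ c.F) (ρ x')) := by
    intro r
    obtain ⟨A, hA⟩ := hbij'.2 (ev P Q (Polynomial.C r))
    exact ⟨A, by rw [← ev_map, hA, hρev]; simp⟩
  have hd := c.hd
  have hp : (ρ c.F).natDegree = c.d := by
    rw [← hΦF, hρev]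
    apply le_antisymm
    · rw [Polynomial.natDegree_le_iff_coeff_eq_zero]
      intro N hN
      by_contra h
      have := hW N 0 h
      have hα := st.hα
      have h1 : ((c.ε P).natDegree * c.d : ℤ) < (c.ε P).natDegree * N := by
        have : (c.d : ℤ) < N := by exact_mod_cast hN
        have : (0 : ℤ) < (c.ε P).natDegree := by exact_mod_cast hα
        nlinarith
      push_cast at this
      linarith
    · exact Polynomial.le_natDegree_of_ne_zero hW0
  have hq : 0 < (ρ x').natDegree := by
    by_contra h0
    have h0 : (ρ x').natDegree = 0 := by omega
    obtain ⟨r, hr⟩ := Polynomial.natDegree_eq_zero.1 h0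
    obtain ⟨A, hA⟩ := hsurj Polynomial.X
    rw [← hr, ev_const] at hA
    have h1 := congrArg Polynomial.natDegree hA
    rw [Polynomial.natDegree_comp, hp, Polynomial.natDegree_X] at h1
    have := Nat.eq_one_of_mul_eq_one_left h1
    omega
  have hN := Nlem (ρ c.F) (ρ x') (by omega) hq hsurj Θ (by
    intro A
    rw [← ev_map, hker]
    constructor
    · rintro ⟨D, hD⟩
      obtain ⟨D', rfl⟩ := hbij'.2 D
      refine ⟨D', hbij'.1 ?_⟩
      rw [hD, _root_.map_mul, hΘ]
    · rintro ⟨D, rfl⟩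
      rw [_root_.map_mul, hΘ]; exact dvd_mul_right _ _)
  obtain ⟨h1, h2, -⟩ := hN
  rw [hp] at h1 h2
  have hβ : (0 : ℤ) < (ρ x').natDegree := by exact_mod_cast hq
  have hd' : (3 : ℤ) ≤ c.d := by exact_mod_cast hd
  have hnd : Θ.natDegree = c.d := by
    apply le_antisymm
    · rw [Polynomial.natDegree_le_iff_coeff_eq_zero]
      intro N hN
      ext i
      rw [Polynomial.coeff_zero]
      by_contra h
      have := h1 i N h
      have hN : (c.d : ℤ) < N := by exact_mod_cast hN
      push_cast at this
      nlinarith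
    · apply Polynomial.le_natDegree_of_ne_zero
      intro h; rw [h] at h2; simp at h2
  refine ⟨Θ, (Θ.coeff c.d).coeff 0, hΘ, h2, hnd, ?_⟩
  rw [Polynomial.leadingCoeff, hnd]
  apply Polynomial.eq_C_of_natDegree_eq_zero
  rw [Polynomial.natDegree_eq_zero_iff_degree_le_zero, Polynomial.degree_le_iff_coeff_zero]
  intro n hn
  by_contra h
  have := h1 n c.d h
  have hn : (0 : ℤ) < n := by exact_mod_cast hn
  push_cast at this
  nlinarith

end Core
end Yosh

open MvPolynomial
namespace Yosh
open scoped Polynomial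

namespace Core
variable {k K : Type} [Field k] [Field K] [Algebra k K] {c : Core k K}

set_option maxHeartbeats 2000000 in
lemma counting {P Q} (st : c.Start P Q) (x' : MvPolynomial (Fin 2) k) (hbij : Function.Bijective (ev (k := k) x' c.F))
    (ψ : ℕ) (hψ : 2 ≤ c.m ∨ 1 ≤ ψ)
    (hb : ∀ Θ : k[X][X], Θ ≠ 0 → c.V.v (c.ι (ev c.F x' Θ)) ≤ c.m * Θ.leadingCoeff.natTrailingDegree - ψ * Θ.natDegree)
    (M : ℕ) (hM : 1 ≤ M)
    (hW : ∀ b : ℕ, ∃ W : Submodule k (MvPolynomial (Fin 2) k), 2 * Module.finrank k W = (b * c.d + 1) * (b * c.d + 2) ∧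
      ∀ A ∈ W, A.totalDegree ≤ b * M * c.d ∧ c.V.Ge (-b + c.m * (b * M)) (c.ι A)) : False := by
  classical
  obtain ⟨Θ, κ, hΘ, hκ, hnd, hlc⟩ := Qdeg st x' hbij
  have hd := c.hd
  have hm := c.hm
  set D := x'.totalDegree with hD
  obtain ⟨c0, hc0⟩ : ∃ c0, c0 = M * (3 * c.d + 2 * c.d ^ 2 * D) + 1 := ⟨_, rfl⟩
  have hcard := cset_card c.d D c0 M hM hc0
  set n := 2 * c0 * M with hn
  have hbn : 2 * c0 ≤ n := by rw [hn]; nlinarith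
  set S := cset c.d D (2 * c0) n c0 with hS
  have hmem : ∀ s ∈ S, s.1 ≤ n ∧ s.2.2 < c.d ∧ s.2.1 + s.2.2 * D + (n - s.1) * c.d ≤ n * c.d ∧
      (2 * c0 : ℤ) < c.m * s.1 + ψ * (c.d * s.2.1 + s.2.2) := by
    rintro ⟨j, l, r⟩ hs
    rw [hS, cset] at hs
    simp only [Finset.mem_union, Finset.mem_sigma, Finset.mem_Ioc, Finset.mem_product, Finset.mem_range, Finset.mem_Ico,
      Finset.mem_singleton] at hs
    dsimp only
    rcases hs with ⟨⟨h1, h2⟩, h3, h4⟩ | ⟨⟨h1, h2⟩, ⟨h3, h5⟩, h4⟩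
    · refine ⟨h2, h4, ?_, ?_⟩
      · obtain ⟨t, ht⟩ := Nat.exists_eq_add_of_le h2
        rw [ht, Nat.add_sub_cancel_left, add_mul]
        have : r * D ≤ c.d * D := Nat.mul_le_mul_right _ h4.le
        have : c.d * j = j * c.d := mul_comm _ _
        omega
      · have h1' : (2 * c0 : ℤ) < j := by exact_mod_cast h1
        have hm' : (1 : ℤ) ≤ c.m := by exact_mod_cast hm
        have : (0 : ℤ) ≤ ψ * (c.d * l + r) := by positivity
        nlinarith
    · subst h4
      refine ⟨h2.trans hbn, by omega, ?_, ?_⟩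
      · obtain ⟨t, ht⟩ := Nat.exists_eq_add_of_le (h2.trans hbn)
        rw [ht, Nat.add_sub_cancel_left, add_mul]
        nlinarith
      · have h1' : (c0 : ℤ) < j := by exact_mod_cast h1
        have h3' : (c0 : ℤ) ≤ l := by exact_mod_cast h3
        have hm' : (1 : ℤ) ≤ c.m := by exact_mod_cast hm
        have hd' : (3 : ℤ) ≤ c.d := by exact_mod_cast hd
        rcases hψ with h | h
        · have h : (2 : ℤ) ≤ c.m := by exact_mod_cast h
          have : (0 : ℤ) ≤ ψ * (c.d * l + (0 : ℕ)) := by positivity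
          nlinarith
        · have h : (1 : ℤ) ≤ ψ := by exact_mod_cast h
          have h6 : (l : ℤ) ≤ c.d * l := by nlinarith
          have h7 : (l : ℤ) ≤ ψ * (c.d * l) := by nlinarith
          have h8 : (j : ℤ) ≤ c.m * j := by nlinarith
          push_cast
          linarith
  set Th : ((_ : ℕ) × (ℕ × ℕ)) → k[X][X] := fun s => Θ ^ s.2.1 * Polynomial.X ^ s.2.2 * Polynomial.C (Polynomial.X ^ (n - s.1)) with hTh
  have hΘ0 : Θ ≠ 0 := by rintro rfl; rw [Polynomial.leadingCoeff_zero] at hlc; exact hκ (Polynomial.C_eq_zero.1 hlc.symm)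
  have hXC : ∀ a : ℕ, (Polynomial.C (Polynomial.X ^ a) : k[X][X]) ≠ 0 := by
    intro a; simp
  have hlead : ∀ s ∈ S, (Th s).natDegree = c.d * s.2.1 + s.2.2 ∧ (Th s).leadingCoeff =
      Polynomial.C (κ ^ s.2.1) * Polynomial.X ^ (n - s.1) := by
    intro s _
    constructor
    · rw [hTh]; dsimp only
      rw [Polynomial.natDegree_mul (mul_ne_zero (pow_ne_zero _ hΘ0) (pow_ne_zero _ Polynomial.X_ne_zero)) (hXC _),
        Polynomial.natDegree_mul (pow_ne_zero _ hΘ0) (pow_ne_zero _ Polynomial.X_ne_zero), Polynomial.natDegree_pow, hnd,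
        Polynomial.natDegree_C, Polynomial.natDegree_X_pow]; ring
    · rw [hTh]; dsimp only
      rw [Polynomial.leadingCoeff_mul, Polynomial.leadingCoeff_mul, Polynomial.leadingCoeff_pow, hlc, Polynomial.leadingCoeff_C,
        Polynomial.leadingCoeff_X_pow, mul_one, Polynomial.C_pow]
  have hinj : ∀ s ∈ S, ∀ s' ∈ S, c.d * s.2.1 + s.2.2 = c.d * s'.2.1 + s'.2.2 → n - s.1 = n - s'.1 → s = s' := by
    rintro ⟨j, l, r⟩ hs ⟨j', l', r'⟩ hs' h1 h2
    have h3 := hmem _ hs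
    have h4 := hmem _ hs'
    dsimp only at h1 h2 h3 h4
    have e1 : j = j' := by omega
    have e2 : r = r' := by
      have := congrArg (· % c.d) h1
      simpa [Nat.mul_add_mod, Nat.mod_eq_of_lt h3.2.1, Nat.mod_eq_of_lt h4.2.1] using this
    subst e1 e2
    have e3 : l = l' := by
      have : c.d * l = c.d * l' := by omega
      exact Nat.eq_of_mul_eq_mul_left (by omega) this
    subst e3
    rfl
  obtain ⟨W, hWr, hW⟩ := hW (2 * c0)
  have hQd : Q.totalDegree ≤ 1 := by
    obtain ⟨i, j, a, hij, hP, hQ⟩ := st.lin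
    rw [hQ, totalDegree_X]
  have hdeg : ∀ s ∈ S, (ev c.F x' (Th s)).totalDegree ≤ n * c.d := by
    intro s hs
    refine le_trans ?_ (hmem s hs).2.2.1
    rw [hTh]; dsimp only
    rw [_root_.map_mul, _root_.map_mul, _root_.map_pow, _root_.map_pow, hΘ, ev_X, ev_C]
    simp only [_root_.map_pow, Polynomial.aeval_X]
    refine (totalDegree_mul _ _).trans (add_le_add ((totalDegree_mul _ _).trans (add_le_add ?_ ?_)) ?_)
    · exact (totalDegree_pow _ _).trans (by nlinarith)
    · exact totalDegree_pow _ _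
    · exact (totalDegree_pow _ _).trans (by rw [c.hdeg])
  let φ : ((S → k) × W) →ₗ[k] restrictTotalDegree (Fin 2) k (n * c.d) :=
    LinearMap.codRestrict _ ((Fintype.linearCombination k (fun s : S => ev c.F x' (Th s))).coprod (-W.subtype)) (by
      rintro ⟨a, w⟩
      rw [LinearMap.coprod_apply]
      refine Submodule.add_mem _ ?_ ?_
      · rw [Fintype.linearCombination_apply]
        refine Submodule.sum_mem _ fun s _ => Submodule.smul_mem _ _ ?_
        rw [mem_restrictTotalDegree]; exact hdeg s s.2
      · rw [LinearMap.neg_apply]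
        refine Submodule.neg_mem _ ?_
        rw [mem_restrictTotalDegree]; exact (hW _ w.2).1)
  have hφ : Function.Injective φ := by
    rw [← LinearMap.ker_eq_bot, LinearMap.ker_eq_bot']
    rintro ⟨a, w⟩ h
    have h : (∑ s : S, a s • ev c.F x' (Th s)) + -(w : MvPolynomial (Fin 2) k) = 0 := by
      have := congrArg Subtype.val h
      simpa [φ, Fintype.linearCombination_apply] using this
    have h : (∑ s : S, a s • ev c.F x' (Th s)) = (w : MvPolynomial (Fin 2) k) := by
      rw [← sub_eq_add_neg, sub_eq_zero] at h; exact h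
    have ha : a = 0 := by
      by_contra ha
      obtain ⟨s0, hs0⟩ := Function.ne_iff.1 ha
      set a' : ((_ : ℕ) × (ℕ × ℕ)) → k := fun s => if hs : s ∈ S then a ⟨s, hs⟩ else 0 with ha'
      have hsum : ∑ s ∈ S, a' s • ev c.F x' (Th s) = (w : MvPolynomial (Fin 2) k) := by
        rw [← h, ← Finset.sum_coe_sort]
        refine Finset.sum_congr rfl fun s _ => ?_
        rw [ha']; simp
      obtain ⟨h1, s, hs, h2, h3⟩ := lead_sum S Th (fun s => c.d * s.2.1 + s.2.2) (fun s => n - s.1) (fun s => κ ^ s.2.1)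
        (fun _ _ => pow_ne_zero _ hκ) hlead hinj a' ⟨s0, s0.2, by rw [ha']; simpa using hs0⟩
      have h4 := hb _ h1
      rw [h2, h3] at h4
      have h5 : ev c.F x' (∑ s ∈ S, a' s • Th s) = (w : MvPolynomial (Fin 2) k) := by
        rw [← hsum, _root_.map_sum]
        exact Finset.sum_congr rfl fun s _ => ev_smul _ _ _ _
      have h6 : (w : MvPolynomial (Fin 2) k) ≠ 0 := by
        rw [← h5]; intro h; exact h1 ((bij_swap hbij).1 (by rw [h, map_zero]))
      have h7 := (hW _ w.2).2 (by intro h; exact h6 (c.ι_inj (by rw [h, map_zero])))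
      rw [h5] at h4
      obtain ⟨g1, -, -, g4⟩ := hmem s hs
      have e : ((n - s.1 : ℕ) : ℤ) = n - s.1 := by omega
      rw [e] at h4
      have e2 : (n : ℤ) = 2 * c0 * M := by rw [hn]; push_cast; ring
      push_cast at h4 h7
      rw [← e2] at h7
      linarith
    subst ha
    have : w = 0 := by
      apply Subtype.ext; rw [← h]; simp
    rw [this]; rfl
  have hfr := LinearMap.finrank_le_finrank_of_injective hφ
  have hWfin : Module.Finite k W := Module.finite_of_finrank_pos (by
    have : 0 < (2 * c0 * c.d + 1) * (2 * c0 * c.d + 2) := by positivity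
    omega)
  rw [Module.finrank_prod, Module.finrank_fintype_fun_eq_card, Fintype.card_coe] at hfr
  have hE := finrank_E k (n * c.d)
  have hfin : 2 * S.card + (2 * c0 * c.d + 1) * (2 * c0 * c.d + 2) ≤ (n * c.d + 1) * (n * c.d + 2) := by
    rw [← hE, ← hWr]; omega
  have hfin' : (2 * S.card + (2 * c0 * c.d + 1) * (2 * c0 * c.d + 2) : ℤ) ≤ (n * c.d + 1) * (n * c.d + 2) := by exact_mod_cast hfin
  have e2 : (n : ℤ) = 2 * c0 * M := by rw [hn]; push_cast; ring
  rw [e2] at hfin'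
  linarith

end Core
end Yosh

open MvPolynomial
namespace Yosh
open scoped Polynomial

lemma Jac_aeval_self {k K : Type} [Field k] [Field K] [Algebra k K] (D0 D1 : Derivation k K K) (t : K) (a : k[X]) :
    Jac D0 D1 (Polynomial.aeval t a) t = 0 := by
  simp only [Jac, Derivation.map_aeval, smul_eq_mul]; ring

namespace Core
variable {k K : Type} [Field k] [Field K] [Algebra k K] {c : Core k K}

lemma le_of_jac (hm1 : c.m = 1) (x' : MvPolynomial (Fin 2) k)
    (hj : ∃ j : k, j ≠ 0 ∧ Jac c.D0 c.D1 (c.ι x') (c.ι c.F) = algebraMap k K j) (a : k[X]) (L : ℕ) :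
    c.ι x' - Polynomial.aeval (c.ι c.F) a / c.ι c.F ^ L ≠ 0 ∧
      c.V.v (c.ι x' - Polynomial.aeval (c.ι c.F) a / c.ι c.F ^ L) ≤ 0 := by
  obtain ⟨j, hj0, hj⟩ := hj
  have hF : c.ι c.F ≠ 0 := ιF_ne
  set z := c.ι x' - Polynomial.aeval (c.ι c.F) a / c.ι c.F ^ L with hz
  have h1 : c.ι c.F ^ L * z = c.ι c.F ^ L * c.ι x' - Polynomial.aeval (c.ι c.F) a := by
    rw [hz]; field_simp
  have hp : Jac c.D0 c.D1 (c.ι c.F ^ L) (c.ι c.F) = 0 := by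
    have := Jac_aeval_self c.D0 c.D1 (c.ι c.F) (Polynomial.X ^ L)
    simpa using this
  have h2 : Jac c.D0 c.D1 z (c.ι c.F) = algebraMap k K j := by
    have h3 := congrArg (fun u => Jac c.D0 c.D1 u (c.ι c.F)) h1
    have h4 : Jac c.D0 c.D1 (c.ι c.F ^ L * c.ι x' - Polynomial.aeval (c.ι c.F) a) (c.ι c.F) =
      Jac c.D0 c.D1 (c.ι c.F ^ L * c.ι x') (c.ι c.F) - Jac c.D0 c.D1 (Polynomial.aeval (c.ι c.F) a) (c.ι c.F) := by
      simp only [Jac, _root_.map_sub]; ring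
    simp only [h4, Jac_mul_left, hp, Jac_aeval_self, mul_zero, add_zero, sub_zero, hj] at h3
    exact mul_left_cancel₀ (pow_ne_zero _ hF) h3
  have hj' : algebraMap k K j ≠ 0 := by simpa using hj0
  have hz0 : z ≠ 0 := by
    intro h; rw [h, Jac_zero_left] at h2; exact hj' h2.symm
  refine ⟨hz0, ?_⟩
  have h5 := c.hlog z (c.ι c.F) hz0 hF (by rw [h2]; exact hj')
  rw [h2, c.hvF, c.V.map_const' j hj0, hm1] at h5
  have := c.omega_le
  rw [hm1] at this
  push_cast at *
  linarith

lemma caseB [IsAlgClosed k] (hreg : ¬ ∀ A, c.V.Ge 0 (c.ι A))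
    (M : ℕ) (hM : 1 ≤ M)
    (hW : ∀ b : ℕ, ∃ W : Submodule k (MvPolynomial (Fin 2) k), 2 * Module.finrank k W = (b * c.d + 1) * (b * c.d + 2) ∧
      ∀ A ∈ W, A.totalDegree ≤ b * M * c.d ∧ c.V.Ge (-b + c.m * (b * M)) (c.ι A)) : c.Concl := by
  obtain ⟨P, Q, st⟩ := c.start
  obtain ⟨x', hbij, hj, herr⟩ := caseB_start st hreg
  have hF : c.ι c.F ≠ 0 := ιF_ne
  have hm1 : c.m = 1 := by
    by_contra hm1
    have hm := c.hm
    refine counting st x' hbij 0 (Or.inl (by omega)) (fun Θ hΘ => ?_) M hM hW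
    have := bound1 x' hbij hj Θ hΘ
    simpa using this
  have hvF : c.V.v (c.ι c.F) = 1 := by rw [c.hvF, hm1]; rfl
  set zz : k[X] × ℕ → K := fun p => c.ι x' - Polynomial.aeval (c.ι c.F) p.1 / c.ι c.F ^ p.2 with hzz
  have hz := fun p : k[X] × ℕ => le_of_jac hm1 x' hj p.1 p.2
  set ff : k[X] × ℕ → ℕ := fun p => (- c.V.v (zz p)).toNat with hff
  obtain ⟨⟨a, L⟩, hmin⟩ : ∃ p, ∀ q, ff p ≤ ff q := by
    obtain ⟨n, ⟨p, hp⟩, h2⟩ := WellFounded.has_min (wellFounded_lt (α := ℕ)) (Set.range ff) ⟨_, ⟨(0, 0), rfl⟩⟩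
    exact ⟨p, fun q => by have := h2 (ff q) ⟨q, rfl⟩; rw [hp]; omega⟩
  have hmax : ∀ q, c.V.v (zz q) ≤ c.V.v (zz (a, L)) := by
    intro q
    have h1 := hmin q
    have h2 := (hz q).2
    have h3 := (hz (a, L)).2
    simp only [hff] at h1
    change c.V.v (zz q) ≤ 0 at h2
    change c.V.v (zz (a, L)) ≤ 0 at h3
    omega
  obtain ⟨j, hjv⟩ : ∃ j : ℕ, c.V.v (zz (a, L)) = -j := by
    have h3 := (hz (a, L)).2
    change c.V.v (zz (a, L)) ≤ 0 at h3
    exact ⟨(-c.V.v (zz (a, L))).toNat, by omega⟩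
  have hz0 : zz (a, L) ≠ 0 := (hz (a, L)).1
  have hj0 : j = 0 := by
    by_contra hj0
    refine counting st x' hbij j (Or.inr (by omega)) (fun Θ hΘ => ?_) M hM hW
    rw [hm1]
    have := bound2 hm1 x' (a * Polynomial.X ^ j) L j (zz (a, L) * c.ι c.F ^ j) (by
      simp only [hzz, _root_.map_mul, _root_.map_pow, Polynomial.aeval_X]; field_simp; ring) hbij (by
      intro _
      rw [c.V.map_mul hz0 (pow_ne_zero _ hF), c.V.map_pow _ hF, hjv, hvF]; simp) (by
      intro r
      have e : zz (a, L) * c.ι c.F ^ j - algebraMap k K r = zz (a * Polynomial.X ^ j + Polynomial.C r * Polynomial.X ^ L, L + j) * c.ι c.F ^ j := by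
        simp only [hzz, _root_.map_mul, _root_.map_pow, Polynomial.aeval_X, _root_.map_add, Polynomial.aeval_C]; field_simp; ring
      have h0 : zz (a * Polynomial.X ^ j + Polynomial.C r * Polynomial.X ^ L, L + j) ≠ 0 := (hz (_, _)).1
      have h1 := hmax (a * Polynomial.X ^ j + Polynomial.C r * Polynomial.X ^ L, L + j)
      rw [e]
      refine ⟨mul_ne_zero h0 (pow_ne_zero _ hF), ?_⟩
      rw [c.V.map_mul h0 (pow_ne_zero _ hF), c.V.map_pow _ hF, hvF]
      linarith) Θ hΘ
    simpa using this
  subst hj0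
  refine ⟨hm1, ?_⟩
  set r := a %ₘ Polynomial.X ^ L with hr
  set cp := a /ₘ Polynomial.X ^ L with hcp
  have hmon : (Polynomial.X ^ L : k[X]).Monic := Polynomial.monic_X_pow L
  have hsplit : r + Polynomial.X ^ L * cp = a := Polynomial.modByMonic_add_div a _
  set y := Polynomial.aeval (c.ι c.F) r / c.ι c.F ^ L with hy
  have hyz : c.ι x' - y = zz (a, L) + Polynomial.aeval (c.ι c.F) cp := by
    simp only [hzz, hy, ← hsplit, _root_.map_mul, _root_.map_pow, Polynomial.aeval_X, _root_.map_add]; field_simp; ring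
  have hVF : c.V.Ge 0 (c.ι c.F) := fun _ => by rw [hvF]; norm_num
  have hVs : c.V.Ge 0 (c.ι x' - y) := by
    rw [hyz]
    refine ZVal.Ge.add (fun _ => by rw [hjv]; simp) (c.V.ge_aeval _ hVF _)
  have hVLF : c.VL.v (c.ι c.F) = -(c.d : ℤ) := by rw [c.VL_spec _ F_ne, c.hdeg]
  have hyL : c.VL.Ge c.d y := by
    rw [hy, Polynomial.aeval_eq_sum_range, Finset.sum_div]
    apply ZVal.Ge.sum
    intro n hn
    by_cases h0 : r.coeff n = 0
    · rw [h0, zero_smul, zero_div]; exact c.VL.ge_zero _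
    have hlt : n < L := by
      by_contra h
      apply h0
      apply Polynomial.coeff_eq_zero_of_degree_lt
      refine lt_of_lt_of_le (Polynomial.degree_modByMonic_lt a hmon) ?_
      rw [Polynomial.degree_X_pow]; exact_mod_cast (not_lt.1 h)
    rw [smul_div_assoc]
    apply ZVal.Ge.smul
    intro _
    rw [c.VL.map_div (pow_ne_zero _ hF) (pow_ne_zero _ hF), c.VL.map_pow _ hF, c.VL.map_pow _ hF, hVLF]
    have h1 : (n : ℤ) + 1 ≤ L := by exact_mod_cast hlt
    have hd : (0 : ℤ) ≤ c.d := by positivity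
    nlinarith
  let E : k[X][X] ≃+* MvPolynomial (Fin 2) k := RingEquiv.ofBijective (ev (k := k) x' c.F) hbij
  let τ : MvPolynomial (Fin 2) k →ₐ[k] K :=
    { toRingHom := (ev (k := k) (c.ι x' - y) (c.ι c.F)).comp E.symm.toRingHom
      commutes' := by
        intro s
        have : E.symm (algebraMap k (MvPolynomial (Fin 2) k) s) = Polynomial.C (Polynomial.C s) := by
          rw [RingEquiv.symm_apply_eq]
          change _ = ev (k := k) x' c.F (Polynomial.C (Polynomial.C s))
          rw [ev_CC]
        change ev (k := k) (c.ι x' - y) (c.ι c.F) (E.symm (algebraMap k (MvPolynomial (Fin 2) k) s)) = _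
        rw [this, ev_CC] }
  have hτ : ∀ A : k[X][X], τ (ev x' c.F A) = ev (c.ι x' - y) (c.ι c.F) A := by
    intro A
    change ev (k := k) (c.ι x' - y) (c.ι c.F) (E.symm (E A)) = _
    rw [RingEquiv.symm_apply_apply]
  have hτF : τ c.F = c.ι c.F := by
    have := hτ Polynomial.X
    rwa [ev_X, ev_X] at this
  have hτx : τ x' = c.ι x' - y := by
    have := hτ (Polynomial.C Polynomial.X)
    rwa [ev_CX, ev_CX] at this
  have hτinj : Function.Injective τ := by
    rw [injective_iff_map_eq_zero]
    intro A hA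
    obtain ⟨A, rfl⟩ := hbij.2 A
    rw [hτ, ← ev_swp] at hA
    set Θ := swp A with hΘ
    obtain ⟨Ψ, h1, h2, h3⟩ := HS (K := K) Θ (Polynomial.X ^ L) (-r) L
    have h4 := h1 (c.ι x') (c.ι c.F) (c.ι x' - y) (by
      rw [hy]; simp; field_simp; ring)
    rw [hA, mul_zero, ← ev_map] at h4
    have h5 : Ψ = 0 := (bij_swap hbij).1 (c.ι_inj (by rw [h4, map_zero, map_zero]))
    rw [h5, Polynomial.coeff_zero, eq_comm, mul_eq_zero] at h2
    rcases h2 with h2 | h2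
    · rw [Polynomial.leadingCoeff_eq_zero] at h2
      rw [← swp_swp A, ← hΘ, h2, map_zero, map_zero]
    · exact absurd h2 (pow_ne_zero _ hmon.ne_zero)
  have hVLge := herr τ hτF (by rw [hτx, sub_sub_cancel_left]; exact hyL.neg)
  rw [st.degP, st.degQ] at hVLge
  have hP : c.VL.Ge (-1) (τ P) := by
    have : τ P = (τ P - c.ι P) + c.ι P := by ring
    rw [this]
    exact (hVLge.1.mono (by norm_num)).add (fun _ => by rw [st.degP])
  have hQ : c.VL.Ge (-1) (τ Q) := by
    have : τ Q = (τ Q - c.ι Q) + c.ι Q := by ring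
    rw [this]
    exact (hVLge.2.mono (by norm_num)).add (fun _ => by rw [st.degQ])
  have hX : ∀ l, c.VL.Ge (-1) (τ (X l)) := by
    obtain ⟨i, j, b, hij, h1, h2⟩ := st.lin
    intro l
    have : l = i ∨ l = j := by
      have : ∀ l i j : Fin 2, i ≠ j → l = i ∨ l = j := by decide
      exact this l i j hij
    rcases this with rfl | rfl
    · have : (X l : MvPolynomial (Fin 2) k) = P + b • Q := by rw [h1, h2]; simp
      rw [this, _root_.map_add, _root_.map_smul]
      exact hP.add (hQ.smul b)
    · rw [← h2]; exact hQ
  refine ⟨τ, hτinj, hτF, ?_, hX 0, hX 1, ?_⟩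
  · intro A
    obtain ⟨A, rfl⟩ := hbij.2 A
    rw [hτ]; exact ge_ev _ _ _ hVs hVF _
  · intro w hw hwF A
    obtain ⟨A, rfl⟩ := hbij.2 A
    rw [hτ]
    refine ge_ev _ _ _ ((hw _).sub ?_) (hw _) _
    rw [hy, div_eq_mul_inv]
    refine ZVal.Ge.mul0 (w.ge_aeval _ (hw _) _) (fun _ => ?_)
    rw [w.map_inv _ (pow_ne_zero _ hF), w.map_pow _ hF, hwF]; simp

theorem main [IsAlgClosed k] (c : Core k K) (hfrac : ∀ a : K, ∃ A B, B ≠ 0 ∧ a = c.ι A / c.ι B)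
    (hone : ∃ a : K, a ≠ 0 ∧ c.V.v a = 1)
    (M : ℕ) (hM : 1 ≤ M)
    (hW : ∀ b : ℕ, ∃ W : Submodule k (MvPolynomial (Fin 2) k), 2 * Module.finrank k W = (b * c.d + 1) * (b * c.d + 2) ∧
      ∀ A ∈ W, A.totalDegree ≤ b * M * c.d ∧ c.V.Ge (-b + c.m * (b * M)) (c.ι A)) : c.Concl := by
  by_cases hreg : ∀ A, c.V.Ge 0 (c.ι A)
  · exact caseA c hfrac hone hreg
  · exact caseB hreg M hM hW

end Core
end Yosh

open MvPolynomial
namespace Yosh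
open scoped Polynomial

section
variable (k K : Type) [Field k] [Field K] [Algebra k K] [Algebra (MvPolynomial (Fin 2) k) K]
  [IsScalarTower k (MvPolynomial (Fin 2) k) K] 

/-- the embedding of the polynomial ring in its fraction field. -/
noncomputable abbrev jj : MvPolynomial (Fin 2) k →ₐ[k] K := IsScalarTower.toAlgHom k (MvPolynomial (Fin 2) k) K

variable [IsFractionRing (MvPolynomial (Fin 2) k) K]

lemma jj_inj : Function.Injective (jj k K) := IsFractionRing.injective (MvPolynomial (Fin 2) k) K

variable {k} in
lemma jj_ne {A : MvPolynomial (Fin 2) k} (hA : A ≠ 0) : jj k K A ≠ 0 := fun h => hA (jj_inj k K (by rw [h, map_zero]))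

variable {K}

lemma frac (a : K) : ∃ A B, B ≠ 0 ∧ a = jj k K A / jj k K B := by
  obtain ⟨A, B, hB, h⟩ := IsFractionRing.div_surjective (A := MvPolynomial (Fin 2) k) a
  exact ⟨A, B, nonZeroDivisors.ne_zero hB, h.symm⟩

variable {k}

lemma exists_val (μ : MvPolynomial (Fin 2) k → ℤ) (hmul : ∀ A B, A ≠ 0 → B ≠ 0 → μ (A * B) = μ A + μ B)
    (hadd : ∀ A B, A ≠ 0 → B ≠ 0 → A + B ≠ 0 → min (μ A) (μ B) ≤ μ (A + B)) (hc : ∀ c : k, c ≠ 0 → μ (C c) = 0) :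
    ∃ V : ZVal k K, ∀ A, A ≠ 0 → V.v (jj k K A) = μ A := by
  choose N D hD h using frac k (K := K)
  have hN : ∀ a, a ≠ 0 → N a ≠ 0 := by
    intro a ha h0
    apply ha; rw [h a, h0, map_zero, zero_div]
  have key : ∀ a, ∀ A B, A ≠ 0 → B ≠ 0 → a = jj k K A / jj k K B → μ (N a) - μ (D a) = μ A - μ B := by
    intro a A B hA hB e
    have ha : a ≠ 0 := by rw [e]; exact div_ne_zero (jj_ne K hA) (jj_ne K hB)
    have e1 : N a * B = A * D a := by
      apply jj_inj k K
      rw [_root_.map_mul, _root_.map_mul]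
      have := (h a).symm.trans e
      rwa [div_eq_div_iff (jj_ne K (hD a)) (jj_ne K hB)] at this
    have e2 := congrArg μ e1
    rw [hmul _ _ (hN a ha) hB, hmul _ _ hA (hD a)] at e2
    linarith
  refine ⟨⟨fun a => μ (N a) - μ (D a), ?_, ?_, ?_⟩, ?_⟩
  · intro a b ha hb
    rw [key (a * b) (N a * N b) (D a * D b) (mul_ne_zero (hN a ha) (hN b hb)) (mul_ne_zero (hD a) (hD b)), 
      hmul _ _ (hN a ha) (hN b hb), hmul _ _ (hD a) (hD b)]
    · ring
    · conv_lhs => rw [h a, h b]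
      rw [_root_.map_mul, _root_.map_mul, div_mul_div_comm]
  · intro a b ha hb hab
    have e : a + b = jj k K (N a * D b + D a * N b) / jj k K (D a * D b) := by
      conv_lhs => rw [h a, h b]
      rw [div_add_div _ _ (jj_ne K (hD a)) (jj_ne K (hD b))]
      simp only [_root_.map_mul, _root_.map_add]
    have h0 : N a * D b + D a * N b ≠ 0 := by
      intro h0; rw [h0, map_zero, zero_div] at e; exact hab e
    rw [key (a + b) _ _ h0 (mul_ne_zero (hD a) (hD b)) e, hmul _ _ (hD a) (hD b)]
    have := hadd _ _ (mul_ne_zero (hN a ha) (hD b)) (mul_ne_zero (hD a) (hN b hb)) h0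
    rw [hmul _ _ (hN a ha) (hD b), hmul _ _ (hD a) (hN b hb)] at this
    rcases min_le_iff.1 this with h | h
    · exact min_le_iff.2 (Or.inl (by linarith))
    · exact min_le_iff.2 (Or.inr (by linarith))
  · intro c hc0
    rw [key (algebraMap k K c) (C c) 1 (by simpa using hc0) one_ne_zero, hc c hc0, ← C_1, hc 1 one_ne_zero, sub_zero]
    rw [map_one, div_one]
    exact ((jj k K).commutes c).symm
  · intro A hA
    dsimp only
    rw [key _ A 1 hA one_ne_zero (by rw [map_one, div_one]), ← C_1, hc 1 one_ne_zero, sub_zero]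

variable (k K)

lemma exists_VL : ∃ V : ZVal k K, ∀ A, A ≠ 0 → V.v (jj k K A) = -(A.totalDegree : ℤ) := by
  apply exists_val
  · intro A B hA hB
    rw [totalDegree_mul_of_isDomain hA hB]; push_cast; ring
  · intro A B hA hB _
    have := totalDegree_add A B
    rcases le_max_iff.1 this with h | h
    · exact min_le_iff.2 (Or.inl (by omega))
    · exact min_le_iff.2 (Or.inr (by omega))
  · intro c _; simp

noncomputable def VL : ZVal k K := (exists_VL k K).choose
lemma VL_spec (A) (hA : A ≠ 0) : (VL k K).v (jj k K A) = -(A.totalDegree : ℤ) := (exists_VL k K).choose_spec A hA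

variable {k}

lemma exists_VP (P : MvPolynomial (Fin 2) k) (hP : Prime P) : ∃ V : ZVal k K, ∀ A, A ≠ 0 → V.v (jj k K A) = multiplicity P A := by
  have hfin : ∀ A, A ≠ 0 → FiniteMultiplicity P A := fun A hA => FiniteMultiplicity.of_not_isUnit hP.not_isUnit hA
  apply exists_val
  · intro A B hA hB
    rw [multiplicity_mul hP (hfin _ (mul_ne_zero hA hB))]; push_cast; ring
  · intro A B hA hB hAB
    have := min_le_emultiplicity_add (p := P) (a := A) (b := B)
    rw [(hfin A hA).emultiplicity_eq_multiplicity, (hfin B hB).emultiplicity_eq_multiplicity, (hfin _ hAB).emultiplicity_eq_multiplicity] at this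
    have this : min (multiplicity P A) (multiplicity P B) ≤ multiplicity P (A + B) := by
      rcases min_le_iff.1 this with h | h
      · exact min_le_iff.2 (Or.inl (by exact_mod_cast h))
      · exact min_le_iff.2 (Or.inr (by exact_mod_cast h))
    exact_mod_cast this
  · intro c hc
    have : multiplicity P (C c) = 0 := by
      apply multiplicity_eq_zero.2
      intro h
      exact hP.not_isUnit (isUnit_of_dvd_unit h ((isUnit_iff_ne_zero.2 hc).map C))
    rw [this]; rfl

noncomputable def VP (P : MvPolynomial (Fin 2) k) (hP : Prime P) : ZVal k K := (exists_VP K P hP).choose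

section
variable {P : MvPolynomial (Fin 2) k} (hP : Prime P)
lemma VP_spec (A) (hA : A ≠ 0) : (VP K P hP).v (jj k K A) = multiplicity P A := (exists_VP K P hP).choose_spec A hA

lemma VP_ge (A) : (VP K P hP).Ge 0 (jj k K A) := by
  intro h
  rw [VP_spec K hP A (by rintro rfl; simp at h)]; positivity

lemma VP_zero_of_not_dvd (A) (h : ¬ P ∣ A) : (VP K P hP).v (jj k K A) = 0 := by
  rw [VP_spec K hP A (by rintro rfl; simp at h), multiplicity_eq_zero.2 h]; rfl

lemma VP_self : (VP K P hP).v (jj k K P) = 1 := by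
  rw [VP_spec K hP P hP.ne_zero, multiplicity_self]; rfl

lemma VP_pos_of_dvd (A) (hA : A ≠ 0) (h : P ∣ A) : 1 ≤ (VP K P hP).v (jj k K A) := by
  rw [VP_spec K hP A hA]
  have : multiplicity P A ≠ 0 := by rw [Ne, multiplicity_eq_zero]; exact fun h' => h' h
  omega

lemma dvd_of_VP (A) (hA : A ≠ 0) (n : ℕ) (h : n ≤ (VP K P hP).v (jj k K A)) : P ^ n ∣ A := by
  rw [VP_spec K hP A hA] at h
  exact pow_dvd_of_le_multiplicity (by exact_mod_cast h)

lemma VP_assoc {P' : MvPolynomial (Fin 2) k} (hP' : Prime P') (h : Associated P P') (a : K) (ha : a ≠ 0) :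
    (VP K P hP).v a = (VP K P' hP').v a := by
  obtain ⟨A, B, hB, rfl⟩ := frac k a
  have hA : A ≠ 0 := by rintro rfl; simp at ha
  rw [ZVal.map_div _ (jj_ne K hA) (jj_ne K hB), ZVal.map_div _ (jj_ne K hA) (jj_ne K hB), VP_spec K hP A hA, VP_spec K hP B hB, VP_spec K hP' A hA, VP_spec K hP' B hB]
  have : ∀ A, multiplicity P A = multiplicity P' A := by
    intro A
    rw [multiplicity, multiplicity, emultiplicity_eq_of_associated_left h]
  rw [this, this]
end

variable {K}

lemma poly_of_VP (a : K) (h : ∀ (P : MvPolynomial (Fin 2) k) hP, (VP K P hP).Ge 0 a) : ∃ A, a = jj k K A := by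
  by_cases ha : a = 0
  · exact ⟨0, by rw [ha, map_zero]⟩
  obtain ⟨A, B, hrel, hAB⟩ := IsFractionRing.exists_reduced_fraction (A := MvPolynomial (Fin 2) k) a
  have hB : (B : MvPolynomial (Fin 2) k) ≠ 0 := nonZeroDivisors.ne_zero B.2
  have e : a = jj k K A / jj k K B := by rw [← hAB, IsFractionRing.mk'_eq_div]; rfl
  have hA : A ≠ 0 := by rintro rfl; rw [map_zero, zero_div] at e; exact ha e
  have hu : IsUnit (B : MvPolynomial (Fin 2) k) := by
    by_contra hu
    obtain ⟨P, hPi, hPB⟩ := WfDvdMonoid.exists_irreducible_factor hu hB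
    have hP := hPi.prime
    have hPA : ¬ P ∣ A := fun hPA => hP.not_isUnit (hrel hPA hPB)
    have h1 := h P hP ha
    rw [e, ZVal.map_div _ (jj_ne K hA) (jj_ne K hB), VP_zero_of_not_dvd K hP A hPA] at h1
    have := VP_pos_of_dvd K hP B hB hPB
    omega
  obtain ⟨u, hu⟩ := hu.exists_right_inv
  refine ⟨A * u, ?_⟩
  rw [e, div_eq_iff (jj_ne K hB), ← _root_.map_mul, mul_assoc, mul_comm u, hu, mul_one]

/-- the coordinate ring of the complement of the curve. -/
def RR (K : Type) [Field K] [Algebra k K] [Algebra (MvPolynomial (Fin 2) k) K]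
  [IsScalarTower k (MvPolynomial (Fin 2) k) K] (G : MvPolynomial (Fin 2) k) (e : ℕ) : Set K :=
  {a | ∃ A n, A.totalDegree ≤ n * e ∧ a = jj k K A / jj k K G ^ n}

lemma mem_RR {G : MvPolynomial (Fin 2) k} (hG : Prime G) {e : ℕ} (he : G.totalDegree = e) (a : K) :
    a ∈ RR K G e ↔ (VL k K).Ge 0 a ∧ ∀ P hP, ¬ Associated P G → (VP K P hP).Ge 0 a := by
  have hG0 := jj_ne K hG.ne_zero
  constructor
  · rintro ⟨A, n, hA, rfl⟩
    constructor
    · intro ha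
      have hA0 : A ≠ 0 := by rintro rfl; simp at ha
      rw [ZVal.map_div _ (jj_ne K hA0) (pow_ne_zero _ hG0), ZVal.map_pow _ _ hG0, VL_spec k K A hA0, VL_spec k K G hG.ne_zero, he]
      have : (A.totalDegree : ℤ) ≤ n * e := by exact_mod_cast hA
      linarith
    · intro P hP hPG ha
      have hA0 : A ≠ 0 := by rintro rfl; simp at ha
      have hPG' : ¬ P ∣ G := fun h => hPG (hP.associated_of_dvd hG h)
      rw [ZVal.map_div _ (jj_ne K hA0) (pow_ne_zero _ hG0), ZVal.map_pow _ _ hG0, VP_zero_of_not_dvd K hP G hPG']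
      have := VP_ge K hP A (jj_ne K hA0)
      linarith
  · rintro ⟨h1, h2⟩
    by_cases ha : a = 0
    · exact ⟨0, 0, by simp, by simp [ha]⟩
    obtain ⟨n, hn⟩ : ∃ n : ℕ, - (VP K G hG).v a ≤ n := ⟨(- (VP K G hG).v a).toNat, by omega⟩
    obtain ⟨A, hA⟩ := poly_of_VP (k := k) (a * jj k K G ^ n) (by
      intro P hP _
      rw [ZVal.map_mul _ ha (pow_ne_zero _ hG0), ZVal.map_pow _ _ hG0]
      by_cases hPG : Associated P G
      · rw [VP_assoc K hP hG hPG _ ha, VP_assoc K hP hG hPG _ hG0, VP_self]; linarith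
      · have := h2 P hP hPG ha
        have := VP_ge K hP G hG0
        positivity)
    have hA0 : A ≠ 0 := by
      rintro rfl; rw [map_zero] at hA; exact mul_ne_zero ha (pow_ne_zero _ hG0) hA
    refine ⟨A, n, ?_, by rw [← hA, mul_div_cancel_right₀ _ (pow_ne_zero _ hG0)]⟩
    have h3 := congrArg (VL k K).v hA
    rw [ZVal.map_mul _ ha (pow_ne_zero _ hG0), ZVal.map_pow _ _ hG0, VL_spec k K A hA0, VL_spec k K G hG.ne_zero, he] at h3
    have := h1 ha
    have : (A.totalDegree : ℤ) ≤ n * e := by linarith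
    exact_mod_cast this

lemma RR_mul {G : MvPolynomial (Fin 2) k} {e : ℕ} {a b : K} (ha : a ∈ RR K G e) (hb : b ∈ RR K G e) : a * b ∈ RR K G e := by
  obtain ⟨A, n, h1, rfl⟩ := ha
  obtain ⟨B, m, h2, rfl⟩ := hb
  refine ⟨A * B, n + m, (totalDegree_mul _ _).trans (by rw [add_mul]; omega), ?_⟩
  rw [_root_.map_mul, pow_add, div_mul_div_comm]

lemma RR_pow {G : MvPolynomial (Fin 2) k} {e : ℕ} {a : K} (ha : a ∈ RR K G e) (n : ℕ) : a ^ n ∈ RR K G e := by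
  induction n with
  | zero => exact ⟨1, 0, by simp, by simp⟩
  | succ n ih => rw [pow_succ]; exact RR_mul ih ha

lemma tdeg_pow (A : MvPolynomial (Fin 2) k) (n : ℕ) : A ≠ 0 → (A ^ n).totalDegree = n * A.totalDegree := by
  intro hA
  induction n with
  | zero => simp
  | succ n ih => rw [pow_succ, totalDegree_mul_of_isDomain (pow_ne_zero _ hA) hA, ih]; ring

lemma RR_vG {G : MvPolynomial (Fin 2) k} (hG : Prime G) {e : ℕ} (he : G.totalDegree = e) (he0 : 0 < e) {a : K} (ha : a ∈ RR K G e)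
    (ha0 : a ≠ 0) : (VP K G hG).v a ≤ 0 := by
  obtain ⟨A, n, h1, rfl⟩ := ha
  have hG0 := jj_ne K hG.ne_zero
  have hA0 : A ≠ 0 := by rintro rfl; simp at ha0
  rw [ZVal.map_div _ (jj_ne K hA0) (pow_ne_zero _ hG0), ZVal.map_pow _ _ hG0, VP_self]
  by_contra h
  obtain ⟨B, rfl⟩ := dvd_of_VP K hG A hA0 (n + 1) (by push_cast; linarith)
  have hB : B ≠ 0 := right_ne_zero_of_mul hA0
  rw [totalDegree_mul_of_isDomain (pow_ne_zero _ hG.ne_zero) hB, tdeg_pow _ _ hG.ne_zero] at h1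
  rw [he, add_mul] at h1
  omega

/-- fractions of elements of the coordinate ring. -/
lemma frac_RR (G : MvPolynomial (Fin 2) k) (hG : G ≠ 0) {e : ℕ} (he0 : 0 < e) (a : K) :
    ∃ b c, b ∈ RR K G e ∧ c ∈ RR K G e ∧ c ≠ 0 ∧ a = b / c := by
  obtain ⟨A, B, hB, rfl⟩ := frac k a
  have hG0 := jj_ne K hG
  set n := A.totalDegree + B.totalDegree
  have hn : n ≤ n * e := Nat.le_mul_of_pos_right _ he0
  refine ⟨jj k K A / jj k K G ^ n, jj k K B / jj k K G ^ n, ⟨A, n, by omega, rfl⟩, ⟨B, n, by omega, rfl⟩, div_ne_zero (jj_ne K hB) (pow_ne_zero _ hG0), ?_⟩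
  rw [div_div_div_cancel_right₀ (pow_ne_zero _ hG0)]

end
end Yosh

open MvPolynomial
namespace Yosh
open scoped Polynomial

section
variable {k K : Type} [Field k] [Field K] [Algebra k K] [Algebra (MvPolynomial (Fin 2) k) K]
  [IsScalarTower k (MvPolynomial (Fin 2) k) K] [IsFractionRing (MvPolynomial (Fin 2) k) K]

/-- the ring homomorphism to dual numbers attached to a derivation. -/
lemma exists_dual {B : Type} [CommRing B] [Algebra k B] (j : B →ₐ[k] K) (D : Derivation k B B) :
    ∃ φ : B →ₐ[k] DualNumber K, ∀ A, φ A = TrivSqZeroExt.inl (j A) + TrivSqZeroExt.inr (j (D A)) :=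
  ⟨AlgHom.ofLinearMap
      { toFun := fun A => TrivSqZeroExt.inl (j A) + TrivSqZeroExt.inr (j (D A))
        map_add' := by
          intro a b
          ext <;> simp
        map_smul' := by
          intro c a
          ext <;> simp }
      (by ext <;> simp)
      (by
        intro a b
        ext
        · simp
        · simp [Derivation.leibniz]; ring), fun _ => rfl⟩

variable (k K) in
lemma exists_der (i : Fin 2) : ∃ D : Derivation k K K, ∀ A, D (jj k K A) = jj k K (pderiv i A) := by
  obtain ⟨φ, hφ⟩ := exists_dual (jj k K) (pderiv i)
  let Φ : K →ₐ[k] DualNumber K := IsLocalization.liftAlgHom (M := nonZeroDivisors (MvPolynomial (Fin 2) k)) (f := φ) (by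
    intro y
    rw [TrivSqZeroExt.isUnit_iff_isUnit_fst]
    simp only [hφ, TrivSqZeroExt.fst_add, TrivSqZeroExt.fst_inl, TrivSqZeroExt.fst_inr, add_zero]
    exact IsUnit.mk0 _ (jj_ne K (nonZeroDivisors.ne_zero y.2)))
  have hΦ : ∀ A, Φ (jj k K A) = φ A := by
    intro A
    exact IsLocalization.lift_eq _ _
  have hfst : ∀ a, (Φ a).fst = a := by
    intro a
    obtain ⟨A, B, hB, rfl⟩ := frac k a
    have h1 : Φ (jj k K A / jj k K B) * Φ (jj k K B) = Φ (jj k K A) := by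
      rw [← _root_.map_mul, div_mul_cancel₀ _ (jj_ne K hB)]
    have h2 := congrArg TrivSqZeroExt.fst h1
    rw [hΦ, hΦ, TrivSqZeroExt.fst_mul] at h2
    simp only [hφ, TrivSqZeroExt.fst_add, TrivSqZeroExt.fst_inl, TrivSqZeroExt.fst_inr, add_zero] at h2
    rw [eq_div_iff (jj_ne K hB), h2]
  refine ⟨Derivation.mk' ((TrivSqZeroExt.sndHom K K).restrictScalars k ∘ₗ Φ.toLinearMap) ?_, ?_⟩
  · intro a b
    simp [TrivSqZeroExt.snd_mul, hfst]; ring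
  · intro A
    change (Φ (jj k K A)).snd = _
    rw [hΦ, hφ]; simp only [TrivSqZeroExt.snd_add, TrivSqZeroExt.snd_inl, TrivSqZeroExt.snd_inr, zero_add]

variable (k K) in
/-- the partial derivatives on the function field. -/
noncomputable def dd (i : Fin 2) : Derivation k K K := (exists_der k K i).choose

lemma dd_jj (i : Fin 2) (A) : dd k K i (jj k K A) = jj k K (pderiv i A) := (exists_der k K i).choose_spec A

lemma der_ext (D D' : Derivation k K K) (h : ∀ i, D (jj k K (X i)) = D' (jj k K (X i))) : D = D' := by
  have h1 : ∀ A, D (jj k K A) = D' (jj k K A) := by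
    intro A
    induction A using MvPolynomial.induction_on with
    | C c =>
      have : jj k K (C c) = algebraMap k K c := (jj k K).commutes c
      rw [this]; simp
    | add p q hp hq => simp only [_root_.map_add, hp, hq]
    | mul_X p i hp => simp only [_root_.map_mul, Derivation.leibniz, hp, h]
  ext a
  obtain ⟨A, B, hB, rfl⟩ := frac k a
  rw [Derivation.leibniz_div, Derivation.leibniz_div, h1, h1]

variable (k) in
noncomputable abbrev JJ (a b : K) : K := Jac (dd k K 0) (dd k K 1) a b

lemma VP_dd {P : MvPolynomial (Fin 2) k} (hP : Prime P) (i : Fin 2) (a : K) (h : (VP K P hP).Ge 0 a) :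
    (VP K P hP).Ge 0 (dd k K i a) := by
  by_cases ha : a = 0
  · subst ha; simpa using ZVal.ge_zero _ _
  -- write a = A / B with P not dividing B
  obtain ⟨A, B, hB, rfl⟩ := frac k a
  have hA : A ≠ 0 := by rintro rfl; simp at ha
  obtain ⟨n, B', hn, rfl⟩ : ∃ n B', ¬ P ∣ B' ∧ B = P ^ n * B' := by
    have hf : FiniteMultiplicity P B := FiniteMultiplicity.of_prime_left hP hB
    obtain ⟨c, h1, h2⟩ := hf.exists_eq_pow_mul_and_not_dvd
    exact ⟨_, c, h2, h1⟩
  have hB' : B' ≠ 0 := right_ne_zero_of_mul hB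
  have hv := h ha
  rw [ZVal.map_div _ (jj_ne K hA) (jj_ne K hB), _root_.map_mul, ZVal.map_mul _ (jj_ne K (pow_ne_zero n hP.ne_zero)) (jj_ne K hB'),
    VP_zero_of_not_dvd K hP B' hn, _root_.map_pow, ZVal.map_pow _ _ (jj_ne K hP.ne_zero), VP_self] at hv
  obtain ⟨A', rfl⟩ := dvd_of_VP K hP A hA n (by linarith)
  have e : jj k K (P ^ n * A') / jj k K (P ^ n * B') = jj k K A' / jj k K B' := by
    rw [_root_.map_mul, _root_.map_mul, mul_div_mul_left _ _ (jj_ne K (pow_ne_zero n hP.ne_zero))]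
  rw [e, Derivation.leibniz_div, dd_jj, dd_jj]
  simp only [smul_eq_mul]
  have : (VP K P hP).Ge 0 ((jj k K B')⁻¹) := by
    intro _; rw [ZVal.map_inv _ _ (jj_ne K hB'), VP_zero_of_not_dvd K hP B' hn]; simp
  have h2 := ((VP_ge K hP B').mul0 (VP_ge K hP (pderiv i A'))).sub ((VP_ge K hP A').mul0 (VP_ge K hP (pderiv i B')))
  exact (this.pow0 2).mul0 h2

lemma VP_JJ0 {P : MvPolynomial (Fin 2) k} (hP : Prime P) (a b : K) (h : (VP K P hP).Ge 0 a) (h' : (VP K P hP).Ge 0 b) :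
    (VP K P hP).Ge 0 (JJ k a b) :=
  ((VP_dd hP 0 a h).mul0 (VP_dd hP 1 b h')).sub ((VP_dd hP 1 a h).mul0 (VP_dd hP 0 b h'))

/-- logarithmic derivative bound. -/
lemma VP_dlog {P : MvPolynomial (Fin 2) k} (hP : Prime P) (a : K) (ha : a ≠ 0) :
    ∃ (n : k) (u : K), u ≠ 0 ∧ (VP K P hP).v u = 0 ∧ ∀ i, dd k K i a / a = algebraMap k K n * (dd k K i (jj k K P) / jj k K P) + dd k K i u / u := by
  set q := jj k K P with hq
  have hq0 : q ≠ 0 := jj_ne K hP.ne_zero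
  set n := (VP K P hP).v a with hn
  refine ⟨(n : k), a * q ^ (-n), mul_ne_zero ha (zpow_ne_zero _ hq0), ?_, ?_⟩
  · rw [ZVal.map_mul _ ha (zpow_ne_zero _ hq0), ZVal.map_zpow _ _ hq0, hq, VP_self]; omega
  · intro i
    rw [Derivation.leibniz, Derivation.leibniz_zpow]
    have : q ^ (-n - 1) = q ^ (-n) / q := by rw [zpow_sub_one₀ hq0, div_eq_mul_inv]
    rw [this]
    have h3 := zpow_ne_zero (-n) hq0
    simp only [smul_eq_mul, zsmul_eq_mul]
    push_cast
    rw [map_intCast]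
    field_simp
    ring

lemma VP_log {P : MvPolynomial (Fin 2) k} (hP : Prime P) (a b : K) (ha : a ≠ 0) (hb : b ≠ 0) (hJ : JJ k a b ≠ 0) :
    (VP K P hP).v a + (VP K P hP).v b ≤ (VP K P hP).v (JJ k a b) + 1 := by
  obtain ⟨n, u, hu, hvu, h1⟩ := VP_dlog hP a ha
  obtain ⟨m, w, hw, hvw, h2⟩ := VP_dlog hP b hb
  set q := jj k K P with hq
  have hq0 : q ≠ 0 := jj_ne K hP.ne_zero
  have e : ∀ i, dd k K i a = a * (algebraMap k K n * (dd k K i q / q) + dd k K i u / u) := by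
    intro i; rw [← h1 i]; field_simp
  have e' : ∀ i, dd k K i b = b * (algebraMap k K m * (dd k K i q / q) + dd k K i w / w) := by
    intro i; rw [← h2 i]; field_simp
  have key : JJ k a b = (a * b * q⁻¹) * (algebraMap k K n * w⁻¹ * JJ k q w + algebraMap k K m * u⁻¹ * JJ k u q + q * u⁻¹ * w⁻¹ * JJ k u w) := by
    simp only [JJ, Jac]
    rw [e, e', e, e']
    field_simp
    ring
  have hgq : (VP K P hP).Ge 0 q := fun _ => by rw [hq, VP_self]; omega
  have hgu : (VP K P hP).Ge 0 u := fun _ => hvu.ge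
  have hgw : (VP K P hP).Ge 0 w := fun _ => hvw.ge
  have hgu' : (VP K P hP).Ge 0 u⁻¹ := fun _ => by rw [ZVal.map_inv _ _ hu, hvu]; simp
  have hgw' : (VP K P hP).Ge 0 w⁻¹ := fun _ => by rw [ZVal.map_inv _ _ hw, hvw]; simp
  have hs : (VP K P hP).Ge 0 (algebraMap k K n * w⁻¹ * JJ k q w + algebraMap k K m * u⁻¹ * JJ k u q + q * u⁻¹ * w⁻¹ * JJ k u w) :=
    ((((hgw'.const_mul n).mul0 (VP_JJ0 hP q w hgq hgw))).add ((hgu'.const_mul m).mul0 (VP_JJ0 hP u q hgu hgq))).add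
      (((hgq.mul0 hgu').mul0 hgw').mul0 (VP_JJ0 hP u w hgu hgw))
  have h0 : a * b * q⁻¹ ≠ 0 := mul_ne_zero (mul_ne_zero ha hb) (inv_ne_zero hq0)
  have hs0 := right_ne_zero_of_mul (key ▸ hJ)
  rw [key, ZVal.map_mul _ h0 hs0, ZVal.map_mul _ (mul_ne_zero ha hb) (inv_ne_zero hq0), ZVal.map_mul _ ha hb, ZVal.map_inv _ _ hq0]
  have := hs hs0
  have h5 : (VP K P hP).v q = 1 := VP_self K hP
  omega

end
end Yosh

open MvPolynomial
namespace Yosh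
open scoped Polynomial

section
variable {k K : Type} [Field k] [Field K] [Algebra k K] [Algebra (MvPolynomial (Fin 2) k) K]
  [IsScalarTower k (MvPolynomial (Fin 2) k) K] [IsFractionRing (MvPolynomial (Fin 2) k) K]

lemma VL_X (i : Fin 2) : (VL k K).v (jj k K (X i)) = -1 := by
  rw [VL_spec k K _ (X_ne_zero i), totalDegree_X]; rfl

lemma VL_mono (s : Fin 2 →₀ ℕ) (c : k) (n : ℕ) (hs : s.degree ≤ n) : (VL k K).Ge (-n) (jj k K (monomial s c)) := by
  intro h
  have hc : monomial s c ≠ 0 := by intro h0; rw [h0] at h; simp at h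
  have hc' : c ≠ 0 := by rintro rfl; simp at hc
  rw [VL_spec k K _ hc, totalDegree_monomial _ hc']
  have : (s.sum fun _ e => e) = s.degree := rfl
  rw [this]; omega

lemma VL_poly (A : MvPolynomial (Fin 2) k) (n : ℕ) (h : A.totalDegree ≤ n) : (VL k K).Ge (-n) (jj k K A) := by
  intro h0
  have hA : A ≠ 0 := by rintro rfl; simp at h0
  rw [VL_spec k K _ hA]; omega

lemma jjX_ne (i : Fin 2) : jj k K (X i) ≠ 0 := jj_ne K (X_ne_zero i)

lemma VL_Xinv (i : Fin 2) : (VL k K).Ge 1 (jj k K (X i))⁻¹ := by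
  intro _; rw [ZVal.map_inv _ _ (jjX_ne i), VL_X]; simp

lemma nsmul_ge (V : ZVal k K) {n : ℤ} {a : K} (h : V.Ge n a) (m : ℕ) : V.Ge n (m • a) := by
  have := h.smul (m : k)
  rwa [Nat.cast_smul_eq_nsmul] at this

lemma VL_dd_poly (i : Fin 2) (A : MvPolynomial (Fin 2) k) (n : ℕ) (h : A.totalDegree ≤ n) :
    (VL k K).Ge (-n + 1) (dd k K i (jj k K A)) := by
  rw [← support_sum_monomial_coeff A, _root_.map_sum, _root_.map_sum]
  refine ZVal.Ge.sum _ _ fun s hs => ?_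
  have hs' : s.degree ≤ n := (le_totalDegree hs).trans h
  have e : dd k K i (jj k K (monomial s (coeff s A))) = (s i • jj k K (monomial s (coeff s A))) * (jj k K (X i))⁻¹ := by
    rw [dd_jj, eq_mul_inv_iff_mul_eq₀ (jjX_ne i), ← _root_.map_mul, mul_comm, X_mul_pderiv_monomial, map_nsmul]
  rw [e]
  exact (nsmul_ge _ (VL_mono s _ n hs') _).mul (VL_Xinv i)

variable (k K) in
/-- Euler derivation. -/
noncomputable def Eu : Derivation k K K := jj k K (X 0) • dd k K 0 + jj k K (X 1) • dd k K 1

lemma Eu_apply (a : K) : Eu k K a = jj k K (X 0) * dd k K 0 a + jj k K (X 1) * dd k K 1 a := rfl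

lemma VL_Eu_poly (A : MvPolynomial (Fin 2) k) (n : ℕ) (h : A.totalDegree ≤ n) :
    (VL k K).Ge (-n + 1) (Eu k K (jj k K A) - n * jj k K A) := by
  have e : Eu k K (jj k K A) - n * jj k K A = ∑ s ∈ A.support, (Eu k K (jj k K (monomial s (coeff s A))) - n * jj k K (monomial s (coeff s A))) := by
    conv_lhs => rw [← support_sum_monomial_coeff A]
    rw [_root_.map_sum, _root_.map_sum, Finset.mul_sum, Finset.sum_sub_distrib]
  rw [e]
  refine ZVal.Ge.sum _ _ fun s hs => ?_
  have hs' : s.degree ≤ n := (le_totalDegree hs).trans h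
  have hsd : s.degree = s 0 + s 1 := by rw [Finsupp.degree_eq_sum]; simp
  have e : Eu k K (jj k K (monomial s (coeff s A))) = (s.degree : K) * jj k K (monomial s (coeff s A)) := by
    rw [Eu_apply, dd_jj, dd_jj, ← _root_.map_mul, ← _root_.map_mul, X_mul_pderiv_monomial, X_mul_pderiv_monomial, map_nsmul, map_nsmul, hsd]
    simp only [nsmul_eq_mul]; push_cast; ring
  rw [e]
  rcases hs'.eq_or_lt with h1 | h1
  · rw [h1, sub_self]; exact ZVal.ge_zero _ _
  · have h2 := (VL_mono (K := K) s (coeff s A) (n-1) (by omega))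
    rw [← nsmul_eq_mul, ← nsmul_eq_mul]
    refine ((nsmul_ge _ h2 _).sub (nsmul_ge _ h2 _)).mono (by omega)

lemma VL_dd (i : Fin 2) (a : K) (n : ℤ) (h : (VL k K).Ge n a) : (VL k K).Ge (n + 1) (dd k K i a) := by
  by_cases ha : a = 0
  · subst ha; simpa using ZVal.ge_zero _ _
  obtain ⟨A, B, hB, rfl⟩ := frac k a
  have hA : A ≠ 0 := by rintro rfl; simp at ha
  have hv := h ha
  rw [ZVal.map_div _ (jj_ne K hA) (jj_ne K hB), VL_spec k K _ hA, VL_spec k K _ hB] at hv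
  rw [Derivation.leibniz_div]
  simp only [smul_eq_mul]
  have h1 := (VL_poly (K := K) B _ le_rfl).mul (VL_dd_poly (K := K) i A _ le_rfl)
  have h2 := (VL_poly (K := K) A _ le_rfl).mul (VL_dd_poly (K := K) i B _ le_rfl)
  have h3 : (VL k K).Ge (2 * B.totalDegree) ((jj k K B)⁻¹ ^ 2) := by
    intro _; rw [ZVal.map_pow _ _ (inv_ne_zero (jj_ne K hB)), ZVal.map_inv _ _ (jj_ne K hB), VL_spec k K _ hB]; simp
  exact (h3.mul (h1.sub (h2.mono (by omega)))).mono (by omega)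

lemma VL_Eu (a : K) (h : (VL k K).Ge 0 a) : (VL k K).Ge 1 (Eu k K a) := by
  by_cases ha : a = 0
  · subst ha; simpa using ZVal.ge_zero _ _
  obtain ⟨A, B, hB, rfl⟩ := frac k a
  have hA : A ≠ 0 := by rintro rfl; simp at ha
  have hv := h ha
  rw [ZVal.map_div _ (jj_ne K hA) (jj_ne K hB), VL_spec k K _ hA, VL_spec k K _ hB] at hv
  have hle : A.totalDegree ≤ B.totalDegree := by omega
  set p := A.totalDegree with hp
  set q := B.totalDegree with hq
  have h1 := (VL_poly (K := K) B _ le_rfl).mul (VL_Eu_poly (K := K) A _ le_rfl)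
  have h2 := (VL_poly (K := K) A _ le_rfl).mul (VL_Eu_poly (K := K) B _ le_rfl)
  have h3 : (VL k K).Ge (2 * B.totalDegree) ((jj k K B)⁻¹ ^ 2) := by
    intro _; rw [ZVal.map_pow _ _ (inv_ne_zero (jj_ne K hB)), ZVal.map_inv _ _ (jj_ne K hB), VL_spec k K _ hB]; simp
  have hB0 := jj_ne K hB
  have e : Eu k K (jj k K A / jj k K B) = (jj k K B)⁻¹ ^ 2 * (jj k K B * (Eu k K (jj k K A) - p * jj k K A) - jj k K A * (Eu k K (jj k K B) - q * jj k K B))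
      + ((p : K) - q) * (jj k K A / jj k K B) := by
    rw [Derivation.leibniz_div]
    simp only [smul_eq_mul]
    field_simp
    ring
  rw [e]
  refine ZVal.Ge.add ((h3.mul (h1.sub (h2.mono (by omega)))).mono (by omega)) ?_
  rcases hle.eq_or_lt with h5 | h5
  · rw [h5, sub_self, zero_mul]; exact ZVal.ge_zero _ _
  · have h6 : (VL k K).Ge 1 (jj k K A / jj k K B) := by
      intro _
      rw [ZVal.map_div _ (jj_ne K hA) (jj_ne K hB), VL_spec k K _ hA, VL_spec k K _ hB]; omega
    rw [sub_mul, ← nsmul_eq_mul, ← nsmul_eq_mul]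
    exact (nsmul_ge _ h6 _).sub (nsmul_ge _ h6 _)

lemma VL_JJ3 (a b : K) (ha : (VL k K).Ge 0 a) (hb : (VL k K).Ge 0 b) : (VL k K).Ge 3 (JJ k a b) := by
  have h0 := jjX_ne (k := k) (K := K) 0
  have e : JJ k a b = (jj k K (X 0))⁻¹ * (Eu k K a * dd k K 1 b - dd k K 1 a * Eu k K b) := by
    rw [Eu_apply, Eu_apply]; simp only [JJ, Jac]; field_simp; ring
  rw [e]
  exact ((VL_Xinv 0).mul (((VL_Eu a ha).mul (VL_dd 1 b 0 hb)).sub (((VL_dd 1 a 0 ha).mul (VL_Eu b hb)).mono (by norm_num)))).mono (by norm_num)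

lemma VL_JJ (a b : K) (n m : ℤ) (ha : (VL k K).Ge n a) (hb : (VL k K).Ge m b) : (VL k K).Ge (n + m + 2) (JJ k a b) := by
  refine ((((VL_dd 0 a n ha).mul (VL_dd 1 b m hb))).sub ((VL_dd 1 a n ha).mul (VL_dd 0 b m hb))).mono (by omega)

/-- chain rule for automorphisms of the function field. -/
lemma JJ_chain (Ψ : K ≃ₐ[k] K) (a b : K) :
    JJ k (Ψ a) (Ψ b) = Ψ (JJ k a b) * JJ k (Ψ (jj k K (X 0))) (Ψ (jj k K (X 1))) := by
  have key : ∀ i a, dd k K i (Ψ a) = Ψ (dd k K 0 a) * dd k K i (Ψ (jj k K (X 0))) + Ψ (dd k K 1 a) * dd k K i (Ψ (jj k K (X 1))) := by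
    intro i a
    let D : Derivation k K K := Derivation.mk' (Ψ.symm.toLinearMap ∘ₗ (dd k K i : K →ₗ[k] K) ∘ₗ Ψ.toLinearMap) (by
      intro a b
      simp [Derivation.leibniz])
    have hD : ∀ a, D a = Ψ.symm (dd k K i (Ψ a)) := fun _ => rfl
    have : D = D (jj k K (X 0)) • dd k K 0 + D (jj k K (X 1)) • dd k K 1 := by
      apply der_ext
      intro j
      fin_cases j <;> simp only [Derivation.add_apply, Derivation.smul_apply, dd_jj] <;> simp [pderiv_X]
    have h2 := congrArg Ψ (congrArg (fun D => D a) this)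
    simp only [Derivation.add_apply, Derivation.smul_apply, hD, smul_eq_mul, _root_.map_add, _root_.map_mul, AlgEquiv.apply_symm_apply] at h2
    rw [h2]; ring
  simp only [JJ, Jac]
  rw [key 0 a, key 1 a, key 0 b, key 1 b, _root_.map_sub, _root_.map_mul, _root_.map_mul]
  ring

lemma JJ_XX : JJ k (jj k K (X 0)) (jj k K (X 1)) = 1 := by
  simp only [JJ, Jac, dd_jj]; simp [pderiv_X]

lemma theta_ne (Ψ : K ≃ₐ[k] K) : JJ k (Ψ (jj k K (X 0))) (Ψ (jj k K (X 1))) ≠ 0 := by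
  intro h
  have := JJ_chain Ψ (Ψ.symm (jj k K (X 0))) (Ψ.symm (jj k K (X 1)))
  rw [h, mul_zero, AlgEquiv.apply_symm_apply, AlgEquiv.apply_symm_apply, JJ_XX] at this
  exact one_ne_zero this

end
end Yosh

open MvPolynomial
namespace Yosh
open scoped Polynomial

section
variable {k K : Type} [Field k] [Field K] [Algebra k K] [Algebra (MvPolynomial (Fin 2) k) K]
  [IsScalarTower k (MvPolynomial (Fin 2) k) K] [IsFractionRing (MvPolynomial (Fin 2) k) K]

lemma pt_star {F G : MvPolynomial (Fin 2) k} (hF : Prime F) {d e : ℕ}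
    (hd : F.totalDegree = d) (Ψ : K ≃ₐ[k] K)
    (hΨ : ∀ a, a ∈ RR K F d ↔ Ψ a ∈ RR K G e) (y : K) (hy : y ∈ RR K G e) (hy0 : y ≠ 0) (i N : ℕ) :
    y ^ N / (Ψ (jj k K F)⁻¹) ^ i ∈ RR K G e ↔ (i * d : ℤ) ≤ N * (VL k K).v (Ψ.symm y) := by
  obtain ⟨a, rfl⟩ := Ψ.surjective y
  have ha : a ∈ RR K F d := (hΨ a).mpr hy
  have ha0 : a ≠ 0 := by rintro rfl; simp at hy0
  have hF0 := jj_ne K hF.ne_zero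
  have e1 : Ψ a ^ N / (Ψ (jj k K F)⁻¹) ^ i = Ψ (a ^ N * jj k K F ^ i) := by
    rw [_root_.map_mul, _root_.map_pow, _root_.map_pow, map_inv₀, inv_pow, div_inv_eq_mul]
  rw [e1, ← hΨ, AlgEquiv.symm_apply_apply, mem_RR hF hd]
  have hv : (VL k K).v (a ^ N * jj k K F ^ i) = N * (VL k K).v a - i * d := by
    rw [ZVal.map_mul _ (pow_ne_zero _ ha0) (pow_ne_zero _ hF0), ZVal.map_pow _ _ ha0, ZVal.map_pow _ _ hF0, VL_spec k K _ hF.ne_zero, hd]; ring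
  constructor
  · rintro ⟨h1, -⟩
    have := h1 (mul_ne_zero (pow_ne_zero _ ha0) (pow_ne_zero _ hF0))
    rw [hv] at this; linarith
  · intro h
    refine ⟨fun _ => by rw [hv]; linarith, fun P hP hPF => ?_⟩
    exact ((((mem_RR hF hd a).mp ha).2 P hP hPF).pow0 N).mul0 ((VP_ge K hP F).pow0 i)

lemma RR_form {G : MvPolynomial (Fin 2) k} (hG : Prime G) {e : ℕ} (he : G.totalDegree = e) (he0 : 0 < e) {a : K} (ha : a ∈ RR K G e)
    (ha0 : a ≠ 0) : ∃ A n, ¬ G ∣ A ∧ A.totalDegree ≤ n * e ∧ a = jj k K A / jj k K G ^ n := by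
  have hv := RR_vG hG he he0 ha ha0
  obtain ⟨A, n, h1, rfl⟩ := ha
  have hA0 : A ≠ 0 := by rintro rfl; simp at ha0
  have hG0 := jj_ne K hG.ne_zero
  obtain ⟨i, A', hn, rfl⟩ : ∃ n B', ¬ G ∣ B' ∧ A = G ^ n * B' := by
    have hf : FiniteMultiplicity G A := FiniteMultiplicity.of_prime_left hG hA0
    obtain ⟨c, h1, h2⟩ := hf.exists_eq_pow_mul_and_not_dvd
    exact ⟨_, c, h2, h1⟩
  have hA' := right_ne_zero_of_mul hA0
  rw [_root_.map_mul, _root_.map_pow, ZVal.map_div _ (mul_ne_zero (pow_ne_zero _ hG0) (jj_ne K hA')) (pow_ne_zero _ hG0), ZVal.map_mul _ (pow_ne_zero _ hG0) (jj_ne K hA'),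
    ZVal.map_pow _ _ hG0, ZVal.map_pow _ _ hG0, VP_self, VP_zero_of_not_dvd K hG _ hn] at hv
  obtain ⟨l, rfl⟩ : ∃ l, n = i + l := ⟨n - i, by omega⟩
  refine ⟨A', l, hn, ?_, ?_⟩
  · rw [totalDegree_mul_of_isDomain (pow_ne_zero _ hG.ne_zero) hA', tdeg_pow _ _ hG.ne_zero, he, add_mul] at h1
    omega
  · rw [_root_.map_mul, _root_.map_pow, pow_add, mul_div_mul_left _ _ (pow_ne_zero _ hG0)]

/-- First part of the analysis of the image of the pole divisor. -/
lemma pt_form {F G : MvPolynomial (Fin 2) k} (hF : Prime F) (hG : Prime G) {d e : ℕ}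
    (hd : F.totalDegree = d) (he : G.totalDegree = e) (hd0 : 0 < d) (he0 : 0 < e) (Ψ : K ≃ₐ[k] K)
    (hΨ : ∀ a, a ∈ RR K F d ↔ Ψ a ∈ RR K G e) :
    ∃ (c : k) (n : ℕ), c ≠ 0 ∧ ((∃ (P : MvPolynomial (Fin 2) k) (_ : Prime P) (s : ℕ), 1 ≤ s ∧ ¬ Associated P G ∧ s * P.totalDegree = n * e ∧
      Ψ (jj k K F)⁻¹ = algebraMap k K c * jj k K P ^ s / jj k K G ^ n) ∨ (1 ≤ n ∧ Ψ (jj k K F)⁻¹ = algebraMap k K c / jj k K G ^ n)) := by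
  have hF0 := jj_ne K hF.ne_zero
  have hG0 := jj_ne K hG.ne_zero
  have hu0 : Ψ (jj k K F)⁻¹ ≠ 0 := by simpa using hF0
  have huF : (jj k K F)⁻¹ ∈ RR K F d := ⟨1, 1, by simp, by simp⟩
  have huG := (hΨ _).mp huF
  have hstar := pt_star hF hd Ψ hΨ
  have hlam : ∀ y, y ∈ RR K G e → y ≠ 0 → 0 ≤ (VL k K).v (Ψ.symm y) := by
    intro y hy hy0
    have := (hstar y hy hy0 0 1).mp (by simpa using hy)
    simpa using this
  obtain ⟨A, n, hGA, hAn, hu⟩ := RR_form hG he he0 huG hu0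
  have hA0 : A ≠ 0 := by rintro rfl; exact hGA (dvd_zero _)
  by_cases hAu : IsUnit A
  · obtain ⟨c, hc, rfl⟩ := (MvPolynomial.isUnit_iff_eq_C_of_isReduced).mp hAu
    have hCc : jj k K (C c) = algebraMap k K c := (jj k K).commutes c
    rw [hCc] at hu
    refine ⟨c, n, hc.ne_zero, Or.inr ⟨?_, hu⟩⟩
    by_contra hn
    have hn : n = 0 := by omega
    subst hn
    have h1 : (1:K) ∈ RR K G e := ⟨1, 0, by simp, by simp⟩
    have := (hstar 1 h1 one_ne_zero 1 1).mp (by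
      rw [hu]
      refine ⟨C c⁻¹, 0, by simp, ?_⟩
      have hCc' : jj k K (C c⁻¹) = algebraMap k K c⁻¹ := (jj k K).commutes c⁻¹
      rw [hCc']; simp)
    rw [_root_.map_one, ZVal.map_one] at this
    simp at this; omega
  · obtain ⟨P, hP, hPA⟩ := WfDvdMonoid.exists_irreducible_factor hAu hA0
    replace hP := hP.prime
    obtain ⟨s, B, hPB, hAB⟩ : ∃ n B', ¬ P ∣ B' ∧ A = P ^ n * B' := by
      have hf : FiniteMultiplicity P A := FiniteMultiplicity.of_prime_left hP hA0
      obtain ⟨c, h1, h2⟩ := hf.exists_eq_pow_mul_and_not_dvd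
      exact ⟨_, c, h2, h1⟩
    have hs : 1 ≤ s := by
      by_contra h
      have : s = 0 := by omega
      subst this
      rw [pow_zero, one_mul] at hAB
      exact hPB (hAB ▸ hPA)
    have hB0 : B ≠ 0 := by rintro rfl; exact hPB (dvd_zero _)
    have hP0 := hP.ne_zero
    have hPG : ¬ Associated P G := fun h => hGA (h.symm.dvd.trans hPA)
    have hPG' : ¬ P ∣ G := fun h => hPG (hP.associated_of_dvd hG h)
    set y1 := jj k K (P ^ e) / jj k K G ^ P.totalDegree with hy1
    set y2 := jj k K (B ^ e) / jj k K G ^ B.totalDegree with hy2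
    set y3 := (jj k K G)⁻¹ with hy3
    have m1 : y1 ∈ RR K G e := ⟨_, _, by rw [tdeg_pow _ _ hP0, mul_comm], rfl⟩
    have m2 : y2 ∈ RR K G e := ⟨_, _, by rw [tdeg_pow _ _ hB0, mul_comm], rfl⟩
    have m3 : y3 ∈ RR K G e := ⟨1, 1, by simp, by simp [hy3]⟩
    have n1 : y1 ≠ 0 := div_ne_zero (jj_ne K (pow_ne_zero _ hP0)) (pow_ne_zero _ hG0)
    have n2 : y2 ≠ 0 := div_ne_zero (jj_ne K (pow_ne_zero _ hB0)) (pow_ne_zero _ hG0)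
    have n3 : y3 ≠ 0 := inv_ne_zero hG0
    have hdegA : A.totalDegree = s * P.totalDegree + B.totalDegree := by
      rw [hAB, totalDegree_mul_of_isDomain (pow_ne_zero _ hP0) hB0, tdeg_pow _ _ hP0]
    have hprod : 0 < (VL k K).v (Ψ.symm (y1 * y2 * y3)) := by
      set N := s + n + 1 with hN
      obtain ⟨D, hD⟩ : A ∣ (P * B) ^ (e * N) := by
        have hle : s ≤ e * N := by
          have : N ≤ e * N := Nat.le_mul_of_pos_left _ he0
          omega
        rw [hAB, mul_pow]
        refine mul_dvd_mul (pow_dvd_pow _ hle) (dvd_pow_self _ (by omega))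
      have hD0 : D ≠ 0 := by
        rintro rfl; rw [mul_zero] at hD
        exact pow_ne_zero _ (mul_ne_zero hP0 hB0) hD
      have := (hstar (y1 * y2 * y3) (RR_mul (RR_mul m1 m2) m3) (mul_ne_zero (mul_ne_zero n1 n2) n3) 1 N).mp (by
        refine ⟨D * G ^ n, N * (P.totalDegree + B.totalDegree + 1), ?_, ?_⟩
        · have h1 := congrArg totalDegree hD
          rw [tdeg_pow _ _ (mul_ne_zero hP0 hB0), totalDegree_mul_of_isDomain hP0 hB0, totalDegree_mul_of_isDomain hA0 hD0] at h1
          rw [totalDegree_mul_of_isDomain hD0 (pow_ne_zero _ hG.ne_zero), tdeg_pow _ _ hG.ne_zero, he]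
          have h2 : n * e ≤ N * e := Nat.mul_le_mul_right _ (by omega)
          nlinarith
        · rw [hu, hy1, hy2, hy3, pow_one, div_eq_iff (div_ne_zero (jj_ne K hA0) (pow_ne_zero _ hG0))]
          have h1 := congrArg (jj k K) hD
          simp only [_root_.map_mul, _root_.map_pow] at h1 ⊢
          have h2 : jj k K G ^ (N * (P.totalDegree + B.totalDegree + 1)) = (jj k K G ^ P.totalDegree * jj k K G ^ B.totalDegree * jj k K G) ^ N := by
            rw [mul_comm, pow_mul]; congr 1; rw [pow_succ, pow_add]
          rw [h2, mul_pow, mul_pow, div_pow, div_pow, inv_pow, mul_pow, mul_pow, ← pow_mul, ← pow_mul (jj k K B)]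
          field_simp
          rw [← mul_pow, h1, mul_comm])
      have hN0 : (0:ℤ) < N := by positivity
      by_contra hneg
      push Not at hneg
      have h5 : (N:ℤ) * (VL k K).v (Ψ.symm (y1 * y2 * y3)) ≤ 0 := mul_nonpos_of_nonneg_of_nonpos hN0.le hneg
      push_cast at this
      omega
    have hpos : ∀ y, y ∈ RR K G e → y ≠ 0 → 0 < (VL k K).v (Ψ.symm y) → y ^ d / Ψ (jj k K F)⁻¹ ∈ RR K G e := by
      intro y hy hy0 h
      have := (hstar y hy hy0 1 d).mpr (by push_cast; nlinarith)
      rwa [pow_one] at this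
    have hvPu : (VP K P hP).v (Ψ (jj k K F)⁻¹) = s := by
      rw [hu, ZVal.map_div _ (jj_ne K hA0) (pow_ne_zero _ hG0), ZVal.map_pow _ _ hG0, VP_zero_of_not_dvd K hP _ hPG', hAB, _root_.map_mul, _root_.map_pow,
        ZVal.map_mul _ (pow_ne_zero _ (jj_ne K hP0)) (jj_ne K hB0), VP_zero_of_not_dvd K hP _ hPB, ZVal.map_pow _ _ (jj_ne K hP0), VP_self]; ring
    -- contradiction when the value at P vanishes
    have hno : ∀ y, y ∈ RR K G e → y ≠ 0 → (VP K P hP).v y = 0 → (VL k K).v (Ψ.symm y) = 0 := by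
      intro y hy hy0 h
      by_contra hne
      have h1 := hpos y hy hy0 (lt_of_le_of_ne (hlam y hy hy0) (Ne.symm hne))
      have h2 := ((mem_RR hG he _).mp h1).2 P hP hPG (div_ne_zero (pow_ne_zero _ hy0) hu0)
      rw [ZVal.map_div _ (pow_ne_zero _ hy0) hu0, ZVal.map_pow _ _ hy0, h, hvPu] at h2
      omega
    have hl2 := hno y2 m2 n2 (by
      rw [hy2, ZVal.map_div _ (jj_ne K (pow_ne_zero _ hB0)) (pow_ne_zero _ hG0), ZVal.map_pow _ _ hG0, VP_zero_of_not_dvd K hP _ hPG', _root_.map_pow,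
        ZVal.map_pow _ _ (jj_ne K hB0), VP_zero_of_not_dvd K hP _ hPB]; ring)
    have hl3 := hno y3 m3 n3 (by
      rw [hy3, ZVal.map_inv _ _ hG0, VP_zero_of_not_dvd K hP _ hPG']; ring)
    have hl1 : 0 < (VL k K).v (Ψ.symm y1) := by
      rw [_root_.map_mul, _root_.map_mul, ZVal.map_mul _ (mul_ne_zero _ _) , ZVal.map_mul, hl2, hl3] at hprod
      · simpa using hprod
      all_goals simpa
    have h1 := (mem_RR hG he _).mp (hpos y1 m1 n1 hl1)
    have hne1 : y1 ^ d / Ψ (jj k K F)⁻¹ ≠ 0 := div_ne_zero (pow_ne_zero _ n1) hu0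
    have hBu : IsUnit B := by
      by_contra hBu
      obtain ⟨Q, hQ, hQB⟩ := WfDvdMonoid.exists_irreducible_factor hBu hB0
      replace hQ := hQ.prime
      have hQA : Q ∣ A := by rw [hAB]; exact hQB.mul_left _
      have hQG : ¬ Associated Q G := fun h => hGA (h.symm.dvd.trans hQA)
      have hQG' : ¬ Q ∣ G := fun h => hQG (hQ.associated_of_dvd hG h)
      have hQP : ¬ Q ∣ P := fun h => hPB ((hQ.associated_of_dvd hP h).symm.dvd.trans hQB)
      have h2 := h1.2 Q hQ hQG hne1
      have h3 := VP_pos_of_dvd K hQ A hA0 hQA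
      rw [ZVal.map_div _ (pow_ne_zero _ n1) hu0, ZVal.map_pow _ _ n1, hy1, hu, ZVal.map_div _ (jj_ne K (pow_ne_zero _ hP0)) (pow_ne_zero _ hG0),
        ZVal.map_div _ (jj_ne K hA0) (pow_ne_zero _ hG0), ZVal.map_pow _ _ hG0, ZVal.map_pow _ _ hG0, VP_zero_of_not_dvd K hQ _ hQG', _root_.map_pow,
        ZVal.map_pow _ _ (jj_ne K hP0), VP_zero_of_not_dvd K hQ _ hQP] at h2
      rw [mul_zero, mul_zero, mul_zero, sub_zero, mul_zero, sub_zero] at h2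
      omega
    obtain ⟨c, hc, rfl⟩ := (MvPolynomial.isUnit_iff_eq_C_of_isReduced).mp hBu
    have hCc : jj k K (C c) = algebraMap k K c := (jj k K).commutes c
    refine ⟨c, n, hc.ne_zero, Or.inl ⟨P, hP, s, hs, hPG, ?_, ?_⟩⟩
    · have h2 := h1.1 hne1
      rw [ZVal.map_div _ (pow_ne_zero _ n1) hu0, ZVal.map_pow _ _ n1, hy1, hu, ZVal.map_div _ (jj_ne K (pow_ne_zero _ hP0)) (pow_ne_zero _ hG0),
        ZVal.map_div _ (jj_ne K hA0) (pow_ne_zero _ hG0), ZVal.map_pow _ _ hG0, ZVal.map_pow _ _ hG0, VL_spec k K _ hG.ne_zero, he, VL_spec k K _ hA0,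
        VL_spec k K _ (pow_ne_zero _ hP0), tdeg_pow _ _ hP0, hdegA, totalDegree_C] at h2
      rw [hdegA, totalDegree_C] at hAn
      push_cast at h2
      have h3 : ((s * P.totalDegree : ℕ) : ℤ) = (n * e : ℕ) := by
        apply le_antisymm
        · exact_mod_cast hAn
        · push_cast
          linarith
      exact_mod_cast h3
    · rw [hu, hAB, _root_.map_mul, _root_.map_pow, hCc, mul_comm]

end
end Yosh

open MvPolynomial
namespace Yosh
open scoped Polynomial

section
variable {k K : Type} [Field k] [Field K] [Algebra k K] [Algebra (MvPolynomial (Fin 2) k) K]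
  [IsScalarTower k (MvPolynomial (Fin 2) k) K] [IsFractionRing (MvPolynomial (Fin 2) k) K]

lemma pt_id {F G : MvPolynomial (Fin 2) k} (hF : Prime F) (hG : Prime G) {d e : ℕ}
    (hd : F.totalDegree = d) (hd0 : 0 < d) (he0 : 0 < e) (Ψ : K ≃ₐ[k] K)
    (hΨ : ∀ a, a ∈ RR K F d ↔ Ψ a ∈ RR K G e) (w : ZVal k K) (n0 : ℕ) (hn0 : 1 ≤ n0)
    (hw : ∀ y, y ∈ RR K G e → y ≠ 0 → 0 ≤ w.v y)
    (hone : ∃ a, a ≠ 0 ∧ w.v a = 1)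
    (h : ∀ y, y ∈ RR K G e → y ≠ 0 → ∀ i N : ℕ, (y ^ N / (Ψ (jj k K F)⁻¹) ^ i ∈ RR K G e ↔ (i * n0 : ℤ) ≤ N * w.v y)) :
    n0 = d ∧ ∀ a, a ≠ 0 → w.v (Ψ a) = (VL k K).v a := by
  have hstar := pt_star hF hd Ψ hΨ
  have hlam : ∀ y, y ∈ RR K G e → y ≠ 0 → 0 ≤ (VL k K).v (Ψ.symm y) := by
    intro y hy hy0
    have := (hstar y hy hy0 0 1).mp (by simpa using hy)
    simpa using this
  have key : ∀ y, y ∈ RR K G e → y ≠ 0 → n0 * (VL k K).v (Ψ.symm y) = d * w.v y := by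
    intro y hy hy0
    obtain ⟨p, hp⟩ := Int.eq_ofNat_of_zero_le (hlam y hy hy0)
    obtain ⟨q, hq⟩ := Int.eq_ofNat_of_zero_le (hw y hy hy0)
    have h1 := fun i => (hstar y hy hy0 i (d * n0)).symm.trans (h y hy hy0 i (d * n0))
    rw [hp, hq] at h1 ⊢
    have hd0' : (0:ℤ) < d := by exact_mod_cast hd0
    have hn0' : (0:ℤ) < n0 := by exact_mod_cast hn0
    apply le_antisymm
    · have := (h1 (n0 * p)).mp (by push_cast; apply le_of_eq; ring)
      push_cast at this
      nlinarith
    · have := (h1 (d * q)).mpr (by push_cast; apply le_of_eq; ring)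
      push_cast at this
      nlinarith
  have key2 : ∀ a, a ≠ 0 → n0 * (VL k K).v (Ψ.symm a) = d * w.v a := by
    intro a ha
    obtain ⟨b, c, hb, hc, hc0, rfl⟩ := frac_RR G hG.ne_zero he0 a
    have hb0 : b ≠ 0 := by rintro rfl; simp at ha
    rw [map_div₀, ZVal.map_div _ (by simpa) (by simpa), ZVal.map_div _ hb0 hc0, mul_sub, mul_sub, key b hb hb0, key c hc hc0]
  have hnd : n0 = d := by
    apply Nat.dvd_antisymm
    · obtain ⟨a, ha, h1⟩ := hone
      have := key2 a ha
      rw [h1, mul_one] at this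
      have : (n0 : ℤ) ∣ d := ⟨_, this.symm⟩
      exact_mod_cast this
    · have := key2 (Ψ (jj k K (X 0))⁻¹) (by simpa using jjX_ne 0)
      rw [AlgEquiv.symm_apply_apply, ZVal.map_inv _ _ (jjX_ne 0), VL_X, neg_neg, mul_one] at this
      have : (d : ℤ) ∣ n0 := ⟨_, this⟩
      exact_mod_cast this
  refine ⟨hnd, fun a ha => ?_⟩
  have := key2 (Ψ a) (by simpa)
  rw [AlgEquiv.symm_apply_apply, hnd] at this
  exact (mul_left_cancel₀ (by exact_mod_cast hd0.ne') this).symm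

/-- The transform of the line at infinity. -/
structure PT (F G : MvPolynomial (Fin 2) k) (d e : ℕ) (Ψ : K ≃ₐ[k] K) where
  c : k
  hc : c ≠ 0
  P0 : MvPolynomial (Fin 2) k
  hP0 : P0 ≠ 0
  w : ZVal k K
  m : ℕ
  n : ℕ
  hw : (∃ hP : Prime P0, ¬ Associated P0 G ∧ w = VP K P0 hP ∧ P0.totalDegree = m) ∨ (P0 = 1 ∧ w = VL k K ∧ m = 1)
  hval : ∀ a, a ≠ 0 → w.v (Ψ a) = (VL k K).v a
  hu : Ψ (jj k K F)⁻¹ = algebraMap k K c * jj k K P0 ^ d / jj k K G ^ n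
  hn : n * e = d * m

lemma alg_ne {c : k} (hc : c ≠ 0) : algebraMap k K c ≠ 0 := by simpa using hc

lemma pt_exists {F G : MvPolynomial (Fin 2) k} (hF : Prime F) (hG : Prime G) {d e : ℕ}
    (hd : F.totalDegree = d) (he : G.totalDegree = e) (hd0 : 0 < d) (he0 : 0 < e) (Ψ : K ≃ₐ[k] K)
    (hΨ : ∀ a, a ∈ RR K F d ↔ Ψ a ∈ RR K G e) : Nonempty (PT F G d e Ψ) := by
  have hG0 := jj_ne K hG.ne_zero
  have hF0 := jj_ne K hF.ne_zero
  have hu0 : Ψ (jj k K F)⁻¹ ≠ 0 := by simpa using hF0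
  obtain ⟨c, n, hc, ⟨P, hP, s, hs, hPG, hdeg, hu⟩ | ⟨hn, hu⟩⟩ := pt_form hF hG hd he hd0 he0 Ψ hΨ
  · have hP0 := jj_ne K hP.ne_zero
    have hPG' : ¬ P ∣ G := fun h => hPG (hP.associated_of_dvd hG h)
    have hVL : (VL k K).v (Ψ (jj k K F)⁻¹) = 0 := by
      rw [hu, ZVal.map_div _ (mul_ne_zero (alg_ne hc) (pow_ne_zero _ hP0)) (pow_ne_zero _ hG0), ZVal.map_mul _ (alg_ne hc) (pow_ne_zero _ hP0), ZVal.map_const' _ c hc,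
        ZVal.map_pow _ _ hP0, ZVal.map_pow _ _ hG0, VL_spec k K _ hP.ne_zero, VL_spec k K _ hG.ne_zero, he]
      have : (s * P.totalDegree : ℤ) = n * e := by exact_mod_cast hdeg
      linarith
    have hVQ : ∀ Q hQ, ¬ Associated Q G → (VP K Q hQ).v (Ψ (jj k K F)⁻¹) = s * (VP K Q hQ).v (jj k K P) := by
      intro Q hQ hQG
      have hQG' : ¬ Q ∣ G := fun h => hQG (hQ.associated_of_dvd hG h)
      rw [hu, ZVal.map_div _ (mul_ne_zero (alg_ne hc) (pow_ne_zero _ hP0)) (pow_ne_zero _ hG0), ZVal.map_mul _ (alg_ne hc) (pow_ne_zero _ hP0), ZVal.map_const' _ c hc,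
        ZVal.map_pow _ _ hP0, ZVal.map_pow _ _ hG0, VP_zero_of_not_dvd K hQ _ hQG']
      ring
    obtain ⟨h1, h2⟩ := pt_id hF hG hd hd0 he0 Ψ hΨ (VP K P hP) s hs
      (fun y hy hy0 => ((mem_RR hG he y).mp hy).2 P hP hPG hy0) ⟨_, hP0, VP_self K hP⟩ (by
      intro y hy hy0 i N
      have hy' := (mem_RR hG he y).mp hy
      rw [mem_RR hG he]
      have hne : y ^ N / Ψ (jj k K F)⁻¹ ^ i ≠ 0 := div_ne_zero (pow_ne_zero _ hy0) (pow_ne_zero _ hu0)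
      constructor
      · rintro ⟨-, h⟩
        have := h P hP hPG hne
        rw [ZVal.map_div _ (pow_ne_zero _ hy0) (pow_ne_zero _ hu0), ZVal.map_pow _ _ hy0, ZVal.map_pow _ _ hu0, hVQ P hP hPG, VP_self] at this
        linarith
      · intro h
        constructor
        · intro _
          rw [ZVal.map_div _ (pow_ne_zero _ hy0) (pow_ne_zero _ hu0), ZVal.map_pow _ _ hy0, ZVal.map_pow _ _ hu0, hVL, mul_zero, sub_zero]
          have := hy'.1 hy0
          positivity
        · intro Q hQ hQG _
          rw [ZVal.map_div _ (pow_ne_zero _ hy0) (pow_ne_zero _ hu0), ZVal.map_pow _ _ hy0, ZVal.map_pow _ _ hu0, hVQ Q hQ hQG]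
          by_cases hQP : Associated Q P
          · rw [VP_assoc K hQ hP hQP _ hP0, VP_self, VP_assoc K hQ hP hQP _ hy0]; linarith
          · rw [VP_zero_of_not_dvd K hQ P (fun h => hQP (hQ.associated_of_dvd hP h))]
            have := hy'.2 Q hQ hQG hy0
            simp only [mul_zero, sub_zero]
            positivity)
    subst h1
    exact ⟨⟨c, hc, P, hP.ne_zero, VP K P hP, P.totalDegree, n, Or.inl ⟨hP, hPG, rfl, rfl⟩, h2, hu, hdeg.symm⟩⟩
  · have hVL : (VL k K).v (Ψ (jj k K F)⁻¹) = (n * e : ℕ) := by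
      rw [hu, ZVal.map_div _ (alg_ne hc) (pow_ne_zero _ hG0), ZVal.map_const' _ c hc, ZVal.map_pow _ _ hG0, VL_spec k K _ hG.ne_zero, he]
      push_cast; ring
    have hVQ : ∀ Q hQ, ¬ Associated Q G → (VP K Q hQ).v (Ψ (jj k K F)⁻¹) = 0 := by
      intro Q hQ hQG
      have hQG' : ¬ Q ∣ G := fun h => hQG (hQ.associated_of_dvd hG h)
      rw [hu, ZVal.map_div _ (alg_ne hc) (pow_ne_zero _ hG0), ZVal.map_const' _ c hc, ZVal.map_pow _ _ hG0, VP_zero_of_not_dvd K hQ _ hQG']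
      ring
    obtain ⟨h1, h2⟩ := pt_id hF hG hd hd0 he0 Ψ hΨ (VL k K) (n * e) (Nat.mul_pos hn he0)
      (fun y hy hy0 => ((mem_RR hG he y).mp hy).1 hy0) ⟨(jj k K (X 0))⁻¹, inv_ne_zero (jjX_ne 0), by rw [ZVal.map_inv _ _ (jjX_ne 0), VL_X]; simp⟩ (by
      intro y hy hy0 i N
      have hy' := (mem_RR hG he y).mp hy
      rw [mem_RR hG he]
      have hne : y ^ N / Ψ (jj k K F)⁻¹ ^ i ≠ 0 := div_ne_zero (pow_ne_zero _ hy0) (pow_ne_zero _ hu0)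
      constructor
      · rintro ⟨h, -⟩
        have := h hne
        rw [ZVal.map_div _ (pow_ne_zero _ hy0) (pow_ne_zero _ hu0), ZVal.map_pow _ _ hy0, ZVal.map_pow _ _ hu0, hVL] at this
        linarith
      · intro h
        constructor
        · intro _
          rw [ZVal.map_div _ (pow_ne_zero _ hy0) (pow_ne_zero _ hu0), ZVal.map_pow _ _ hy0, ZVal.map_pow _ _ hu0, hVL]
          linarith
        · intro Q hQ hQG _
          rw [ZVal.map_div _ (pow_ne_zero _ hy0) (pow_ne_zero _ hu0), ZVal.map_pow _ _ hy0, ZVal.map_pow _ _ hu0, hVQ Q hQ hQG]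
          have := hy'.2 Q hQ hQG hy0
          simp only [mul_zero, sub_zero]
          positivity)
    exact ⟨⟨c, hc, 1, one_ne_zero, VL k K, 1, n, Or.inr ⟨rfl, rfl, rfl⟩, h2, by simpa using hu, by omega⟩⟩

lemma pt_dvd {F G : MvPolynomial (Fin 2) k} (hF : Prime F) (hG : Prime G) {d e : ℕ}
    (Ψ : K ≃ₐ[k] K) (p : PT F G d e Ψ) : d ∣ e := by
  have hG0 := jj_ne K hG.ne_zero
  have hF0 := jj_ne K hF.ne_zero
  have hP0 := jj_ne K p.hP0
  have hb0 : jj k K p.P0 ^ e / jj k K G ^ p.m ≠ 0 := div_ne_zero (pow_ne_zero _ hP0) (pow_ne_zero _ hG0)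
  have h1 : (Ψ (jj k K F)⁻¹) ^ e = algebraMap k K (p.c ^ e) * (jj k K p.P0 ^ e / jj k K G ^ p.m) ^ d := by
    rw [p.hu, div_pow, mul_pow, div_pow, ← pow_mul, ← pow_mul, ← pow_mul, ← pow_mul, p.hn, _root_.map_pow, mul_comm d p.m, mul_comm d e, mul_div_assoc]
  have h2 := congrArg (fun a => (VP K F hF).v (Ψ.symm a)) h1
  simp only [_root_.map_pow, _root_.map_mul, AlgEquiv.symm_apply_apply, AlgEquiv.commutes] at h2
  have h3 : Ψ.symm (jj k K p.P0 ^ e / jj k K G ^ p.m) ≠ 0 := by simpa using hb0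
  rw [← _root_.map_pow, ZVal.map_pow _ _ (inv_ne_zero hF0), ZVal.map_inv _ _ hF0, VP_self, ZVal.map_mul _ (alg_ne (pow_ne_zero _ p.hc)) (pow_ne_zero _ h3), ZVal.map_const' _ _ (pow_ne_zero _ p.hc),
    ZVal.map_pow _ _ h3, zero_add] at h2
  have : (d : ℤ) ∣ e := ⟨- (VP K F hF).v (Ψ.symm (jj k K p.P0 ^ e / jj k K G ^ p.m)), by linarith⟩
  exact_mod_cast this

/-- equality of degrees and normal form. -/
lemma pt_final {F G : MvPolynomial (Fin 2) k} (hF : Prime F) (hG : Prime G) {d e : ℕ}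
    (hd : F.totalDegree = d) (he : G.totalDegree = e) (hd0 : 0 < d) (he0 : 0 < e) (Ψ : K ≃ₐ[k] K)
    (hΨ : ∀ a, a ∈ RR K F d ↔ Ψ a ∈ RR K G e) : e = d ∧ ∃ p : PT F G d d Ψ, p.n = p.m := by
  obtain ⟨p⟩ := pt_exists hF hG hd he hd0 he0 Ψ hΨ
  obtain ⟨q⟩ := pt_exists hG hF he hd he0 hd0 Ψ.symm (by
    intro a; rw [hΨ, AlgEquiv.apply_symm_apply])
  have : e = d := Nat.dvd_antisymm (pt_dvd hG hF _ q) (pt_dvd hF hG _ p)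
  subst this
  refine ⟨rfl, p, ?_⟩
  have := p.hn
  rw [mul_comm] at this
  exact Nat.eq_of_mul_eq_mul_left hd0 this

end
end Yosh

open MvPolynomial
namespace Yosh
open scoped Polynomial

section
variable {k K : Type} [Field k] [Field K] [Algebra k K]

/-- Pull back of a valuation by an automorphism. -/
def ZVal.comap (V : ZVal k K) (Ψ : K ≃ₐ[k] K) : ZVal k K where
  v a := V.v (Ψ a)
  map_mul' a b ha hb := by rw [_root_.map_mul, V.map_mul (by simpa) (by simpa)]
  map_add' a b ha hb hab := by
    rw [_root_.map_add]
    exact V.map_add' _ _ (by simpa) (by simpa) (by rw [← _root_.map_add]; exact (EmbeddingLike.map_ne_zero_iff (f := Ψ)).mpr hab)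
  map_const' c hc := by rw [AlgEquiv.commutes, V.map_const' c hc]

lemma ZVal.comap_v (V : ZVal k K) (Ψ : K ≃ₐ[k] K) (a : K) : (V.comap Ψ).v a = V.v (Ψ a) := rfl

lemma ZVal.comap_ge (V : ZVal k K) (Ψ : K ≃ₐ[k] K) (a : K) (n : ℤ) : (V.comap Ψ).Ge n a ↔ V.Ge n (Ψ a) := by
  unfold ZVal.Ge
  rw [ZVal.comap_v]
  simp

lemma ge_poly (v : ZVal k K) (φ : MvPolynomial (Fin 2) k →ₐ[k] K) (N : ℕ) (h : ∀ i, v.Ge (-N) (φ (X i)))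
    (A : MvPolynomial (Fin 2) k) (n : ℕ) (hA : A.totalDegree ≤ n) : v.Ge (-(N * n)) (φ A) := by
  rw [← support_sum_monomial_coeff A, _root_.map_sum]
  refine ZVal.Ge.sum _ _ fun s hs => ?_
  have hs' : s.degree ≤ n := (le_totalDegree hs).trans hA
  have hsd : s.degree = s 0 + s 1 := by rw [Finsupp.degree_eq_sum]; simp
  have e : φ (monomial s (coeff s A)) = algebraMap k K (coeff s A) * (φ (X 0) ^ s 0 * φ (X 1) ^ s 1) := by
    rw [monomial_eq, Finsupp.prod_fintype _ _ (by simp), Fin.prod_univ_two, _root_.map_mul, _root_.map_mul, _root_.map_pow, _root_.map_pow]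
    congr 1
    exact φ.commutes _
  rw [e]
  refine ((((h 0).pow (s 0)).mul ((h 1).pow (s 1))).const_mul _).mono ?_
  have : (s 0 + s 1 : ℤ) ≤ n := by rw [hsd] at hs'; exact_mod_cast hs'
  nlinarith [Int.natCast_nonneg N]

lemma ge_poly0 (v : ZVal k K) (φ : MvPolynomial (Fin 2) k →ₐ[k] K) (h : ∀ i, v.Ge 0 (φ (X i)))
    (A : MvPolynomial (Fin 2) k) : v.Ge 0 (φ A) := by
  simpa using ge_poly v φ 0 (by simpa using h) A _ le_rfl
end

section
variable {k K : Type} [Field k] [Field K] [Algebra k K] [Algebra (MvPolynomial (Fin 2) k) K]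
  [IsScalarTower k (MvPolynomial (Fin 2) k) K] [IsFractionRing (MvPolynomial (Fin 2) k) K]

/-- setup for the end game. -/
structure Setup (F G : MvPolynomial (Fin 2) k) (d : ℕ) (Ψ : K ≃ₐ[k] K) where
  hF : Prime F
  hG : Prime G
  hd : F.totalDegree = d
  he : G.totalDegree = d
  hd0 : 3 ≤ d
  hΨ : ∀ a, a ∈ RR K F d ↔ Ψ a ∈ RR K G d
  p : PT F G d d Ψ
  hpn : p.n = p.m

namespace Setup
variable {F G : MvPolynomial (Fin 2) k} {d : ℕ} {Ψ : K ≃ₐ[k] K} (S : Setup F G d Ψ)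
include S

lemma hF0 : jj k K F ≠ 0 := jj_ne K S.hF.ne_zero
lemma hG0 : jj k K G ≠ 0 := jj_ne K S.hG.ne_zero
lemma hΨF0 : Ψ (jj k K F) ≠ 0 := by simpa using S.hF0
lemma hu0 : Ψ (jj k K F)⁻¹ ≠ 0 := by simpa using S.hF0

lemma hΨF : Ψ (jj k K F) = jj k K G ^ S.p.m / (algebraMap k K S.p.c * jj k K S.p.P0 ^ d) := by
  have := S.p.hu
  rw [map_inv₀, S.hpn] at this
  rw [← inv_inv (Ψ (jj k K F)), this, inv_div]

lemma hu_pos (v : ZVal k K) : v.v (Ψ (jj k K F)) = S.p.m * v.v (jj k K G) - d * v.v (jj k K S.p.P0) := by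
  have h1 := jj_ne K S.p.hP0
  have h2 := alg_ne (K := K) S.p.hc
  rw [S.hΨF, ZVal.map_div _ (pow_ne_zero _ S.hG0) (mul_ne_zero h2 (pow_ne_zero _ h1)), ZVal.map_mul _ h2 (pow_ne_zero _ h1), ZVal.map_const' _ _ S.p.hc,
    ZVal.map_pow _ _ h1, ZVal.map_pow _ _ S.hG0]; ring

lemma hvu (v : ZVal k K) : v.v (Ψ (jj k K F)⁻¹) = - v.v (Ψ (jj k K F)) := by
  rw [map_inv₀, ZVal.map_inv _ _ S.hΨF0]

lemma P0_G : (VP K G S.hG).v (jj k K S.p.P0) = 0 := by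
  rcases S.p.hw with ⟨hP, h1, -, -⟩ | ⟨h1, -, -⟩
  · exact VP_zero_of_not_dvd K S.hG _ fun h => h1 (S.hG.associated_of_dvd hP h).symm
  · rw [h1, _root_.map_one, ZVal.map_one]

lemma hm : 1 ≤ S.p.m := by
  rcases S.p.hw with ⟨hP, h1, -, h3⟩ | ⟨h1, -, h3⟩
  · rw [← h3, Nat.one_le_iff_ne_zero]
    intro h0
    rw [totalDegree_eq_zero_iff_eq_C] at h0
    apply hP.not_unit
    rw [h0]
    apply IsUnit.map
    apply IsUnit.mk0
    intro h4
    rw [h4, C_0] at h0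
    exact hP.ne_zero h0
  · omega

lemma hVF : (VP K G S.hG).v (Ψ (jj k K F)) = S.p.m := by
  rw [S.hu_pos, VP_self, S.P0_G]; ring

/-- regularity criterion. -/
lemma reg (v : ZVal k K) (hv : ∀ a ∈ RR K G d, v.Ge 0 a) (h0 : v.v (Ψ (jj k K F)) = 0) (A) : v.Ge 0 (Ψ (jj k K A)) := by
  refine ge_poly0 v ((Ψ : K →ₐ[k] K).comp (jj k K)) (fun i => ?_) A
  have h1 : jj k K (X i) / jj k K F ∈ RR K F d := ⟨X i, 1, by rw [totalDegree_X]; have := S.hd0; omega, by simp⟩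
  have h2 := hv _ ((S.hΨ _).mp h1)
  have e : ((Ψ : K →ₐ[k] K).comp (jj k K)) (X i) = Ψ (jj k K (X i) / jj k K F) * Ψ (jj k K F) := by
    rw [← _root_.map_mul, div_mul_cancel₀ _ S.hF0]; rfl
  rw [e]
  exact h2.mul0 (fun _ => h0.ge)

lemma vQ0 (Q) (hQ : Prime Q) (hQG : ¬ Associated Q G) (hQP : ¬ Q ∣ S.p.P0) : (VP K Q hQ).v (Ψ (jj k K F)) = 0 := by
  rw [S.hu_pos, VP_zero_of_not_dvd K hQ _ hQP, VP_zero_of_not_dvd K hQ _ (fun h => hQG (hQ.associated_of_dvd S.hG h))]; ring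

lemma RQ (Q) (hQ : Prime Q) (hQG : ¬ Associated Q G) : ∀ a ∈ RR K G d, (VP K Q hQ).Ge 0 a :=
  fun a ha => ((mem_RR S.hG S.he a).mp ha).2 Q hQ hQG

lemma RL : ∀ a ∈ RR K G d, (VL k K).Ge 0 a :=
  fun a ha => ((mem_RR S.hG S.he a).mp ha).1

lemma vL0 (h : S.p.P0.totalDegree = S.p.m) : (VL k K).v (Ψ (jj k K F)) = 0 := by
  rw [S.hu_pos, VL_spec k K _ S.hG.ne_zero, VL_spec k K _ S.p.hP0, S.he, h]; ring

lemma wF : S.p.w.v (Ψ (jj k K F)) = -d := by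
  rw [S.p.hval _ S.hF0, VL_spec k K _ S.hF.ne_zero, S.hd]

lemma theta_P (hP : Prime S.p.P0) (hw : S.p.w = VP K S.p.P0 hP) :
    (VP K S.p.P0 hP).Ge (-3) (JJ k (Ψ (jj k K (X 0))) (Ψ (jj k K (X 1)))) := by
  rw [← hw]
  set x := jj k K (X 0) with hx
  set y := jj k K (X 1) with hy
  have hx0 : x ≠ 0 := jjX_ne 0
  have hy0 : y ≠ 0 := jjX_ne 1
  have hy0' : Ψ y ≠ 0 := by simpa using hy0
  have h1 : S.p.w.Ge 0 (Ψ (x / y)) := by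
    intro _
    rw [S.p.hval _ (div_ne_zero hx0 hy0), ZVal.map_div _ hx0 hy0, VL_X, VL_X]; simp
  have h2 : S.p.w.Ge 0 (Ψ y⁻¹) := by
    intro _
    rw [S.p.hval _ (inv_ne_zero hy0), ZVal.map_inv _ _ hy0, VL_X]; simp
  have h3 : S.p.w.v (Ψ y) = -1 := by rw [S.p.hval _ hy0, VL_X]
  have e : JJ k (Ψ x) (Ψ y) = - (Ψ y) ^ 3 * JJ k (Ψ (x / y)) (Ψ y⁻¹) := by
    rw [map_div₀, map_inv₀]
    simp only [JJ, Jac, Derivation.leibniz_div, Derivation.leibniz_inv, smul_eq_mul]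
    field_simp
    ring
  rw [e]
  rw [hw] at h1 h2 h3 ⊢
  have h4 := VP_JJ0 hP _ _ h1 h2
  have h5 : (VP K S.p.P0 hP).Ge (-3) (-(Ψ y) ^ 3) := by
    refine ZVal.Ge.neg (fun _ => ?_)
    rw [ZVal.map_pow _ _ hy0', h3]; norm_num
  exact (h5.mul h4).mono (by norm_num)

lemma homega : (d : ℤ) * (VP K G S.hG).v (JJ k (Ψ (jj k K (X 0))) (Ψ (jj k K (X 1)))) ≤ 3 * (S.p.m - 1) := by
  set θ := JJ k (Ψ (jj k K (X 0))) (Ψ (jj k K (X 1))) with hθ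
  have hθ0 : θ ≠ 0 := theta_ne Ψ
  have hne : θ ^ d * Ψ (jj k K F)⁻¹ ^ 3 * jj k K G ^ 3 ≠ 0 :=
    mul_ne_zero (mul_ne_zero (pow_ne_zero _ hθ0) (pow_ne_zero _ S.hu0)) (pow_ne_zero _ S.hG0)
  have hv : ∀ v : ZVal k K, v.v (θ ^ d * Ψ (jj k K F)⁻¹ ^ 3 * jj k K G ^ 3) = d * v.v θ - 3 * v.v (Ψ (jj k K F)) + 3 * v.v (jj k K G) := by
    intro v
    rw [ZVal.map_mul _ (mul_ne_zero (pow_ne_zero _ hθ0) (pow_ne_zero _ S.hu0)) (pow_ne_zero _ S.hG0), ZVal.map_mul _ (pow_ne_zero _ hθ0) (pow_ne_zero _ S.hu0),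
      ZVal.map_pow _ _ hθ0, ZVal.map_pow _ _ S.hu0, ZVal.map_pow _ _ S.hG0, S.hvu]; push_cast; ring
  have hd0 : (0 : ℤ) ≤ d := by positivity
  have hmem : θ ^ d * Ψ (jj k K F)⁻¹ ^ 3 * jj k K G ^ 3 ∈ RR K G d := by
    rw [mem_RR S.hG S.he]
    constructor
    · intro _
      rw [hv, VL_spec k K _ S.hG.ne_zero, S.he]
      rcases S.p.hw with ⟨hP, h1, h2, h3⟩ | ⟨h1, h2, h3⟩
      · rw [S.vL0 h3]
        have := VL_JJ3 _ _ (S.reg _ S.RL (S.vL0 h3) (X 0)) (S.reg _ S.RL (S.vL0 h3) (X 1)) hθ0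
        rw [← hθ] at this
        nlinarith
      · have h4 := S.wF
        have h5 := S.p.hval (jj k K (X 0)) (jjX_ne 0)
        have h6 := S.p.hval (jj k K (X 1)) (jjX_ne 1)
        rw [h2] at h4 h5 h6
        rw [VL_X] at h5 h6
        have := VL_JJ (k := k) (Ψ (jj k K (X 0))) (Ψ (jj k K (X 1))) (-1) (-1) (fun _ => h5.ge) (fun _ => h6.ge) hθ0
        rw [← hθ] at this
        rw [h4]
        nlinarith
    · intro Q hQ hQG _
      rw [hv, VP_zero_of_not_dvd K hQ G (fun h => hQG (hQ.associated_of_dvd S.hG h))]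
      by_cases hQP : Q ∣ S.p.P0
      · rcases S.p.hw with ⟨hP, h1, h2, h3⟩ | ⟨h1, h2, h3⟩
        · have hass := hQ.associated_of_dvd hP hQP
          rw [VP_assoc K hQ hP hass _ hθ0, VP_assoc K hQ hP hass _ S.hΨF0, ← h2, S.wF]
          have := S.theta_P hP h2 hθ0
          rw [← hθ, ← h2] at this
          nlinarith
        · rw [h1] at hQP
          exact absurd (isUnit_of_dvd_one hQP) hQ.not_unit
      · rw [S.vQ0 Q hQ hQG hQP]
        have h7 := S.reg _ (S.RQ Q hQ hQG) (S.vQ0 Q hQ hQG hQP)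
        have := VP_JJ0 hQ _ _ (h7 (X 0)) (h7 (X 1)) hθ0
        rw [← hθ] at this
        nlinarith
  have := RR_vG S.hG S.he (by have := S.hd0; omega) hmem hne
  rw [hv, S.hVF, VP_self] at this
  linarith

end Setup
end
end Yosh

open MvPolynomial
namespace Yosh
open scoped Polynomial

section
variable {k K : Type} [Field k] [Field K] [Algebra k K] [Algebra (MvPolynomial (Fin 2) k) K]
  [IsScalarTower k (MvPolynomial (Fin 2) k) K] [IsFractionRing (MvPolynomial (Fin 2) k) K]

namespace Setup
variable {F G : MvPolynomial (Fin 2) k} {d : ℕ} {Ψ : K ≃ₐ[k] K} (S : Setup F G d Ψ)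

/-- The core data attached to a setup. -/
noncomputable def core (ε : MvPolynomial (Fin 2) k →ₐ[k] k[X]) (hs : Function.Surjective ε)
    (hk : ∀ A, ε A = 0 ↔ F ∣ A) : Core k K where
  ι := jj k K
  ι_inj := jj_inj k K
  D0 := dd k K 0
  D1 := dd k K 1
  D00 := by rw [dd_jj]; simp
  D01 := by rw [dd_jj, pderiv_X]; simp
  D10 := by rw [dd_jj, pderiv_X]; simp
  D11 := by rw [dd_jj]; simp
  V := (VP K G S.hG).comap Ψ
  VL := VL k K
  VL_spec := VL_spec k K
  ω := (VP K G S.hG).v (JJ k (Ψ (jj k K (X 0))) (Ψ (jj k K (X 1)))) + 1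
  hlog := by
    intro a b ha hb hJ
    have hJ1 : Ψ (JJ k a b) ≠ 0 := (EmbeddingLike.map_ne_zero_iff (f := Ψ)).mpr hJ
    have h := VP_log (k := k) S.hG (Ψ a) (Ψ b) (by simpa) (by simpa)
      (by rw [JJ_chain]; exact mul_ne_zero hJ1 (theta_ne Ψ))
    rw [JJ_chain, ZVal.map_mul _ hJ1 (theta_ne Ψ)] at h
    rw [ZVal.comap_v, ZVal.comap_v, ZVal.comap_v]
    linarith
  F := F
  d := d
  hd := S.hd0
  hdeg := S.hd
  ε := ε
  ε_surj := hs
  ε_ker := hk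
  m := S.p.m
  hm := S.hm
  hvF := S.hVF
  hω := by have := S.homega; rwa [add_sub_cancel_right]

/-- twisting map -/
noncomputable def tw (F G : MvPolynomial (Fin 2) k) (Ψ : K ≃ₐ[k] K) (n b : ℕ) : MvPolynomial (Fin 2) k →ₗ[k] K :=
  (LinearMap.mulLeft k (jj k K F ^ n)).comp ((Ψ.symm : K →ₐ[k] K).toLinearMap.comp
    ((LinearMap.mulRight k (jj k K G ^ b)⁻¹).comp (jj k K).toLinearMap))

lemma tw_apply (n b : ℕ) (A) : tw F G Ψ n b A = jj k K F ^ n * Ψ.symm (jj k K A / jj k K G ^ b) := by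
  rw [div_eq_mul_inv]; rfl

include S in
lemma exists_W : ∃ M : ℕ, 1 ≤ M ∧ ∀ b : ℕ, ∃ W : Submodule k (MvPolynomial (Fin 2) k),
    2 * Module.finrank k W = (b * d + 1) * (b * d + 2) ∧
    ∀ A ∈ W, A.totalDegree ≤ b * M * d ∧ ((VP K G S.hG).comap Ψ).Ge (-b + S.p.m * (b * M)) (jj k K A) := by
  set v' := (VP K F S.hF).comap Ψ.symm with hv'
  set N : ℕ := (v'.v (jj k K (X 0))).natAbs + (v'.v (jj k K (X 1))).natAbs with hN
  have hF0 := S.hF0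
  have hG0 := S.hG0
  have hNi : ∀ i, v'.Ge (-N) (jj k K (X i)) := by
    intro i _
    fin_cases i <;> · simp only [Fin.zero_eta, Fin.mk_one, Fin.isValue]; omega
  refine ⟨d * N + (v'.v (jj k K G)).natAbs + 1, by omega, fun b => ?_⟩
  set M := d * N + (v'.v (jj k K G)).natAbs + 1 with hM
  set T := tw F G Ψ (b * M) b with hT
  have hTinj : Function.Injective T := by
    intro A B h
    rw [hT, tw_apply, tw_apply] at h
    have h1 := Ψ.symm.injective (mul_left_cancel₀ (pow_ne_zero _ hF0) h)
    exact jj_inj k K ((div_left_inj' (pow_ne_zero _ hG0)).mp h1)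
  have hmem : ∀ A : MvPolynomial (Fin 2) k, A.totalDegree ≤ b * d → Ψ.symm (jj k K A / jj k K G ^ b) ∈ RR K F d := by
    intro A hA
    rw [S.hΨ, AlgEquiv.apply_symm_apply]
    exact ⟨A, b, hA, rfl⟩
  have hpoly : ∀ A : MvPolynomial (Fin 2) k, A.totalDegree ≤ b * d → ∃ B, T A = jj k K B := by
    intro A hA
    apply poly_of_VP
    intro Q hQ
    have h1 := (mem_RR S.hF S.hd _).mp (hmem A hA)
    rw [hT, tw_apply]
    by_cases hQF : Associated Q F
    · intro hne
      rw [VP_assoc K hQ S.hF hQF _ hne]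
      revert hne
      change (VP K F S.hF).Ge 0 _
      have h2 : (VP K F S.hF).Ge (-(N * (b * d : ℕ)) - b * v'.v (jj k K G)) (Ψ.symm (jj k K A / jj k K G ^ b)) := by
        rw [← ZVal.comap_ge, ← hv']
        intro hne
        have hA0 : jj k K A ≠ 0 := fun h => hne (by rw [h, zero_div])
        rw [ZVal.map_div _ hA0 (pow_ne_zero _ hG0), ZVal.map_pow _ _ hG0]
        have := ge_poly v' (jj k K) N hNi A _ hA hA0
        linarith
      have h3 : (VP K F S.hF).Ge (b * M : ℕ) (jj k K F ^ (b * M)) := by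
        intro _
        rw [ZVal.map_pow _ _ hF0, VP_self]; simp
      refine (h3.mul h2).mono ?_
      have h4 : v'.v (jj k K G) ≤ (v'.v (jj k K G)).natAbs := by omega
      rw [hM]
      push_cast
      have h5 : (0:ℤ) ≤ b := by positivity
      push_cast at h4
      nlinarith
    · exact ((VP_ge K hQ F).pow0 _).mul0 (h1.2 Q hQ hQF) |> fun h => by simpa using h
  refine ⟨Submodule.comap (jj k K).toLinearMap (Submodule.map T (restrictTotalDegree (Fin 2) k (b * d))), ?_, ?_⟩
  · rw [← finrank_E k (b * d)]
    congr 1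
    have e1 : Submodule.map (jj k K).toLinearMap (Submodule.comap (jj k K).toLinearMap (Submodule.map T (restrictTotalDegree (Fin 2) k (b * d)))) =
        Submodule.map T (restrictTotalDegree (Fin 2) k (b * d)) := by
      apply Submodule.map_comap_eq_self
      rintro _ ⟨A, hA, rfl⟩
      obtain ⟨B, hB⟩ := hpoly A ((mem_restrictTotalDegree _ _ _).mp hA)
      exact ⟨B, hB.symm⟩
    rw [(Submodule.equivMapOfInjective T hTinj (restrictTotalDegree (Fin 2) k (b * d))).finrank_eq]
    have hji : Function.Injective (jj k K).toLinearMap := jj_inj k K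
    refine Eq.trans ?_ (congrArg (fun W : Submodule k K => Module.finrank k W) e1)
    exact (Submodule.equivMapOfInjective (jj k K).toLinearMap hji (Submodule.comap (jj k K).toLinearMap (Submodule.map T (restrictTotalDegree (Fin 2) k (b * d))))).finrank_eq
  · rintro B ⟨A, hA, hB⟩
    have hA' := (mem_restrictTotalDegree _ _ _).mp hA
    have hB' : jj k K B = jj k K F ^ (b * M) * Ψ.symm (jj k K A / jj k K G ^ b) := by
      rw [← tw_apply]; exact hB.symm
    by_cases hB0 : B = 0
    · subst hB0; simp [ZVal.ge_zero]
    have h1 := (mem_RR S.hF S.hd _).mp (hmem A hA')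
    have hx : Ψ.symm (jj k K A / jj k K G ^ b) ≠ 0 := fun h => jj_ne K hB0 (by rw [hB', h, mul_zero])
    constructor
    · have h2 := VL_spec k K B hB0
      rw [hB', ZVal.map_mul _ (pow_ne_zero _ hF0) hx, ZVal.map_pow _ _ hF0, VL_spec k K F S.hF.ne_zero, S.hd] at h2
      have h3 := h1.1 hx
      have : (B.totalDegree : ℤ) ≤ ((b * M * d : ℕ) : ℤ) := by push_cast at h2 ⊢; linarith
      exact_mod_cast this
    · rw [ZVal.comap_ge, hB', _root_.map_mul, AlgEquiv.apply_symm_apply, _root_.map_pow]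
      have h2 : (VP K G S.hG).Ge (S.p.m * (b * M)) (Ψ (jj k K F) ^ (b * M)) := by
        intro _
        rw [ZVal.map_pow _ _ S.hΨF0, S.hVF]; push_cast; linarith
      have h3 : (VP K G S.hG).Ge (-b) (jj k K A / jj k K G ^ b) := by
        intro hne
        have hA0 : jj k K A ≠ 0 := fun h => hne (by rw [h, zero_div])
        rw [ZVal.map_div _ hA0 (pow_ne_zero _ hG0), ZVal.map_pow _ _ hG0, VP_self]
        have := VP_ge K S.hG A hA0
        linarith
      exact (h2.mul h3).mono (by linarith)

include S in
theorem final [IsAlgClosed k] (ε : MvPolynomial (Fin 2) k →ₐ[k] k[X]) (hs : Function.Surjective ε)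
    (hk : ∀ A, ε A = 0 ↔ F ∣ A) : ∃ (ℓ : MvPolynomial (Fin 2) k →ₐ[k] K) (P0 : MvPolynomial (Fin 2) k)
      (A : Fin 2 → MvPolynomial (Fin 2) k) (c : k), Function.Injective ℓ ∧ P0 ≠ 0 ∧ c ≠ 0 ∧ P0.totalDegree ≤ 1 ∧
      (∀ i, (A i).totalDegree ≤ 1) ∧ (∀ i, jj k K (A i) = jj k K P0 * ℓ (X i)) ∧
      ℓ F * jj k K P0 ^ d = algebraMap k K c * jj k K G := by
  obtain ⟨M, hM, hW⟩ := S.exists_W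
  have hone : ∃ a : K, a ≠ 0 ∧ (S.core ε hs hk).V.v a = 1 := by
    refine ⟨Ψ.symm (jj k K G), by simpa using S.hG0, ?_⟩
    change (VP K G S.hG).v (Ψ (Ψ.symm (jj k K G))) = 1
    rw [AlgEquiv.apply_symm_apply, VP_self]
  obtain ⟨hm1, τ, hτi, hτF, hτV, hτ0, hτ1, hτw⟩ := (S.core ε hs hk).main (frac k) hone M hM hW
  change S.p.m = 1 at hm1
  change τ F = jj k K F at hτF
  change ∀ A, ((VP K G S.hG).comap Ψ).Ge 0 (τ A) at hτV
  change (VL k K).Ge (-1) _ at hτ0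
  change (VL k K).Ge (-1) _ at hτ1
  change ∀ w : ZVal k K, (∀ A, w.Ge 0 (jj k K A)) → w.v (jj k K F) = 0 → ∀ A, w.Ge 0 (τ A) at hτw
  have hτL : ∀ i, (VL k K).Ge (-1) (τ (X i)) := by
    intro i
    fin_cases i
    · exact hτ0
    · exact hτ1
  have hreg : ∀ v : ZVal k K, (∀ a ∈ RR K G d, v.Ge 0 a) → v.v (Ψ (jj k K F)) = 0 → ∀ A, v.Ge 0 (Ψ (τ A)) := by
    intro v hv h0 A
    rw [← ZVal.comap_ge]
    refine hτw (v.comap Ψ) (fun B => ?_) h0 A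
    rw [ZVal.comap_ge]
    exact S.reg v hv h0 B
  have hwL : ∀ i, S.p.w.Ge (-1) (Ψ (τ (X i))) := by
    intro i hne
    have h0 : τ (X i) ≠ 0 := fun h => hne (by rw [h, map_zero])
    rw [S.p.hval _ h0]
    exact hτL i h0
  have hP00 := jj_ne K S.p.hP0
  have hpoly : ∀ i, ∃ A, jj k K S.p.P0 * Ψ (τ (X i)) = jj k K A := by
    intro i
    apply poly_of_VP
    intro Q hQ
    by_cases hQG : Associated Q G
    · intro hne
      rw [VP_assoc K hQ S.hG hQG _ hne]
      revert hne
      change (VP K G S.hG).Ge 0 _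
      exact (VP_ge K S.hG _).mul0 ((ZVal.comap_ge _ _ _ _).mp (hτV _))
    by_cases hQP : Q ∣ S.p.P0
    · rcases S.p.hw with ⟨hP, h1, h2, h3⟩ | ⟨h1, h2, h3⟩
      · intro hne
        rw [VP_assoc K hQ hP (hQ.associated_of_dvd hP hQP) _ hne]
        revert hne
        change (VP K S.p.P0 hP).Ge 0 _
        have h4 := hwL i
        rw [h2] at h4
        have h5 : (VP K S.p.P0 hP).Ge 1 (jj k K S.p.P0) := fun _ => (VP_self K hP).ge
        exact (h5.mul h4).mono (by norm_num)
      · rw [h1] at hQP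
        exact absurd (isUnit_of_dvd_one hQP) hQ.not_isUnit
    · exact (VP_ge K hQ _).mul0 (hreg _ (S.RQ Q hQ hQG) (S.vQ0 Q hQ hQG hQP) _)
  choose A hA using hpoly
  have hPd : S.p.P0.totalDegree ≤ 1 := by
    rcases S.p.hw with ⟨hP, h1, h2, h3⟩ | ⟨h1, h2, h3⟩
    · omega
    · rw [h1]; simp
  refine ⟨(Ψ : K →ₐ[k] K).comp τ, S.p.P0, A, S.p.c⁻¹, ?_, S.p.hP0, inv_ne_zero S.p.hc, hPd, ?_, fun i => (hA i).symm, ?_⟩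
  · exact Ψ.injective.comp hτi
  · intro i
    have h : (VL k K).Ge (-1) (jj k K (A i)) := by
      rw [← hA i]
      rcases S.p.hw with ⟨hP, h1, h2, h3⟩ | ⟨h1, h2, h3⟩
      · have h4 : (VL k K).Ge (-1) (jj k K S.p.P0) := by
          intro _
          rw [VL_spec k K _ S.p.hP0, h3, hm1]; simp
        exact (h4.mul (hreg _ S.RL (S.vL0 h3) _)).mono (by norm_num)
      · rw [h1, _root_.map_one, one_mul, ← h2]
        exact hwL i
    by_cases h0 : A i = 0
    · rw [h0]; simp
    have := h (jj_ne K h0)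
    rw [VL_spec k K _ h0] at this
    omega
  · change Ψ (τ F) * _ = _
    have hc := alg_ne (K := K) S.p.hc
    rw [hτF, S.hΨF, hm1, map_inv₀]
    field_simp

end Setup
end
end Yosh

open MvPolynomial
namespace Yosh
open scoped Polynomial

section
variable {k : Type} [Field k]

/-- dehomogenization -/
noncomputable def dh : MvPolynomial (Fin 3) k →ₐ[k] MvPolynomial (Fin 2) k := aeval ![(X 0 : MvPolynomial (Fin 2) k), X 1, 1]

/-- homogenization of degree `n` -/
noncomputable def hz (n : ℕ) : MvPolynomial (Fin 2) k →ₗ[k] MvPolynomial (Fin 3) k :=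
  (basisMonomials (Fin 2) k).constr k (fun s => X 0 ^ s 0 * X 1 ^ s 1 * X 2 ^ (n - (s 0 + s 1)))

lemma hz_monomial (n : ℕ) (s : Fin 2 →₀ ℕ) (c : k) :
    hz n (monomial s c) = C c * (X 0 ^ s 0 * X 1 ^ s 1 * X 2 ^ (n - (s 0 + s 1))) := by
  have : monomial s c = c • (basisMonomials (Fin 2) k) s := by
    rw [coe_basisMonomials, smul_monomial]; simp
  rw [this, _root_.map_smul, hz, Module.Basis.constr_basis, smul_eq_C_mul]

lemma mon2 (s : Fin 2 →₀ ℕ) (c : k) : monomial s c = C c * (X 0 ^ s 0 * X 1 ^ s 1) := by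
  rw [monomial_eq, Finsupp.prod_fintype _ _ (by simp), Fin.prod_univ_two]

lemma mon3 (s : Fin 3 →₀ ℕ) (c : k) : monomial s c = C c * (X 0 ^ s 0 * X 1 ^ s 1 * X 2 ^ s 2) := by
  rw [monomial_eq, Finsupp.prod_fintype _ _ (by simp), Fin.prod_univ_three]

lemma dh_C (c : k) : dh (C c) = C c := by rw [dh, aeval_C]; rfl
lemma dh_X0 : dh (X 0 : MvPolynomial (Fin 3) k) = X 0 := by simp [dh]
lemma dh_X1 : dh (X 1 : MvPolynomial (Fin 3) k) = X 1 := by simp [dh]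
lemma dh_X2 : dh (X 2 : MvPolynomial (Fin 3) k) = 1 := by simp [dh]

lemma sum_mon {σ : Type} (A : MvPolynomial σ k) : A = ∑ s ∈ A.support, monomial s (coeff s A) := (support_sum_monomial_coeff A).symm

lemma dh_hz (n : ℕ) (A : MvPolynomial (Fin 2) k) : dh (hz n A) = A := by
  induction A using MvPolynomial.induction_on' with
  | monomial s c =>
    rw [hz_monomial, mon2]
    simp only [_root_.map_mul, _root_.map_pow, dh_C, dh_X0, dh_X1, dh_X2, one_pow, mul_one]
  | add p q hp hq => rw [_root_.map_add, _root_.map_add, hp, hq]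

lemma deg2 (s : Fin 2 →₀ ℕ) : s.degree = s 0 + s 1 := by rw [Finsupp.degree_eq_sum]; simp
lemma deg3 (s : Fin 3 →₀ ℕ) : s.degree = s 0 + s 1 + s 2 := by rw [Finsupp.degree_eq_sum, Fin.sum_univ_three]

lemma dh_mon (s : Fin 3 →₀ ℕ) (c : k) : dh (monomial s c) = monomial (Finsupp.single 0 (s 0) + Finsupp.single 1 (s 1)) c := by
  rw [mon3, mon2]
  simp [dh_C, dh_X0, dh_X1, dh_X2]

lemma hz_dh {n : ℕ} {a : MvPolynomial (Fin 3) k} (ha : a.IsHomogeneous n) : hz n (dh a) = a := by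
  conv_lhs => rw [sum_mon a]
  conv_rhs => rw [sum_mon a]
  rw [_root_.map_sum, _root_.map_sum]
  refine Finset.sum_congr rfl fun s hs => ?_
  have h := ha.degree_eq_sum_deg_support hs
  have h' : s 0 + s 1 + s 2 = n := by
    rw [← deg3]; exact h.symm
  rw [dh_mon, hz_monomial, mon3]
  simp
  left
  congr 1
  omega

lemma dh_eq_zero {n : ℕ} {a : MvPolynomial (Fin 3) k} (ha : a.IsHomogeneous n) (h : dh a = 0) : a = 0 := by
  rw [← hz_dh ha, h, map_zero]

lemma dh_inj {n : ℕ} {a b : MvPolynomial (Fin 3) k} (ha : a.IsHomogeneous n) (hb : b.IsHomogeneous n) (h : dh a = dh b) : a = b := by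
  rw [← hz_dh ha, h, hz_dh hb]

lemma dh_deg {n : ℕ} {a : MvPolynomial (Fin 3) k} (ha : a.IsHomogeneous n) : (dh a).totalDegree ≤ n := by
  rw [sum_mon a, _root_.map_sum]
  refine totalDegree_finsetSum_le fun s hs => ?_
  have h' : s 0 + s 1 + s 2 = n := by
    rw [← deg3]; exact (ha.degree_eq_sum_deg_support hs).symm
  rw [dh_mon]
  refine (totalDegree_monomial_le _ _).trans ?_
  change Finsupp.degree _ ≤ n
  rw [deg2]
  simp
  omega

lemma hz_hom {n : ℕ} {A : MvPolynomial (Fin 2) k} (hA : A.totalDegree ≤ n) : (hz n A).IsHomogeneous n := by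
  rw [sum_mon A, _root_.map_sum]
  refine IsHomogeneous.sum _ _ _ fun s hs => ?_
  have hs' : s 0 + s 1 ≤ n := by rw [← deg2]; exact (le_totalDegree hs).trans hA
  rw [hz_monomial]
  apply IsHomogeneous.C_mul
  have := ((isHomogeneous_X_pow (R := k) (0 : Fin 3) (s 0)).mul (isHomogeneous_X_pow (R := k) (1 : Fin 3) (s 1))).mul
    (isHomogeneous_X_pow (R := k) (2 : Fin 3) (n - (s 0 + s 1)))
  convert this using 1
  omega

lemma hz_succ {n : ℕ} {A : MvPolynomial (Fin 2) k} (hA : A.totalDegree ≤ n) : hz (n + 1) A = X 2 * hz n A := by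
  rw [sum_mon A, _root_.map_sum, _root_.map_sum, Finset.mul_sum]
  refine Finset.sum_congr rfl fun s hs => ?_
  have hs' : s 0 + s 1 ≤ n := by rw [← deg2]; exact (le_totalDegree hs).trans hA
  rw [hz_monomial, hz_monomial, Nat.succ_sub hs', pow_succ]
  ring

lemma dh_deg_eq {n : ℕ} {a : MvPolynomial (Fin 3) k} (ha : a.IsHomogeneous n) (h : ¬ X 2 ∣ a) : (dh a).totalDegree = n := by
  refine le_antisymm (dh_deg ha) ?_
  by_contra hlt
  push Not at hlt
  obtain ⟨m, rfl⟩ : ∃ m, n = m + 1 := ⟨n - 1, by omega⟩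
  apply h
  rw [← hz_dh ha, hz_succ (by omega)]
  exact Dvd.intro _ rfl

lemma dh_irr {n : ℕ} {a : MvPolynomial (Fin 3) k} (ha : a.IsHomogeneous n) (h : ¬ X 2 ∣ a) (hi : Irreducible a) (hn : 0 < n) :
    Irreducible (dh a) := by
  constructor
  · intro hu
    have h1 := dh_deg_eq ha h
    obtain ⟨c, hc, e⟩ := isUnit_iff_eq_C_of_isReduced.mp hu
    rw [e, totalDegree_C] at h1
    omega
  · intro A B hAB
    have h0 : dh a ≠ 0 := fun h0 => hi.ne_zero (dh_eq_zero ha h0)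
    rw [hAB] at h0
    have h1 := dh_deg_eq ha h
    rw [hAB, totalDegree_mul_of_isDomain (left_ne_zero_of_mul h0) (right_ne_zero_of_mul h0)] at h1
    have h2 := (hz_hom (le_refl A.totalDegree)).mul (hz_hom (le_refl B.totalDegree))
    rw [h1] at h2
    have h3 : a = hz A.totalDegree A * hz B.totalDegree B := by
      apply dh_inj ha h2
      rw [_root_.map_mul, dh_hz, dh_hz, hAB]
    rcases hi.isUnit_or_isUnit h3 with h4 | h4
    · left; have := h4.map (dh (k := k)); rwa [dh_hz] at this
    · right; have := h4.map (dh (k := k)); rwa [dh_hz] at this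

/-- linear substitution -/
noncomputable def sb (M : Matrix (Fin 3) (Fin 3) k) : MvPolynomial (Fin 3) k →ₐ[k] MvPolynomial (Fin 3) k :=
  aeval (fun i => ∑ j, C (M i j) * X j)

lemma sb_X (M : Matrix (Fin 3) (Fin 3) k) (i) : sb M (X i) = ∑ j, C (M i j) * X j := by rw [sb, aeval_X]

lemma sb_sb (M N : Matrix (Fin 3) (Fin 3) k) (a) : sb N (sb M a) = sb (M * N) a := by
  have : (sb N).comp (sb M) = sb (M * N) := by
    apply algHom_ext
    intro i
    rw [AlgHom.comp_apply, sb_X, sb_X, _root_.map_sum]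
    simp only [_root_.map_mul, sb_X, Matrix.mul_apply, _root_.map_sum, Finset.sum_mul, Finset.mul_sum]
    rw [Finset.sum_comm]
    refine Finset.sum_congr rfl fun j _ => Finset.sum_congr rfl fun l _ => ?_
    have : sb N (C (M i l)) = C (M i l) := (sb N).commutes _
    rw [this]; ring
  exact DFunLike.congr_fun this a

lemma sb_one (a) : sb (1 : Matrix (Fin 3) (Fin 3) k) a = a := by
  have : sb (1 : Matrix (Fin 3) (Fin 3) k) = AlgHom.id k _ := by
    apply algHom_ext
    intro i
    rw [sb_X]
    simp [Matrix.one_apply]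
  rw [this]; rfl

lemma sb_hom (M : Matrix (Fin 3) (Fin 3) k) {a} {n : ℕ} (ha : a.IsHomogeneous n) : (sb M a).IsHomogeneous n := by
  have := ha.aeval (S := k) (fun i => ∑ j, C (M i j) * X j) (n := 1) fun i =>
    IsHomogeneous.sum _ _ _ fun j _ => isHomogeneous_C_mul_X _ _
  rw [one_mul] at this
  exact this

/-- linear automorphism. -/
noncomputable def sbE (M N : Matrix (Fin 3) (Fin 3) k) (h : M * N = 1) : MvPolynomial (Fin 3) k ≃ₐ[k] MvPolynomial (Fin 3) k :=
  AlgEquiv.ofAlgHom (sb M) (sb N)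
    (by ext1 i; rw [AlgHom.comp_apply, sb_sb, mul_eq_one_comm.mp h, sb_one]; rfl)
    (by ext1 i; rw [AlgHom.comp_apply, sb_sb, h, sb_one]; rfl)

lemma sb_irr {M : Matrix (Fin 3) (Fin 3) k} (hM : IsUnit M.det) {a} (ha : Irreducible a) : Irreducible (sb M a) := by
  have := (MulEquiv.irreducible_iff (sbE M M⁻¹ (Matrix.mul_nonsing_inv M hM)) (x := a)).mpr ha
  exact this

lemma sb_inj {M : Matrix (Fin 3) (Fin 3) k} (hM : IsUnit M.det) : Function.Injective (sb M) :=
  (sbE M M⁻¹ (Matrix.mul_nonsing_inv M hM)).injective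

/-- equivalence under linear change -/
def PE (f g : MvPolynomial (Fin 3) k) : Prop := ∃ N : Matrix (Fin 3) (Fin 3) k, IsUnit N.det ∧ ∃ c : kˣ, sb N f = (c : k) • g

lemma PE.symm {f g : MvPolynomial (Fin 3) k} (h : PE f g) : PE g f := by
  obtain ⟨N, hN, c, e⟩ := h
  refine ⟨N⁻¹, by rw [Matrix.det_nonsing_inv]; simpa using hN, c⁻¹, ?_⟩
  have := congrArg (sb N⁻¹) e
  rw [sb_sb, Matrix.mul_nonsing_inv N hN, sb_one, _root_.map_smul] at this
  rw [this, smul_smul]; simp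

lemma PE.trans {f g h : MvPolynomial (Fin 3) k} (h1 : PE f g) (h2 : PE g h) : PE f h := by
  obtain ⟨N, hN, c, e⟩ := h1
  obtain ⟨M, hM, c', e'⟩ := h2
  refine ⟨N * M, by rw [Matrix.det_mul]; exact hN.mul hM, c * c', ?_⟩
  rw [← sb_sb, e, _root_.map_smul, e', smul_smul]; simp

lemma PE.sb {f : MvPolynomial (Fin 3) k} {M : Matrix (Fin 3) (Fin 3) k} (hM : IsUnit M.det) : PE f (sb M f) :=
  ⟨M, hM, 1, by simp⟩

end
end Yosh

open MvPolynomial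
attribute [local instance] MvPolynomial.gradedAlgebra
namespace Yosh
open scoped Polynomial

lemma ext_equiv {k K A B : Type} [Field k] [Field K] [Algebra k K] [CommRing A] [CommRing B] [Algebra k A] [Algebra k B]
    (i : A →ₐ[k] K) (j : B →ₐ[k] K) (hi : Function.Injective i) (hj : Function.Injective j)
    (hfi : ∀ x : K, ∃ a b, x = i a / i b) (hfj : ∀ x : K, ∃ a b, x = j a / j b) (e : A ≃ₐ[k] B) :
    ∃ Ψ : K ≃ₐ[k] K, ∀ a, Ψ (i a) = j (e a) := by
  have : IsDomain A := hi.isDomain i.toRingHom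
  let _ : Algebra A K := i.toRingHom.toAlgebra
  have : IsScalarTower k A K := IsScalarTower.of_algebraMap_eq fun c => (i.commutes c).symm
  have : FaithfulSMul A K := (faithfulSMul_iff_algebraMap_injective A K).mpr hi
  have : IsFractionRing A K := IsFractionRing.of_field A K hfi
  have hinj : Function.Injective (j.comp (e : A →ₐ[k] B)) := hj.comp e.injective
  set Ψ0 : K →ₐ[k] K := IsFractionRing.liftAlgHom (g := j.comp (e : A →ₐ[k] B)) hinj with hΨ0
  have h0 : ∀ a, Ψ0 (i a) = j (e a) := by
    intro a
    exact IsFractionRing.lift_algebraMap (A := A) (K := K) (g := (j.comp (e : A →ₐ[k] B)).toRingHom) hinj a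
  have hb : Function.Bijective Ψ0 := by
    refine ⟨Ψ0.toRingHom.injective, fun x => ?_⟩
    obtain ⟨a, b, rfl⟩ := hfj x
    refine ⟨i (e.symm a) / i (e.symm b), ?_⟩
    rw [map_div₀, h0, h0, AlgEquiv.apply_symm_apply, AlgEquiv.apply_symm_apply]
  exact ⟨AlgEquiv.ofBijective Ψ0 hb, h0⟩

section
variable {k K : Type} [Field k] [Field K] [Algebra k K]

/-- evaluation of fractions -/
noncomputable def th (φ : MvPolynomial (Fin 3) k →ₐ[k] K) (f : MvPolynomial (Fin 3) k) (h : φ f ≠ 0) : AwayRing k f →ₐ[k] K where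
  __ := (IsLocalization.Away.lift (S := Localization.Away f) f (g := φ.toRingHom) (IsUnit.mk0 _ h)).comp
    (algebraMap (AwayRing k f) (Localization.Away f))
  commutes' c := by
    change IsLocalization.Away.lift (S := Localization.Away f) f (g := φ.toRingHom) (IsUnit.mk0 _ h)
      (HomogeneousLocalization.val (algebraMap k (AwayRing k f) c)) = _
    have : HomogeneousLocalization.val (algebraMap k (AwayRing k f) c) = algebraMap (MvPolynomial (Fin 3) k) (Localization.Away f) (C c) := by
      rw [← Localization.mk_one_eq_algebraMap]; rfl
    rw [this, IsLocalization.Away.lift_eq]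
    exact φ.commutes c

lemma th_mk (φ : MvPolynomial (Fin 3) k →ₐ[k] K) (f : MvPolynomial (Fin 3) k) (h : φ f ≠ 0) {d : ℕ}
    (hf : f ∈ homogeneousSubmodule (Fin 3) k d) (n : ℕ) (a) (ha : a ∈ homogeneousSubmodule (Fin 3) k (n • d)) :
    th φ f h (HomogeneousLocalization.Away.mk _ hf n a ha) = φ a / φ f ^ n := by
  change IsLocalization.Away.lift (S := Localization.Away f) f (g := φ.toRingHom) (IsUnit.mk0 _ h)
      (HomogeneousLocalization.val (HomogeneousLocalization.Away.mk _ hf n a ha)) = _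
  rw [HomogeneousLocalization.Away.val_mk, eq_div_iff (pow_ne_zero _ h)]
  have e : φ f ^ n = IsLocalization.Away.lift (S := Localization.Away f) f (g := φ.toRingHom) (IsUnit.mk0 _ h)
      (algebraMap (MvPolynomial (Fin 3) k) (Localization.Away f) (f ^ n)) := by
    rw [IsLocalization.Away.lift_eq]; exact (_root_.map_pow φ f n).symm
  rw [e, ← _root_.map_mul, ← Localization.mk_one_eq_algebraMap, Localization.mk_mul]
  have e2 : (Localization.mk (a * f ^ n) (⟨f ^ n, ⟨n, rfl⟩⟩ * 1) : Localization.Away f) = algebraMap (MvPolynomial (Fin 3) k) (Localization.Away f) a := by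
    rw [← Localization.mk_one_eq_algebraMap, Localization.mk_eq_mk_iff, Localization.r_iff_exists]
    exact ⟨1, by simp; ring⟩
  rw [e2, IsLocalization.Away.lift_eq]; rfl
end

section
variable {k K : Type} [Field k] [Field K] [Algebra k K] [Algebra (MvPolynomial (Fin 2) k) K]
  [IsScalarTower k (MvPolynomial (Fin 2) k) K] [IsFractionRing (MvPolynomial (Fin 2) k) K]

lemma th_range {f : MvPolynomial (Fin 3) k} {d : ℕ} (hf : f.IsHomogeneous d) {M : Matrix (Fin 3) (Fin 3) k} (hM : IsUnit M.det)
    (h : ((jj k K).comp (dh.comp (sb M))) f ≠ 0) (x : K) :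
    x ∈ RR K (dh (sb M f)) d ↔ ∃ a, th ((jj k K).comp (dh.comp (sb M))) f h a = x := by
  have hf' : f ∈ homogeneousSubmodule (Fin 3) k d := (mem_homogeneousSubmodule _ _).mpr hf
  constructor
  · rintro ⟨A, n, hA, rfl⟩
    have h1 := hz_hom hA
    refine ⟨HomogeneousLocalization.Away.mk _ hf' n (sb M⁻¹ (hz (n * d) A)) ((mem_homogeneousSubmodule _ _).mpr (by rw [smul_eq_mul]; exact sb_hom _ h1)), ?_⟩
    rw [th_mk]
    change jj k K (dh (sb M (sb M⁻¹ _))) / _ = _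
    rw [sb_sb, Matrix.nonsing_inv_mul M hM, sb_one, dh_hz]; rfl
  · rintro ⟨a, rfl⟩
    obtain ⟨n, a, ha, rfl⟩ := HomogeneousLocalization.Away.mk_surjective (homogeneousSubmodule (Fin 3) k) hf' a
    rw [th_mk]
    exact ⟨dh (sb M a), n, dh_deg (sb_hom M ha), rfl⟩

lemma th_inj {f : MvPolynomial (Fin 3) k} {d : ℕ} (hf : f.IsHomogeneous d) {M : Matrix (Fin 3) (Fin 3) k} (hM : IsUnit M.det)
    (h : ((jj k K).comp (dh.comp (sb M))) f ≠ 0) : Function.Injective (th ((jj k K).comp (dh.comp (sb M))) f h) := by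
  have hf' : f ∈ homogeneousSubmodule (Fin 3) k d := (mem_homogeneousSubmodule _ _).mpr hf
  rw [injective_iff_map_eq_zero]
  intro a
  obtain ⟨n, a, ha, rfl⟩ := HomogeneousLocalization.Away.mk_surjective (homogeneousSubmodule (Fin 3) k) hf' a
  rw [th_mk, div_eq_zero_iff]
  rintro (h1 | h1)
  · have h2 : dh (sb M a) = 0 := jj_inj k K (by rw [map_zero]; exact h1)
    have h3 := sb_inj hM ((dh_eq_zero (sb_hom M ha) h2).trans (map_zero _).symm)
    subst h3
    apply HomogeneousLocalization.val_injective
    rw [HomogeneousLocalization.Away.val_mk, Localization.mk_zero, HomogeneousLocalization.val_zero]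
  · exact absurd h1 (pow_ne_zero _ h)

lemma exists_Psi {f g : MvPolynomial (Fin 3) k} {d e : ℕ} (hf : f.IsHomogeneous d) (hg : g.IsHomogeneous e) (hd : 0 < d) (he : 0 < e)
    (hf0 : f ≠ 0) (hg0 : g ≠ 0)
    {M M' : Matrix (Fin 3) (Fin 3) k} (hM : IsUnit M.det) (hM' : IsUnit M'.det) (hiso : Nonempty (AwayRing k f ≃ₐ[k] AwayRing k g)) :
    ∃ Ψ : K ≃ₐ[k] K, ∀ a, a ∈ RR K (dh (sb M f)) d ↔ Ψ a ∈ RR K (dh (sb M' g)) e := by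
  obtain ⟨φ⟩ := hiso
  have hF : dh (sb M f) ≠ 0 := fun h => hf0 (sb_inj hM ((dh_eq_zero (sb_hom M hf) h).trans (map_zero _).symm))
  have hG : dh (sb M' g) ≠ 0 := fun h => hg0 (sb_inj hM' ((dh_eq_zero (sb_hom M' hg) h).trans (map_zero _).symm))
  have h1 : ((jj k K).comp (dh.comp (sb M))) f ≠ 0 := jj_ne K hF
  have h2 : ((jj k K).comp (dh.comp (sb M'))) g ≠ 0 := jj_ne K hG
  obtain ⟨Ψ, hΨ⟩ := ext_equiv (th _ f h1) (th _ g h2) (th_inj hf hM h1) (th_inj hg hM' h2) (by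
    intro x
    obtain ⟨b, c, hb, hc, -, rfl⟩ := frac_RR (dh (sb M f)) hF hd x
    obtain ⟨b', rfl⟩ := (th_range hf hM h1 b).mp hb
    obtain ⟨c', rfl⟩ := (th_range hf hM h1 c).mp hc
    exact ⟨b', c', rfl⟩) (by
    intro x
    obtain ⟨b, c, hb, hc, -, rfl⟩ := frac_RR (dh (sb M' g)) hG he x
    obtain ⟨b', rfl⟩ := (th_range hg hM' h2 b).mp hb
    obtain ⟨c', rfl⟩ := (th_range hg hM' h2 c).mp hc
    exact ⟨b', c', rfl⟩) φ
  refine ⟨Ψ, fun a => ?_⟩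
  rw [th_range hf hM h1, th_range hg hM' h2]
  constructor
  · rintro ⟨b, rfl⟩
    exact ⟨φ b, (hΨ b).symm⟩
  · rintro ⟨b, hb⟩
    refine ⟨φ.symm b, Ψ.injective ?_⟩
    rw [hΨ, AlgEquiv.apply_symm_apply, hb]

end
end Yosh

open MvPolynomial
attribute [local instance] MvPolynomial.gradedAlgebra
namespace Yosh
open scoped Polynomial

section
variable {k : Type} [Field k]

lemma lin_form {a : MvPolynomial (Fin 3) k} (ha : a.IsHomogeneous 1) : ∃ v : Fin 3 → k, a = ∑ j, C (v j) * X j := by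
  have h := (mem_homogeneousSubmodule 1 a).mpr ha
  rw [homogeneousSubmodule_one_eq_span_X, Submodule.mem_span_range_iff_exists_fun] at h
  obtain ⟨v, hv⟩ := h
  exact ⟨v, by rw [← hv]; simp only [smul_eq_C_mul]⟩

lemma hom_lin (v : Fin 3 → k) : (∑ j, C (v j) * X j : MvPolynomial (Fin 3) k).IsHomogeneous 1 :=
  IsHomogeneous.sum _ _ _ fun j _ => isHomogeneous_C_mul_X _ _

lemma lin_zero {v : Fin 3 → k} (h : (∑ j, C (v j) * X j : MvPolynomial (Fin 3) k) = 0) : v = 0 := by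
  funext i
  have := congrArg (fun p => eval (Pi.single i 1) p) h
  simpa [Pi.single_apply] using this

lemma not_unit_hom {a : MvPolynomial (Fin 3) k} {n : ℕ} (ha : a.IsHomogeneous n) (hn : 0 < n) : ¬ IsUnit a := by
  intro hu
  obtain ⟨c, hc, e⟩ := isUnit_iff_eq_C_of_isReduced.mp hu
  have h1 := ha.totalDegree hu.ne_zero
  rw [e, totalDegree_C] at h1
  omega

lemma hom_pos {a : MvPolynomial (Fin 3) k} {n : ℕ} (ha : a.IsHomogeneous n) (hi : Irreducible a) : 0 < n := by
  by_contra h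
  obtain rfl : n = 0 := by omega
  have h1 := ha.totalDegree hi.ne_zero
  rw [totalDegree_eq_zero_iff_eq_C] at h1
  apply hi.not_isUnit
  rw [h1]
  apply IsUnit.map
  apply IsUnit.mk0
  intro h2
  rw [h2, C_0] at h1
  exact hi.ne_zero h1

lemma X2_prime : Prime (X 2 : MvPolynomial (Fin 3) k) := X_prime

lemma not_X2_dvd_X0 : ¬ (X 2 : MvPolynomial (Fin 3) k) ∣ X 0 := by
  rintro ⟨q, hq⟩
  have := congrArg (fun p => eval (Pi.single 0 1) p) hq
  simp at this

lemma exists_M (g : MvPolynomial (Fin 3) k) (hg : Irreducible g) : ∃ M : Matrix (Fin 3) (Fin 3) k, IsUnit M.det ∧ ¬ X 2 ∣ sb M g := by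
  by_cases h : X 2 ∣ g
  · have ha := X2_prime.irreducible.associated_of_dvd hg h
    refine ⟨!![0,0,1;0,1,0;1,0,0], by simp [Matrix.det_fin_three], ?_⟩
    intro h2
    have h3 := (ha.map (sb (k := k) !![0,0,1;0,1,0;1,0,0])).symm
    have h4 := h3.dvd_iff_dvd_right.mp h2
    rw [sb_X, Fin.sum_univ_three] at h4
    simp at h4
  · exact ⟨1, by simp, by rwa [sb_one]⟩

lemma line_not_dvd {f : MvPolynomial (Fin 3) k} (hf : Irreducible f)
    (h : Nonempty ((MvPolynomial (Fin 2) k ⧸ Ideal.span {dh f}) ≃ₐ[k] k[X])) : ¬ X 2 ∣ f := by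
  intro h2
  have ha := X2_prime.irreducible.associated_of_dvd hf h2
  have h3 := ha.map (dh (k := k))
  rw [dh_X2] at h3
  have h4 : IsUnit (dh f) := h3.isUnit isUnit_one
  obtain ⟨e⟩ := h
  have : Subsingleton (MvPolynomial (Fin 2) k ⧸ Ideal.span {dh f}) := by
    rw [Ideal.Quotient.subsingleton_iff, Ideal.span_singleton_eq_top]; exact h4
  have : Subsingleton k[X] := e.symm.injective.subsingleton
  exact not_subsingleton k[X] this

lemma exists_eps {F : MvPolynomial (Fin 2) k} (h : Nonempty ((MvPolynomial (Fin 2) k ⧸ Ideal.span {F}) ≃ₐ[k] k[X])) :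
    ∃ ε : MvPolynomial (Fin 2) k →ₐ[k] k[X], Function.Surjective ε ∧ ∀ A, ε A = 0 ↔ F ∣ A := by
  obtain ⟨e⟩ := h
  refine ⟨e.toAlgHom.comp (Ideal.Quotient.mkₐ k (Ideal.span {F})), ?_, ?_⟩
  · exact e.surjective.comp (Ideal.Quotient.mkₐ_surjective k _)
  · intro A
    change e (Ideal.Quotient.mk _ A) = 0 ↔ _
    rw [EmbeddingLike.map_eq_zero_iff, Ideal.Quotient.eq_zero_iff_mem, Ideal.mem_span_singleton]

end

section
variable {k K : Type} [Field k] [Field K] [Algebra k K] [Algebra (MvPolynomial (Fin 2) k) K]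
  [IsScalarTower k (MvPolynomial (Fin 2) k) K] [IsFractionRing (MvPolynomial (Fin 2) k) K]

lemma finish {f g : MvPolynomial (Fin 3) k} {d : ℕ} (hf : f.IsHomogeneous d) (hg : g.IsHomogeneous d)
    (ℓ : MvPolynomial (Fin 2) k →ₐ[k] K) (P0 : MvPolynomial (Fin 2) k)
      (A : Fin 2 → MvPolynomial (Fin 2) k) (c : k) (hℓ : Function.Injective ℓ) (hP0 : P0 ≠ 0) (hc : c ≠ 0) (hP : P0.totalDegree ≤ 1)
      (hA : ∀ i, (A i).totalDegree ≤ 1) (hAP : ∀ i, jj k K (A i) = jj k K P0 * ℓ (X i))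
      (hF : ℓ (dh f) * jj k K P0 ^ d = algebraMap k K c * jj k K (dh g)) : PE f g := by
  obtain ⟨v0, h0⟩ := lin_form (hz_hom (hA 0))
  obtain ⟨v1, h1⟩ := lin_form (hz_hom (hA 1))
  obtain ⟨v2, h2⟩ := lin_form (hz_hom hP)
  set N : Matrix (Fin 3) (Fin 3) k := Matrix.of ![v0, v1, v2] with hN
  have e0 : dh (sb N (X 0)) = A 0 := by rw [← dh_hz 1 (A 0), h0, sb_X]; rfl
  have e1 : dh (sb N (X 1)) = A 1 := by rw [← dh_hz 1 (A 1), h1, sb_X]; rfl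
  have e2 : dh (sb N (X 2)) = P0 := by rw [← dh_hz 1 P0, h2, sb_X]; rfl
  have key : ∀ {n : ℕ} {a : MvPolynomial (Fin 3) k}, a.IsHomogeneous n → jj k K (dh (sb N a)) = ℓ (dh a) * jj k K P0 ^ n := by
    intro n a ha
    rw [sum_mon a]
    simp only [_root_.map_sum]
    rw [Finset.sum_mul]
    refine Finset.sum_congr rfl fun s hs => ?_
    have h' : s 0 + s 1 + s 2 = n := by
      rw [← deg3]; exact (ha.degree_eq_sum_deg_support hs).symm
    have hC1 : ∀ c : k, jj k K (dh (sb N (C c))) = algebraMap k K c := fun c => ((jj k K).comp (dh.comp (sb N))).commutes c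
    have hC2 : ∀ c : k, ℓ (dh (C c)) = algebraMap k K c := fun c => (ℓ.comp dh).commutes c
    rw [mon3]
    simp only [_root_.map_mul, _root_.map_pow, hC1, hC2, e0, e1, e2, hAP, dh_X0, dh_X1, dh_X2]
    rw [← h', _root_.map_one ℓ]
    ring
  have hfin : sb N f = c • g := by
    have hcg : (c • g).IsHomogeneous d := by rw [smul_eq_C_mul]; exact hg.C_mul c
    refine dh_inj (sb_hom N hf) hcg (jj_inj k K ?_)
    rw [key hf, hF, _root_.map_smul, _root_.map_smul, Algebra.smul_def]
  refine ⟨N, ?_, Units.mk0 c hc, hfin⟩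
  rw [isUnit_iff_ne_zero]
  intro hdet
  obtain ⟨v, hv, hvN⟩ := Matrix.exists_vecMul_eq_zero_iff.mpr hdet
  apply hv
  apply lin_zero (k := k)
  apply dh_eq_zero (hom_lin v)
  apply hℓ
  rw [map_zero]
  have h3 := key (hom_lin v)
  have h4 : sb N (∑ j, C (v j) * X j) = 0 := by
    have : ∀ j, sb N (C (v j)) = C (v j) := fun j => (sb N).commutes _
    simp only [_root_.map_sum, _root_.map_mul, sb_X, this, Finset.mul_sum]
    rw [Finset.sum_comm]
    refine Finset.sum_eq_zero fun j _ => ?_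
    have h5 := congrFun hvN j
    simp only [Matrix.vecMul, dotProduct, Pi.zero_apply] at h5
    have h6 := congrArg (C (σ := Fin 3)) h5
    rw [_root_.map_sum, C_0] at h6
    simp only [C_mul] at h6
    rw [← zero_mul (X j), ← h6, Finset.sum_mul]
    refine Finset.sum_congr rfl fun i _ => by ring
  rw [h4, map_zero, map_zero, eq_comm, mul_eq_zero] at h3
  rcases h3 with h3 | h3
  · exact h3
  · exact absurd h3 (pow_ne_zero _ (jj_ne K hP0))

end
end Yosh

open MvPolynomial
attribute [local instance] MvPolynomial.gradedAlgebra
namespace Yosh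
open scoped Polynomial

section
variable {k : Type} [Field k]

lemma PE_lin {f : MvPolynomial (Fin 3) k} (hf : f.IsHomogeneous 1) (h0 : f ≠ 0) : PE (X 2) f := by
  obtain ⟨v, rfl⟩ := lin_form hf
  have hv : v 0 ≠ 0 ∨ v 1 ≠ 0 ∨ v 2 ≠ 0 := by
    by_contra h
    push Not at h
    apply h0
    rw [Fin.sum_univ_three, h.1, h.2.1, h.2.2]; simp
  rcases hv with h | h | h
  · refine ⟨!![0,1,0;0,0,1;v 0, v 1, v 2], by simpa [Matrix.det_fin_three] using h, 1, ?_⟩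
    rw [sb_X, Fin.sum_univ_three, Fin.sum_univ_three]; simp
  · refine ⟨!![1,0,0;0,0,1;v 0, v 1, v 2], by simpa [Matrix.det_fin_three] using h, 1, ?_⟩
    rw [sb_X, Fin.sum_univ_three, Fin.sum_univ_three]; simp
  · refine ⟨!![1,0,0;0,1,0;v 0, v 1, v 2], by simpa [Matrix.det_fin_three] using h, 1, ?_⟩
    rw [sb_X, Fin.sum_univ_three, Fin.sum_univ_three]; simp

/-- general ternary quadratic form -/
noncomputable def QF (a b c p q r : k) : MvPolynomial (Fin 3) k :=
  C a * X 0 ^ 2 + C b * X 1 ^ 2 + C c * X 2 ^ 2 + C p * (X 0 * X 1) + C q * (X 0 * X 2) + C r * (X 1 * X 2)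

lemma quad_form {f : MvPolynomial (Fin 3) k} (hf : f.IsHomogeneous 2) : ∃ a b c p q r, f = QF a b c p q r := by
  have h := (mem_homogeneousSubmodule 2 f).mpr hf
  rw [← homogeneousSubmodule_one_pow, pow_two] at h
  refine Submodule.mul_induction_on h ?_ ?_
  · intro m hm n hn
    obtain ⟨v, rfl⟩ := lin_form ((mem_homogeneousSubmodule 1 m).mp hm)
    obtain ⟨w, rfl⟩ := lin_form ((mem_homogeneousSubmodule 1 n).mp hn)
    refine ⟨v 0 * w 0, v 1 * w 1, v 2 * w 2, v 0 * w 1 + v 1 * w 0, v 0 * w 2 + v 2 * w 0, v 1 * w 2 + v 2 * w 1, ?_⟩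
    rw [QF, Fin.sum_univ_three, Fin.sum_univ_three]
    simp only [C_mul, C_add]
    ring
  · rintro _ _ ⟨a, b, c, p, q, r, rfl⟩ ⟨a', b', c', p', q', r', rfl⟩
    refine ⟨a + a', b + b', c + c', p + p', q + q', r + r', ?_⟩
    simp only [QF, C_add]
    ring

lemma not_irr_mul {v w : Fin 3 → k} (h : Irreducible ((∑ j, C (v j) * X j : MvPolynomial (Fin 3) k) * (∑ j, C (w j) * X j))) : False := by
  rcases h.isUnit_or_isUnit rfl with h1 | h1
  · exact not_unit_hom (hom_lin v) one_pos h1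
  · exact not_unit_hom (hom_lin w) one_pos h1

lemma sb_C (M : Matrix (Fin 3) (Fin 3) k) (c : k) : sb M (C c) = C c := (sb M).commutes c

lemma PE_of_eq {f g : MvPolynomial (Fin 3) k} (M : Matrix (Fin 3) (Fin 3) k) (hM : IsUnit M.det) (h : sb M f = g) : PE f g :=
  ⟨M, hM, 1, by simpa using h⟩

lemma root2 [IsAlgClosed k] (a p b : k) (ha : a ≠ 0) : ∃ t, a * t ^ 2 + p * t + b = 0 := by
  obtain ⟨t, ht⟩ := IsAlgClosed.exists_root (Polynomial.C a * Polynomial.X ^ 2 + Polynomial.C p * Polynomial.X + Polynomial.C b)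
    (by rw [Polynomial.degree_quadratic ha]; norm_num)
  exact ⟨t, by simpa using ht⟩

lemma PE_irr {f g : MvPolynomial (Fin 3) k} (h : PE f g) (hf : Irreducible f) : Irreducible g := by
  obtain ⟨N, hN, c, e⟩ := h
  have := sb_irr hN hf
  rw [e] at this
  have h2 : Associated g ((c : k) • g) := by
    rw [smul_eq_C_mul, mul_comm]
    exact (associated_mul_unit_right g (C (c : k)) (c.isUnit.map C))
  exact h2.irreducible_iff.mpr this

lemma PE_conic [IsAlgClosed k] {f : MvPolynomial (Fin 3) k} (hf : f.IsHomogeneous 2) (hi : Irreducible f) :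
    PE f (QF 0 0 1 1 0 0) := by
  -- step 1
  obtain ⟨b, c, p, q, r, h1⟩ : ∃ b c p q r : k, PE f (QF 0 b c p q r) := by
    obtain ⟨a, b, c, p, q, r, rfl⟩ := quad_form hf
    by_cases ha : a = 0
    · subst ha
      exact ⟨b, c, p, q, r, 1, by simp, 1, by rw [sb_one]; simp⟩
    · obtain ⟨t, ht⟩ := root2 a p b ha
      refine ⟨a, c, a * t + a * t + p, q * t + r, q, PE_of_eq !![t,1,0;1,0,0;0,0,1] (by simp [Matrix.det_fin_three]) ?_⟩
      have ht' : (C a * C t ^ 2 + C p * C t + C b : MvPolynomial (Fin 3) k) = 0 := by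
        rw [← C_0, ← ht]; simp only [C_add, C_mul, C_pow]
      simp only [QF, _root_.map_add, _root_.map_mul, _root_.map_pow, sb_C, sb_X, Fin.sum_univ_three]
      simp
      linear_combination (X 0 ^ 2) * ht'
  have hi1 := PE_irr h1 hi
  -- step 2
  obtain ⟨b, c, p, q, r, h2, hp⟩ : ∃ b c p q r : k, PE f (QF 0 b c p q r) ∧ p ≠ 0 := by
    by_cases hp : p = 0
    · subst hp
      by_cases hq : q = 0
      · subst hq
        exfalso
        by_cases hb : b = 0
        · subst hb
          refine not_irr_mul (v := ![0,0,1]) (w := ![0,r,c]) ?_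
          convert hi1 using 1
          simp only [QF, Fin.sum_univ_three]
          simp
          ring
        · obtain ⟨t, ht⟩ := root2 b r c hb
          refine not_irr_mul (v := ![0,1,-t]) (w := ![0,b,b * t + r]) ?_
          convert hi1 using 1
          have ht' : (C b * C t ^ 2 + C r * C t + C c : MvPolynomial (Fin 3) k) = 0 := by
            rw [← C_0, ← ht]; simp only [C_add, C_mul, C_pow]
          simp only [QF, Fin.sum_univ_three]
          simp
          linear_combination (-X 2 ^ 2) * ht'
      · refine ⟨c, b, q, 0, r, h1.trans (PE_of_eq !![1,0,0;0,0,1;0,1,0] (by simp [Matrix.det_fin_three]) ?_), hq⟩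
        simp only [QF, _root_.map_add, _root_.map_mul, _root_.map_pow, sb_C, sb_X, Fin.sum_univ_three]
        simp
        ring
    · exact ⟨b, c, p, q, r, h1, hp⟩
  -- step 3
  obtain ⟨b, c, r, h3⟩ : ∃ b c r : k, PE f (QF 0 b c 1 0 r) := by
    refine ⟨b * (p⁻¹ * p⁻¹), b * q ^ 2 * (p⁻¹ * p⁻¹) + c - r * q / p, -(b * q * (p⁻¹ * p⁻¹)) - b * q * (p⁻¹ * p⁻¹) + r / p, h2.trans (PE_of_eq !![1,0,0;0,1/p,-q/p;0,0,1] (by simpa [Matrix.det_fin_three] using hp) ?_)⟩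
    have hp' : (C p * C p⁻¹ : MvPolynomial (Fin 3) k) = 1 := by rw [← C_mul, mul_inv_cancel₀ hp, C_1]
    simp only [QF, _root_.map_add, _root_.map_mul, _root_.map_pow, sb_C, sb_X, Fin.sum_univ_three]
    simp [div_eq_mul_inv]
    linear_combination (X 0 * X 1 - C q * X 0 * X 2) * hp'
  -- step 4
  have h4 : PE f (QF 0 0 c 1 0 0) := by
    refine h3.trans (PE_of_eq !![1,-b,-r;0,1,0;0,0,1] (by simp [Matrix.det_fin_three]) ?_)
    simp only [QF, _root_.map_add, _root_.map_mul, _root_.map_pow, sb_C, sb_X, Fin.sum_univ_three]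
    simp
    ring
  have hi4 := PE_irr h4 hi
  have hc : c ≠ 0 := by
    rintro rfl
    refine not_irr_mul (k := k) (v := ![1,0,0]) (w := ![0,1,0]) ?_
    convert hi4 using 1
    simp only [QF, Fin.sum_univ_three]
    simp
  obtain ⟨s, hs⟩ := root2 c 0 (-1) hc
  have hs0 : s ≠ 0 := by rintro rfl; simp at hs
  refine h4.trans (PE_of_eq !![1,0,0;0,1,0;0,0,s] (by simpa [Matrix.det_fin_three] using hs0) ?_)
  have hs' : (C c * C s ^ 2 - 1 : MvPolynomial (Fin 3) k) = 0 := by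
    rw [← C_0, ← hs]; simp [sub_eq_add_neg]
  simp only [QF, _root_.map_add, _root_.map_mul, _root_.map_pow, sb_C, sb_X, Fin.sum_univ_three]
  simp
  linear_combination (X 2 ^ 2) * hs'

end
end Yosh

open MvPolynomial
attribute [local instance] MvPolynomial.gradedAlgebra
namespace Yosh
open scoped Polynomial

lemma main_PE (k : Type) [Field k] [IsAlgClosed k]
    (f : MvPolynomial (Fin 3) k) (d : ℕ) (hd : 0 < d)
    (hf : f.IsHomogeneous d) (hfirr : Irreducible f)
    (M : Matrix (Fin 3) (Fin 3) k) (hM : IsUnit M.det)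
    (hline : Nonempty ((MvPolynomial (Fin 2) k ⧸ Ideal.span {dh (sb M f)}) ≃ₐ[k] Polynomial k))
    (g : MvPolynomial (Fin 3) k) (e : ℕ)
    (hg : g.IsHomogeneous e) (hgirr : Irreducible g)
    (hiso : Nonempty (AwayRing k f ≃ₐ[k] AwayRing k g)) : PE g f := by
  have he := hom_pos hg hgirr
  obtain ⟨M', hM', hg2⟩ := exists_M g hgirr
  have hfi := sb_irr hM hfirr
  have hgi := sb_irr hM' hgirr
  have hf2 := line_not_dvd hfi hline
  have hfh := sb_hom M hf
  have hgh := sb_hom M' hg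
  have hF : Prime (dh (sb M f)) := (dh_irr hfh hf2 hfi hd).prime
  have hG : Prime (dh (sb M' g)) := (dh_irr hgh hg2 hgi he).prime
  obtain ⟨Ψ, hΨ⟩ := exists_Psi (K := FractionRing (MvPolynomial (Fin 2) k)) hf hg hd he hfirr.ne_zero hgirr.ne_zero hM hM' hiso
  have dF := dh_deg_eq hfh hf2
  have dG := dh_deg_eq hgh hg2
  obtain ⟨hed, p, hp⟩ := pt_final hF hG dF dG hd he Ψ hΨ
  subst hed
  by_cases h1 : e = 1
  · subst h1
    exact (PE_lin hg hgirr.ne_zero).symm.trans (PE_lin hf hfirr.ne_zero)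
  by_cases h2 : e = 2
  · subst h2
    exact (PE_conic hg hgirr).trans (PE_conic hf hfirr).symm
  obtain ⟨ε, hs, hk⟩ := exists_eps hline
  have S : Setup (dh (sb M f)) (dh (sb M' g)) e Ψ := ⟨hF, hG, dF, dG, by omega, hΨ, p, hp⟩
  obtain ⟨ℓ, P0, A, c, hℓ, hP0, hc, hP, hA, hAP, hfin⟩ := S.final ε hs hk
  have h3 : PE (sb M f) (sb M' g) := finish hfh hgh ℓ P0 A c hℓ hP0 hc hP hA hAP hfin
  exact (PE.sb hM').trans (h3.symm.trans (PE.sb hM).symm)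

end Yosh
theorem yoshihara_very_tangent_line (k : Type) [Field k] [IsAlgClosed k]
    (f : MvPolynomial (Fin 3) k) (d : ℕ) (hd : 0 < d)
    (hf : f.IsHomogeneous d) (hfirr : Irreducible f)
    (hline : ∃ M : Matrix (Fin 3) (Fin 3) k, IsUnit M.det ∧
      Nonempty ((MvPolynomial (Fin 2) k ⧸
          Ideal.span { aeval ![(X 0 : MvPolynomial (Fin 2) k), X 1, 1]
            (aeval (fun i => ∑ j, C (M i j) * X j) f) }) ≃ₐ[k] Polynomial k))
    (g : MvPolynomial (Fin 3) k) (e : ℕ)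
    (hg : g.IsHomogeneous e) (hgirr : Irreducible g)
    (hiso : Nonempty (AwayRing k f ≃ₐ[k] AwayRing k g)) :
    ProjEquiv g f := by
  obtain ⟨M, hM, hl⟩ := hline
  exact Yosh.main_PE k f d hd hf hfirr M hM hl g e hg hgirr hiso
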